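/- Let φ and φ₀ be psh functions on the unit polydisc Δⁿ ⊆ ℂⁿ and let f₀ be a tuple of holomorphic functions on Δⁿ such that |f₀|²e^{-2φ₀} is integrable near the origin o. Assume that φ ≥ N·log|z| + O(1) near o for some sufficiently large N > 0, that |f₀|²e^{-2(φ+φ₀)} is not integrable near o, and that |f₀|²e^{-2((1-ε)φ+φ₀)} is integrable near o for every ε ∈ (0,1). Then for some neighborhood U ⊂⊂ Δⁿ of o, lim_{t→+∞} [ -log ∫_{{φ<-t}∩U} |f₀|²e^{-2φ₀} ] / (2t) = 1. -/

import Mathlib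

open MeasureTheory Filter Topology
open scoped ENNReal NNReal

noncomputable section

/-- `ℂⁿ`. -/
abbrev Cn (n : ℕ) : Type := Fin n → ℂ

variable {n : ℕ}

/-- The exponential function `EReal → ℝ≥0∞`, with `exp ⊥ = 0` and `exp ⊤ = ⊤`. -/
def expE (x : EReal) : ℝ≥0∞ :=
  if x = ⊥ then 0 else if x = ⊤ then ⊤ else ENNReal.ofReal (Real.exp x.toReal)

/-- The logarithm `ℝ → EReal`, with value `⊥` for `x ≤ 0`. -/
def elog (x : ℝ) : EReal := if x ≤ 0 then (⊥ : EReal) else ((Real.log x : ℝ) : EReal)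

/-- The density `e^{c·φ} : ℂⁿ → [0,∞]` associated to an extended-real-valued `φ`. -/
def wexp (c : ℝ) (φ : Cn n → EReal) (z : Cn n) : ℝ≥0∞ := expE ((c : EReal) * φ z)

/-- `|f₀|² = ∑ⱼ |f₀ⱼ|²` as a `[0,∞]`-valued density, for a tuple `f₀` of functions. -/
def normSq2 {m : ℕ} (f₀ : Fin m → Cn n → ℂ) (z : Cn n) : ℝ≥0∞ :=
  ∑ j, (‖f₀ j z‖₊ : ℝ≥0∞) ^ 2

/-- `log |f₀| = (1/2) log ∑ⱼ |f₀ⱼ|²` for a tuple `f₀`. -/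
def logAbsT {m : ℕ} (f₀ : Fin m → Cn n → ℂ) (z : Cn n) : EReal :=
  elog (Real.sqrt (∑ j, ‖f₀ j z‖ ^ 2))

/-- The weight `|f₀|² e^{-2φ₀}`. -/
def dens0 {m : ℕ} (f₀ : Fin m → Cn n → ℂ) (φ₀ : Cn n → EReal) (z : Cn n) : ℝ≥0∞ :=
  normSq2 f₀ z * wexp (-2) φ₀ z

/-- A nonnegative function is (Lebesgue-)integrable near the origin. -/
def IntNear (g : Cn n → ℝ≥0∞) : Prop := ∃ U ∈ 𝓝 (0 : Cn n), (∫⁻ z in U, g z) < ⊤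

/-- `ψ ≤ φ + O(1)` near the origin. -/
def leO (ψ φ : Cn n → EReal) : Prop := ∃ C : ℝ, ∀ᶠ z in 𝓝 (0 : Cn n), ψ z ≤ φ z + (C : EReal)

/-- `ψ = φ + O(1)` near the origin. -/
def eqO (ψ φ : Cn n → EReal) : Prop := leO ψ φ ∧ leO φ ψ

/-- The truncated average of `u` over the circle `θ ↦ z + r e^{iθ} w`, truncated below at `-m`. -/
def circleAvg (u : Cn n → EReal) (z w : Cn n) (r : ℝ) (m : ℕ) : ℝ :=
  (2 * Real.pi)⁻¹ * ∫ θ in (0:ℝ)..(2 * Real.pi),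
    (max (u (z + ((r : ℂ) * Complex.exp (Complex.I * (θ : ℂ))) • w)) ((-(m : ℝ) : ℝ) : EReal)).toReal

/-- `u` is plurisubharmonic on `Ω`: it is upper semicontinuous on `Ω`, takes values in
`[-∞, ∞)`, is not identically `-∞` on any connected component of `Ω`, and satisfies the
sub-mean value inequality on all small circles inside complex lines. -/
structure PSHOn (u : Cn n → EReal) (Ω : Set (Cn n)) : Prop where
  usc : UpperSemicontinuousOn u Ω
  lt_top : ∀ z ∈ Ω, u z < ⊤
  not_botOnComponents : ∀ z ∈ Ω, ∃ w ∈ connectedComponentIn Ω z, u w ≠ ⊥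
  submean : ∀ z ∈ Ω, ∀ w : Cn n, ∃ ε > 0, ∀ r : ℝ, 0 < r → r < ε →
    u z ≤ ⨅ m : ℕ, ((circleAvg u z w r m : ℝ) : EReal)

/-- `u` is plurisubharmonic near the origin. -/
def PSHNear (u : Cn n → EReal) : Prop := ∃ U ∈ 𝓝 (0 : Cn n), IsOpen U ∧ PSHOn u U

/-- `f` is holomorphic near the origin. -/
def HoloNear (f : Cn n → ℂ) : Prop := ∃ U ∈ 𝓝 (0 : Cn n), IsOpen U ∧ DifferentiableOn ℂ f U

/-- `Φ` is a (local) Zhou weight near the origin related to a general nonnegative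
weight `W`. -/
structure IsZhouWeightFor (W : Cn n → ℝ≥0∞) (Φ : Cn n → EReal) : Prop where
  psh : PSHNear Φ
  intN : ∃ N₁ : ℕ, ∀ N₀ : ℕ, N₁ ≤ N₀ →
    IntNear fun z => W z * ENNReal.ofReal (‖z‖ ^ (2 * N₀)) * wexp (-2) Φ z
  nonint : ¬ IntNear fun z => W z * wexp (-2) Φ z
  maximal : ∀ φ' : Cn n → EReal, PSHNear φ' → leO Φ φ' →
    (¬ IntNear fun z => W z * wexp (-2) φ' z) → eqO φ' Φ

/-- `Φ` is a local Zhou weight related to `|f₀|² e^{-2φ₀}` near the origin (including the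
standing assumptions that `f₀` is a tuple of holomorphic functions near `o`, `φ₀` is
plurisubharmonic near `o`, and `|f₀|² e^{-2φ₀}` is integrable near `o`). -/
structure IsLocalZhouWeight {m : ℕ} (f₀ : Fin m → Cn n → ℂ) (φ₀ : Cn n → EReal)
    (Φ : Cn n → EReal) : Prop where
  holo : ∀ j, HoloNear (f₀ j)
  psh₀ : PSHNear φ₀
  int₀ : IntNear (dens0 f₀ φ₀)
  zhou : IsZhouWeightFor (dens0 f₀ φ₀) Φ

/-- The Zhou number (relative type) `σ(ψ, Φ) = sup { b ≥ 0 : ψ ≤ bΦ + O(1) near o }`. -/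
def zhouNumber (ψ Φ : Cn n → EReal) : ℝ :=
  sSup {b : ℝ | 0 ≤ b ∧ leO ψ fun z => (b : EReal) * Φ z}

/-- `log ‖f‖ : ℂⁿ → EReal`. -/
def logAbs (f : Cn n → ℂ) (z : Cn n) : EReal := elog ‖f z‖

/-- `ν(f, Φ) = σ(log|f|, Φ)`. -/
def nuNumber (f : Cn n → ℂ) (Φ : Cn n → EReal) : ℝ := zhouNumber (logAbs f) Φ

/-- The jumping number `c_o^G(Φ) = sup { c ≥ 0 : |G|² e^{-2cΦ} integrable near o }`. -/
def jumping (G : Cn n → ℂ) (Φ : Cn n → EReal) : ℝ :=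
  sSup {c : ℝ | 0 ≤ c ∧ IntNear fun z => (‖G z‖₊ : ℝ≥0∞) ^ 2 * wexp (-2 * c) Φ z}

/-- The inclusion `ℐ(φ)ₒ ⊆ ℐ(ψ)ₒ` of multiplier ideals at the origin. -/
def mIdealLE (φ ψ : Cn n → EReal) : Prop :=
  ∀ f : Cn n → ℂ, HoloNear f →
    (IntNear fun z => (‖f z‖₊ : ℝ≥0∞) ^ 2 * wexp (-2) φ z) →
    IntNear fun z => (‖f z‖₊ : ℝ≥0∞) ^ 2 * wexp (-2) ψ z

/-- The Tian function `Tn(t; f, v, φ₀) = sup { c ≥ 0 : |f|^{2t} e^{-2cv - 2φ₀} integrable near o }`. -/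
def tian (t : ℝ) (f : Cn n → ℂ) (v φ₀ : Cn n → EReal) : ℝ :=
  sSup {c : ℝ | 0 ≤ c ∧
    IntNear fun z => ENNReal.ofReal (‖f z‖ ^ (2 * t)) * wexp (-2 * c) v z * wexp (-2) φ₀ z}

/-- The unit polydisc `Δⁿ ⊆ ℂⁿ`. -/
def polydisc (n : ℕ) : Set (Cn n) := {z | ∀ j, ‖z j‖ < 1}

open scoped ContDiff ComplexConjugate

/-- The `j`-th standard basis vector of `ℂⁿ`. -/
def stdVec (j : Fin n) : Cn n := Pi.single j 1

/-- The Wirtinger derivative `∂/∂z̄ⱼ`. -/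
def dbar (j : Fin n) (u : Cn n → ℂ) (z : Cn n) : ℂ :=
  (1 / 2) * (fderiv ℝ u z (stdVec j) + Complex.I * fderiv ℝ u z (Complex.I • stdVec j))

/-- The Wirtinger derivative `∂/∂zⱼ`. -/
def dwir (j : Fin n) (u : Cn n → ℂ) (z : Cn n) : ℂ :=
  (1 / 2) * (fderiv ℝ u z (stdVec j) - Complex.I * fderiv ℝ u z (Complex.I • stdVec j))

section Wirtinger

variable {u v : Cn n → ℂ} {z : Cn n} (j k : Fin n)

lemma dbar_mul (hu : DifferentiableAt ℝ u z) (hv : DifferentiableAt ℝ v z) :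
    dbar j (fun w => u w * v w) z = dbar j u z * v z + u z * dbar j v z := by
  simp only [dbar, fderiv_fun_mul hu hv, _root_.add_apply,
    _root_.smul_apply, smul_eq_mul]
  ring

lemma dwir_mul (hu : DifferentiableAt ℝ u z) (hv : DifferentiableAt ℝ v z) :
    dwir j (fun w => u w * v w) z = dwir j u z * v z + u z * dwir j v z := by
  simp only [dwir, fderiv_fun_mul hu hv, _root_.add_apply,
    _root_.smul_apply, smul_eq_mul]
  ring

lemma dbar_add (hu : DifferentiableAt ℝ u z) (hv : DifferentiableAt ℝ v z) :
    dbar j (fun w => u w + v w) z = dbar j u z + dbar j v z := by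
  simp only [dbar, fderiv_fun_add hu hv, _root_.add_apply]
  ring

lemma dbar_sub (hu : DifferentiableAt ℝ u z) (hv : DifferentiableAt ℝ v z) :
    dbar j (fun w => u w - v w) z = dbar j u z - dbar j v z := by
  simp only [dbar, fderiv_fun_sub hu hv, _root_.sub_apply]
  ring

lemma fderiv_conj (u : Cn n → ℂ) (z w : Cn n) :
    fderiv ℝ (fun w => conj (u w)) z w = conj (fderiv ℝ u z w) := by
  have := Complex.conjCLE.comp_fderiv (f := u) (x := z)
  have h2 : (⇑Complex.conjCLE ∘ u) = fun w => conj (u w) := by ext; simp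
  rw [h2] at this
  rw [this]; simp

lemma dbar_conj : dbar j (fun w => conj (u w)) z = conj (dwir j u z) := by
  simp only [dbar, dwir, fderiv_conj, map_mul, map_sub, Complex.conj_I, map_div₀, map_one,
    Complex.conj_ofNat]
  ring

lemma contDiff_fderiv_vec (hu : ContDiff ℝ ∞ u) (w : Cn n) :
    ContDiff ℝ ∞ (fun z => fderiv ℝ u z w) :=
  (hu.fderiv_right (m := ∞) (by simp)).clm_apply contDiff_const

lemma contDiff_dbar (hu : ContDiff ℝ ∞ u) : ContDiff ℝ ∞ (dbar j u) := by
  unfold dbar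
  exact contDiff_const.mul ((contDiff_fderiv_vec hu _).add
    (contDiff_const.mul (contDiff_fderiv_vec hu _)))

lemma contDiff_dwir (hu : ContDiff ℝ ∞ u) : ContDiff ℝ ∞ (dwir j u) := by
  unfold dwir
  exact contDiff_const.mul ((contDiff_fderiv_vec hu _).sub
    (contDiff_const.mul (contDiff_fderiv_vec hu _)))

lemma hasCompactSupport_dbar (hu : HasCompactSupport u) : HasCompactSupport (dbar j u) := by
  refine (hu.fderiv (𝕜 := ℝ)).mono fun z hz => ?_
  rw [Function.mem_support] at hz ⊢
  contrapose! hz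
  simp [dbar, hz]

lemma hasCompactSupport_dwir (hu : HasCompactSupport u) : HasCompactSupport (dwir j u) := by
  refine (hu.fderiv (𝕜 := ℝ)).mono fun z hz => ?_
  rw [Function.mem_support] at hz ⊢
  contrapose! hz
  simp [dwir, hz]

lemma fderiv_fderiv_vec (hu : ContDiff ℝ ∞ u) (w w' : Cn n) :
    fderiv ℝ (fun z => fderiv ℝ u z w) z w' = fderiv ℝ (fderiv ℝ u) z w' w := by
  have h : DifferentiableAt ℝ (fderiv ℝ u) z :=
    ((hu.fderiv_right (m := ∞) (by simp)).differentiable (by simp)) z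
  rw [fderiv_clm_apply h (differentiableAt_const _)]
  simp

lemma fderiv_dwir (hu : ContDiff ℝ ∞ u) (w : Cn n) :
    fderiv ℝ (dwir j u) z w = (1 / 2) * (fderiv ℝ (fderiv ℝ u) z w (stdVec j)
      - Complex.I * fderiv ℝ (fderiv ℝ u) z w (Complex.I • stdVec j)) := by
  have d := fun w => (((contDiff_fderiv_vec hu w).differentiable (by simp)) z).hasFDerivAt
  have h := (((d (stdVec j)).sub ((d (Complex.I • stdVec j)).const_mul Complex.I)).const_mul
    (1 / 2 : ℂ)).fderiv
  have h2 := congrArg (fun L => L w) h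
  rw [show dwir j u = fun z => _ from rfl]
  simp only [dwir]
  refine h2.trans ?_
  simp [fderiv_fderiv_vec hu]

lemma fderiv_dbar (hu : ContDiff ℝ ∞ u) (w : Cn n) :
    fderiv ℝ (dbar j u) z w = (1 / 2) * (fderiv ℝ (fderiv ℝ u) z w (stdVec j)
      + Complex.I * fderiv ℝ (fderiv ℝ u) z w (Complex.I • stdVec j)) := by
  have d := fun w => (((contDiff_fderiv_vec hu w).differentiable (by simp)) z).hasFDerivAt
  have h := (((d (stdVec j)).add ((d (Complex.I • stdVec j)).const_mul Complex.I)).const_mul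
    (1 / 2 : ℂ)).fderiv
  have h2 := congrArg (fun L => L w) h
  rw [show dbar j u = fun z => _ from rfl]
  simp only [dbar]
  refine h2.trans ?_
  simp [fderiv_fderiv_vec hu]
  ring

lemma isSymmSndFDerivAt_of_contDiff {F : Type*} [NormedAddCommGroup F] [NormedSpace ℝ F]
    {u : Cn n → F} (hu : ContDiff ℝ ∞ u) : IsSymmSndFDerivAt ℝ u z :=
  hu.contDiffAt.isSymmSndFDerivAt (by
    rw [minSmoothness_of_isRCLikeNormedField]
    exact WithTop.coe_le_coe.2 (le_top : (2 : ℕ∞) ≤ ⊤))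

lemma dbar_dwir_comm (hu : ContDiff ℝ ∞ u) : dbar k (dwir j u) z = dwir j (dbar k u) z := by
  have hs : IsSymmSndFDerivAt ℝ u z := isSymmSndFDerivAt_of_contDiff hu
  rw [dbar, dwir]
  simp only [fderiv_dwir _ hu, fderiv_dbar _ hu]
  rw [hs (stdVec j) (stdVec k), hs (stdVec j) (Complex.I • stdVec k),
    hs (Complex.I • stdVec j) (stdVec k), hs (Complex.I • stdVec j) (Complex.I • stdVec k)]
  ring

lemma dbar_dbar_comm (hu : ContDiff ℝ ∞ u) : dbar k (dbar j u) z = dbar j (dbar k u) z := by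
  have hs : IsSymmSndFDerivAt ℝ u z := isSymmSndFDerivAt_of_contDiff hu
  rw [dbar, dbar]
  simp only [fderiv_dbar _ hu]
  rw [hs (stdVec j) (stdVec k), hs (stdVec j) (Complex.I • stdVec k),
    hs (Complex.I • stdVec j) (stdVec k), hs (Complex.I • stdVec j) (Complex.I • stdVec k)]
  ring

lemma integral_fderiv_mul_eq {u v : Cn n → ℂ} (hu : ContDiff ℝ ∞ u) (hv : ContDiff ℝ ∞ v)
    (hc : HasCompactSupport u) (w : Cn n) :
    ∫ z, u z * fderiv ℝ v z w = -∫ z, fderiv ℝ u z w * v z := by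
  have hcu : HasCompactSupport (fun z => fderiv ℝ u z w) := hc.fderiv_apply (𝕜 := ℝ) w
  apply integral_mul_fderiv_eq_neg_fderiv_mul_of_integrable
  · exact ((contDiff_fderiv_vec hu w).continuous.mul hv.continuous).integrable_of_hasCompactSupport
      hcu.mul_right
  · exact (hu.continuous.mul (contDiff_fderiv_vec hv w).continuous).integrable_of_hasCompactSupport
      hc.mul_right
  · exact (hu.continuous.mul hv.continuous).integrable_of_hasCompactSupport hc.mul_right
  · exact fun z _ => hu.differentiable (by simp) z
  · exact fun z _ => hv.differentiable (by simp) z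

lemma integral_mul_dbar (hu : ContDiff ℝ ∞ u) (hv : ContDiff ℝ ∞ v)
    (hc : HasCompactSupport u) : ∫ z, u z * dbar j v z = -∫ z, dbar j u z * v z := by
  have hcu : ∀ w, HasCompactSupport (fun z => fderiv ℝ u z w) := fun w => hc.fderiv_apply (𝕜 := ℝ) w
  have i1 : ∀ w, Integrable fun z => u z * fderiv ℝ v z w := fun w =>
    (hu.continuous.mul (contDiff_fderiv_vec hv w).continuous).integrable_of_hasCompactSupport
      hc.mul_right
  have i2 : ∀ w, Integrable fun z => fderiv ℝ u z w * v z := fun w =>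
    ((contDiff_fderiv_vec hu w).continuous.mul hv.continuous).integrable_of_hasCompactSupport
      (hcu w).mul_right
  calc ∫ z, u z * dbar j v z
      = ∫ z, ((1 / 2) * (u z * fderiv ℝ v z (stdVec j)) +
          (1 / 2 * Complex.I) * (u z * fderiv ℝ v z (Complex.I • stdVec j))) := by
        congr 1; ext z; simp only [dbar]; ring
    _ = -∫ z, ((1 / 2) * (fderiv ℝ u z (stdVec j) * v z) +
          (1 / 2 * Complex.I) * (fderiv ℝ u z (Complex.I • stdVec j) * v z)) := by
        rw [integral_add ((i1 _).const_mul _) ((i1 _).const_mul _), integral_const_mul,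
          integral_const_mul, integral_add ((i2 _).const_mul _) ((i2 _).const_mul _),
          integral_const_mul, integral_const_mul, integral_fderiv_mul_eq hu hv hc,
          integral_fderiv_mul_eq hu hv hc]
        ring
    _ = -∫ z, dbar j u z * v z := by
        congr 2; ext z; simp only [dbar]; ring

end Wirtinger

/-- The Levi form `∑ ∂²ψ/∂zⱼ∂z̄ₖ bⱼ b̄ₖ` of a real function, in real coordinates. -/
def levi (ψ : Cn n → ℝ) (z b : Cn n) : ℝ :=
  (1 / 4) * (fderiv ℝ (fderiv ℝ ψ) z b b
    + fderiv ℝ (fderiv ℝ ψ) z (Complex.I • b) (Complex.I • b))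

/-- The Hermitian form attached to a real bilinear form on `ℂⁿ`. -/
def hermForm (B : Cn n →L[ℝ] Cn n →L[ℝ] ℝ) (b c : Cn n) : ℂ :=
  (B c b + B (Complex.I • c) (Complex.I • b) : ℝ)
    + Complex.I * (B (Complex.I • c) b - B c (Complex.I • b) : ℝ)

lemma complex_smul_eq (a : ℂ) (b : Cn n) : a • b = a.re • b + a.im • (Complex.I • b) := by
  conv_lhs => rw [← Complex.re_add_im a]
  rw [add_smul, mul_smul]
  rfl

lemma I_smul_I_smul (b : Cn n) : Complex.I • (Complex.I • b) = -b := by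
  rw [smul_smul, Complex.I_mul_I, neg_one_smul]

lemma hermForm_smul_left (B : Cn n →L[ℝ] Cn n →L[ℝ] ℝ) (a : ℂ) (b c : Cn n) :
    hermForm B (a • b) c = a * hermForm B b c := by
  have h1 : Complex.I • a • b = a.re • (Complex.I • b) + a.im • (-b) := by
    rw [smul_comm, complex_smul_eq a, I_smul_I_smul]
  simp only [hermForm, h1]
  rw [complex_smul_eq a b]
  simp only [map_add, map_smul, map_neg, smul_eq_mul]
  apply Complex.ext <;> simp <;> ring

lemma hermForm_smul_right (B : Cn n →L[ℝ] Cn n →L[ℝ] ℝ) (a : ℂ) (b c : Cn n) :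
    hermForm B b (a • c) = conj a * hermForm B b c := by
  have h1 : Complex.I • a • c = a.re • (Complex.I • c) + a.im • (-c) := by
    rw [smul_comm, complex_smul_eq a, I_smul_I_smul]
  simp only [hermForm, h1]
  rw [complex_smul_eq a c]
  simp only [map_add, map_smul, map_neg, smul_eq_mul, _root_.add_apply, _root_.smul_apply,
    _root_.neg_apply]
  apply Complex.ext <;> simp <;> ring

lemma hermForm_add_left (B : Cn n →L[ℝ] Cn n →L[ℝ] ℝ) (b b' c : Cn n) :
    hermForm B (b + b') c = hermForm B b c + hermForm B b' c := by
  simp only [hermForm, smul_add, map_add]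
  push_cast
  ring

lemma hermForm_add_right (B : Cn n →L[ℝ] Cn n →L[ℝ] ℝ) (b c c' : Cn n) :
    hermForm B b (c + c') = hermForm B b c + hermForm B b c' := by
  simp only [hermForm, smul_add, map_add, _root_.add_apply]
  push_cast
  ring

lemma eq_sum_stdVec (b : Cn n) : b = ∑ j, b j • stdVec j := by
  ext i
  simp [stdVec, Finset.sum_apply, Pi.single_apply]

lemma hermForm_eq_sum (B : Cn n →L[ℝ] Cn n →L[ℝ] ℝ) (b c : Cn n) :
    hermForm B b c = ∑ j, ∑ k, hermForm B (stdVec j) (stdVec k) * b j * conj (c k) := by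
  let L : Cn n → Cn n →+ ℂ := fun c =>
    AddMonoidHom.mk' (fun b => hermForm B b c) fun b b' => hermForm_add_left B b b' c
  let R : Cn n → Cn n →+ ℂ := fun b =>
    AddMonoidHom.mk' (fun c => hermForm B b c) fun c c' => hermForm_add_right B b c c'
  have h1 : ∀ c, hermForm B b c = ∑ j, b j * hermForm B (stdVec j) c := fun c => by
    calc hermForm B b c = L c (∑ j, b j • stdVec j) := by rw [← eq_sum_stdVec]; rfl
      _ = _ := by
        rw [map_sum]
        exact Finset.sum_congr rfl fun j _ => hermForm_smul_left B _ _ _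
  have h2 : ∀ b, hermForm B b c = ∑ k, conj (c k) * hermForm B b (stdVec k) := fun b => by
    calc hermForm B b c = R b (∑ j, c j • stdVec j) := by rw [← eq_sum_stdVec]; rfl
      _ = _ := by
        rw [map_sum]
        exact Finset.sum_congr rfl fun j _ => hermForm_smul_right B _ _ _
  rw [h1]
  refine Finset.sum_congr rfl fun j _ => ?_
  rw [h2, Finset.mul_sum]
  refine Finset.sum_congr rfl fun k _ => ?_
  ring

lemma contDiff_ofReal_comp {ψ : Cn n → ℝ} (hψ : ContDiff ℝ ∞ ψ) :
    ContDiff ℝ ∞ (fun z => (ψ z : ℂ)) := Complex.ofRealCLM.contDiff.comp hψ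

lemma fderiv_ofReal {ψ : Cn n → ℝ} (hψ : ContDiff ℝ ∞ ψ) (z w : Cn n) :
    fderiv ℝ (fun z => (ψ z : ℂ)) z w = (fderiv ℝ ψ z w : ℂ) := by
  have := (Complex.ofRealCLM.hasFDerivAt.comp z
    ((hψ.differentiable (by simp)) z).hasFDerivAt).fderiv
  have h2 := congrArg (fun L => L w) this
  exact h2

lemma fderiv_fderiv_ofReal {ψ : Cn n → ℝ} (hψ : ContDiff ℝ ∞ ψ) (z w w' : Cn n) :
    fderiv ℝ (fderiv ℝ (fun z => (ψ z : ℂ))) z w' w = (fderiv ℝ (fderiv ℝ ψ) z w' w : ℂ) := by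
  rw [← fderiv_fderiv_vec (contDiff_ofReal_comp hψ)]
  simp only [fderiv_ofReal hψ]
  have h : ContDiff ℝ ∞ (fun z => fderiv ℝ ψ z w) :=
    (hψ.fderiv_right (m := ∞) (by simp)).clm_apply contDiff_const
  rw [fderiv_ofReal h]
  have hd : DifferentiableAt ℝ (fderiv ℝ ψ) z :=
    ((hψ.fderiv_right (m := ∞) (by simp)).differentiable (by simp)) z
  rw [fderiv_clm_apply hd (differentiableAt_const _)]
  simp

lemma dbar_dwir_ofReal {ψ : Cn n → ℝ} (hψ : ContDiff ℝ ∞ ψ) (z : Cn n) (j k : Fin n) :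
    dbar k (dwir j (fun z => (ψ z : ℂ))) z
      = (1 / 4) * hermForm (fderiv ℝ (fderiv ℝ ψ) z) (stdVec j) (stdVec k) := by
  rw [dbar, fderiv_dwir _ (contDiff_ofReal_comp hψ), fderiv_dwir _ (contDiff_ofReal_comp hψ)]
  simp only [fderiv_fderiv_ofReal hψ, hermForm]
  apply Complex.ext <;> simp <;> ring

lemma sum_dbar_dwir_eq_levi {ψ : Cn n → ℝ} (hψ : ContDiff ℝ ∞ ψ) (z b : Cn n) :
    ∑ j, ∑ k, dbar k (dwir j (fun z => (ψ z : ℂ))) z * b j * conj (b k) = (levi ψ z b : ℂ) := by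
  have hs : IsSymmSndFDerivAt ℝ ψ z := isSymmSndFDerivAt_of_contDiff hψ
  simp only [dbar_dwir_ofReal hψ, mul_assoc, ← Finset.mul_sum]
  simp only [← mul_assoc]
  rw [← hermForm_eq_sum]
  simp only [hermForm, levi, hs (Complex.I • b) b]
  push_cast
  ring

/-- The formal adjoint of `-∂̄ⱼ` in `L²(e^{-ψ})`. -/
def dadj (ψ : Cn n → ℝ) (j : Fin n) (u : Cn n → ℂ) (z : Cn n) : ℂ :=
  dwir j u z - dwir j (fun z => (ψ z : ℂ)) z * u z

section

variable {ψ : Cn n → ℝ} {u w : Cn n → ℂ} {z : Cn n}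

lemma contDiff_dadj (hψ : ContDiff ℝ ∞ ψ) (j : Fin n) (hu : ContDiff ℝ ∞ u) :
    ContDiff ℝ ∞ (dadj ψ j u) :=
  (contDiff_dwir j hu).sub ((contDiff_dwir j (contDiff_ofReal_comp hψ)).mul hu)

lemma hasCompactSupport_dadj (ψ : Cn n → ℝ) (j : Fin n) (hu : HasCompactSupport u) :
    HasCompactSupport (dadj ψ j u) :=
  (hasCompactSupport_dwir j hu).sub hu.mul_left

lemma contDiff_expWeight (hψ : ContDiff ℝ ∞ ψ) :
    ContDiff ℝ ∞ (fun z => (Real.exp (-ψ z) : ℂ)) :=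
  contDiff_ofReal_comp (Real.contDiff_exp.comp hψ.neg)

lemma contDiff_conj (hu : ContDiff ℝ ∞ u) : ContDiff ℝ ∞ (fun z => conj (u z)) :=
  Complex.conjCLE.contDiff.comp hu

lemma hasCompactSupport_conj (hc : HasCompactSupport u) :
    HasCompactSupport (fun z => conj (u z)) :=
  hc.comp_left (g := fun x : ℂ => conj x) (by simp)

lemma conj_dwir_ofReal (ψ : Cn n → ℝ) (j : Fin n) (z : Cn n) :
    conj (dwir j (fun z => (ψ z : ℂ)) z) = dbar j (fun z => (ψ z : ℂ)) z := by
  rw [← dbar_conj]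
  simp

lemma dbar_expWeight (hψ : ContDiff ℝ ∞ ψ) (j : Fin n) :
    dbar j (fun z => (Real.exp (-ψ z) : ℂ)) z
      = -dbar j (fun z => (ψ z : ℂ)) z * (Real.exp (-ψ z) : ℂ) := by
  have hd := (hψ.differentiable (by simp)) z
  have h : ∀ w, fderiv ℝ (fun z => (Real.exp (-ψ z) : ℂ)) z w
      = -(fderiv ℝ ψ z w : ℂ) * (Real.exp (-ψ z) : ℂ) := fun w => by
    rw [fderiv_ofReal (ψ := fun z => Real.exp (-ψ z)) (Real.contDiff_exp.comp hψ.neg)]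
    rw [show fderiv ℝ (fun z => Real.exp (-ψ z)) z = _ from (hd.hasFDerivAt.neg.exp).fderiv]
    simp
    ring
  simp only [dbar, h, fderiv_ofReal hψ]
  ring

lemma integral_dbar_mul_conj (hψ : ContDiff ℝ ∞ ψ) (k : Fin n) (hu : ContDiff ℝ ∞ u)
    (hw : ContDiff ℝ ∞ w) (hcw : HasCompactSupport w) :
    ∫ z, dbar k u z * conj (w z) * (Real.exp (-ψ z) : ℂ)
      = -∫ z, u z * conj (dadj ψ k w z) * (Real.exp (-ψ z) : ℂ) := by
  have hW := contDiff_expWeight hψ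
  have h := integral_mul_dbar k (u := fun z => conj (w z) * (Real.exp (-ψ z) : ℂ)) (v := u)
    ((contDiff_conj hw).mul hW) hu (hasCompactSupport_conj hcw).mul_right
  rw [show (fun z => dbar k u z * conj (w z) * (Real.exp (-ψ z) : ℂ))
    = fun z => (fun z => conj (w z) * (Real.exp (-ψ z) : ℂ)) z * dbar k u z by ext; ring, h]
  congr 2
  ext z
  rw [dbar_mul k ((contDiff_conj hw).differentiable (by simp) z)
    (hW.differentiable (by simp) z), dbar_conj, dbar_expWeight hψ, dadj, map_sub, map_mul,
    conj_dwir_ofReal]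
  ring

lemma integral_conj_dbar_mul (hψ : ContDiff ℝ ∞ ψ) (k : Fin n) (hu : ContDiff ℝ ∞ u)
    (hw : ContDiff ℝ ∞ w) (hcw : HasCompactSupport w) :
    ∫ z, w z * conj (dbar k u z) * (Real.exp (-ψ z) : ℂ)
      = -∫ z, dadj ψ k w z * conj (u z) * (Real.exp (-ψ z) : ℂ) := by
  have h := congrArg conj (integral_dbar_mul_conj hψ k hu hw hcw)
  rw [map_neg, ← integral_conj, ← integral_conj] at h
  simp only [map_mul, Complex.conj_conj, Complex.conj_ofReal] at h
  calc _ = ∫ z, conj (dbar k u z) * w z * (Real.exp (-ψ z) : ℂ) := by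
        congr 1; ext z; ring
    _ = _ := h
    _ = _ := by congr 2; ext z; ring

lemma dbar_dadj (hψ : ContDiff ℝ ∞ ψ) (j k : Fin n) (hu : ContDiff ℝ ∞ u) :
    dbar k (dadj ψ j u) z = dadj ψ j (dbar k u) z
      - dbar k (dwir j (fun z => (ψ z : ℂ))) z * u z := by
  have h1 := (contDiff_dwir j hu).differentiable (by simp) z
  have h2 := (contDiff_dwir j (contDiff_ofReal_comp hψ)).differentiable (by simp) z
  have h3 := hu.differentiable (by simp) z
  rw [show dadj ψ j u = fun z => dwir j u z - dwir j (fun z => (ψ z : ℂ)) z * u z from rfl,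
    dbar_sub k h1 (h2.fun_mul h3), dbar_mul k h2 h3, dbar_dwir_comm j k hu, dadj]
  ring

lemma integral_dadj_mul_conj_dadj (hψ : ContDiff ℝ ∞ ψ) (j k : Fin n) (hu : ContDiff ℝ ∞ u)
    (hcu : HasCompactSupport u) (hw : ContDiff ℝ ∞ w) (hcw : HasCompactSupport w) :
    ∫ z, dadj ψ j u z * conj (dadj ψ k w z) * (Real.exp (-ψ z) : ℂ)
      = (∫ z, dbar k u z * conj (dbar j w z) * (Real.exp (-ψ z) : ℂ))
        + ∫ z, dbar k (dwir j (fun z => (ψ z : ℂ))) z * u z * conj (w z)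
            * (Real.exp (-ψ z) : ℂ) := by
  have hW := (contDiff_expWeight hψ).continuous
  have h1 := integral_dbar_mul_conj hψ k (contDiff_dadj hψ j hu) hw hcw
  have h2 := integral_conj_dbar_mul hψ j hw (contDiff_dbar k hu) (hasCompactSupport_dbar k hcu)
  have hcc : HasCompactSupport fun z => conj (w z) := hasCompactSupport_conj hcw
  rw [← neg_eq_iff_eq_neg] at h1
  rw [← h1, h2, ← integral_neg, ← integral_neg, ← integral_add]
  · congr 1
    ext z
    rw [dbar_dadj hψ j k hu]
    ring
  · refine (Continuous.integrable_of_hasCompactSupport ?_ ?_).neg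
    · exact ((contDiff_dadj hψ j (contDiff_dbar k hu)).continuous.mul
        (contDiff_conj hw).continuous).mul hW
    · exact hcc.mul_left.mul_right
  · refine (Continuous.integrable_of_hasCompactSupport ?_ ?_)
    · exact ((((contDiff_dbar k (contDiff_dwir j (contDiff_ofReal_comp hψ))).mul hu).continuous.mul
        (contDiff_conj hw).continuous)).mul hW
    · exact hcc.mul_left.mul_right

end

/-- The Morrey–Kohn–Hörmander inequality for compactly supported smooth forms. -/
theorem morrey_kohn_hormander {ψ : Cn n → ℝ} (hψ : ContDiff ℝ ∞ ψ) {β : Fin n → Cn n → ℂ}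
    (hβ : ∀ j, ContDiff ℝ ∞ (β j)) (hc : ∀ j, HasCompactSupport (β j)) :
    ∫ z, levi ψ z (fun j => β j z) * Real.exp (-ψ z)
      ≤ (∫ z, ‖∑ j, dadj ψ j (β j) z‖ ^ 2 * Real.exp (-ψ z))
        + (1 / 2) * ∑ j, ∑ k, ∫ z, ‖dbar k (β j) z - dbar j (β k) z‖ ^ 2 * Real.exp (-ψ z) := by
  have hW := (contDiff_expWeight hψ).continuous
  have hWr : Continuous fun z => Real.exp (-ψ z) := Real.continuous_exp.comp hψ.continuous.neg
  have hcc : ∀ j, HasCompactSupport fun z => conj (β j z) :=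
    fun j => hasCompactSupport_conj (hc j)
  -- the three quadratic expressions as complex integrals
  have hA : ((∫ z, ‖∑ j, dadj ψ j (β j) z‖ ^ 2 * Real.exp (-ψ z) : ℝ) : ℂ)
      = ∑ j, ∑ k, ∫ z, dadj ψ j (β j) z * conj (dadj ψ k (β k) z) * (Real.exp (-ψ z) : ℂ) := by
    rw [← integral_complex_ofReal]
    have hi : ∀ j k, Integrable fun z =>
        dadj ψ j (β j) z * conj (dadj ψ k (β k) z) * (Real.exp (-ψ z) : ℂ) := fun j k => by
      refine Continuous.integrable_of_hasCompactSupport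
        (((contDiff_dadj hψ j (hβ j)).continuous.mul
          (contDiff_conj (contDiff_dadj hψ k (hβ k))).continuous).mul hW) ?_
      exact (hasCompactSupport_dadj ψ j (hc j)).mul_right.mul_right
    simp_rw [← integral_finsetSum _ fun k _ => hi _ k]
    rw [← integral_finsetSum _ fun j _ => integrable_finsetSum _ fun k _ => hi j k]
    congr 1
    ext z
    push_cast
    rw [← Complex.mul_conj', map_sum, Finset.sum_mul_sum]
    simp only [Finset.sum_mul]
  have hL : ((∫ z, levi ψ z (fun j => β j z) * Real.exp (-ψ z) : ℝ) : ℂ)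
      = ∑ j, ∑ k, ∫ z, dbar k (dwir j (fun z => (ψ z : ℂ))) z * β j z * conj (β k z)
            * (Real.exp (-ψ z) : ℂ) := by
    rw [← integral_complex_ofReal]
    have hi : ∀ j k, Integrable fun z => dbar k (dwir j (fun z => (ψ z : ℂ))) z * β j z
        * conj (β k z) * (Real.exp (-ψ z) : ℂ) := fun j k => by
      refine (Continuous.integrable_of_hasCompactSupport ?_ ?_)
      · exact ((((contDiff_dbar k (contDiff_dwir j (contDiff_ofReal_comp hψ))).mul
          (hβ j)).continuous.mul (contDiff_conj (hβ k)).continuous)).mul hW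
      · exact (hcc k).mul_left.mul_right
    simp_rw [← integral_finsetSum _ fun k _ => hi _ k]
    rw [← integral_finsetSum _ fun j _ => integrable_finsetSum _ fun k _ => hi j k]
    congr 1
    ext z
    push_cast
    rw [← sum_dbar_dwir_eq_levi hψ, Finset.sum_mul]
    simp only [Finset.sum_mul]
  have hD : ∀ j k, Integrable fun z =>
      dbar k (β j) z * conj (dbar j (β k) z) * (Real.exp (-ψ z) : ℂ) := fun j k => by
    refine Continuous.integrable_of_hasCompactSupport
      (((contDiff_dbar k (hβ j)).continuous.mul
        (contDiff_conj (contDiff_dbar j (hβ k))).continuous).mul hW) ?_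
    exact (hasCompactSupport_dbar k (hc j)).mul_right.mul_right
  have hN : ∀ j k, Integrable fun z => ‖dbar k (β j) z‖ ^ 2 * Real.exp (-ψ z) := fun j k => by
    refine Continuous.integrable_of_hasCompactSupport
      (((contDiff_dbar k (hβ j)).continuous.norm.pow 2).mul hWr) ?_
    exact ((hasCompactSupport_dbar k (hc j)).comp_left (g := fun x : ℂ => ‖x‖ ^ 2)
      (by simp)).mul_right
  have key : (∫ z, ‖∑ j, dadj ψ j (β j) z‖ ^ 2 * Real.exp (-ψ z))
      = (∑ j, ∑ k, (∫ z, dbar k (β j) z * conj (dbar j (β k) z) * (Real.exp (-ψ z) : ℂ)).re)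
        + ∫ z, levi ψ z (fun j => β j z) * Real.exp (-ψ z) := by
    have : ((∫ z, ‖∑ j, dadj ψ j (β j) z‖ ^ 2 * Real.exp (-ψ z) : ℝ) : ℂ)
      = (∑ j, ∑ k, (∫ z, dbar k (β j) z * conj (dbar j (β k) z) * (Real.exp (-ψ z) : ℂ)))
        + ((∫ z, levi ψ z (fun j => β j z) * Real.exp (-ψ z) : ℝ) : ℂ) := by
      rw [hA, hL, ← Finset.sum_add_distrib]
      refine Finset.sum_congr rfl fun j _ => ?_
      rw [← Finset.sum_add_distrib]
      refine Finset.sum_congr rfl fun k _ => ?_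
      exact integral_dadj_mul_conj_dadj hψ j k (hβ j) (hc j) (hβ k) (hc k)
    have h2 := congrArg Complex.re this
    simpa [Complex.re_sum] using h2
  have hpt : ∀ j k, (∫ z, ‖dbar k (β j) z - dbar j (β k) z‖ ^ 2 * Real.exp (-ψ z))
      = (∫ z, ‖dbar k (β j) z‖ ^ 2 * Real.exp (-ψ z))
        + (∫ z, ‖dbar j (β k) z‖ ^ 2 * Real.exp (-ψ z))
        - 2 * (∫ z, dbar k (β j) z * conj (dbar j (β k) z) * (Real.exp (-ψ z) : ℂ)).re := by
    intro j k
    have hre : (∫ z, dbar k (β j) z * conj (dbar j (β k) z) * (Real.exp (-ψ z) : ℂ)).re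
        = ∫ z, (dbar k (β j) z * conj (dbar j (β k) z) * (Real.exp (-ψ z) : ℂ)).re :=
      (integral_re (hD j k)).symm
    have hDr : Integrable fun z =>
        (dbar k (β j) z * conj (dbar j (β k) z) * (Real.exp (-ψ z) : ℂ)).re := (hD j k).re
    rw [hre, ← integral_add (hN j k) (hN k j), ← integral_const_mul,
      ← integral_sub ((hN j k).fun_add (hN k j)) (hDr.const_mul 2)]
    congr 1
    ext z
    rw [Complex.re_mul_ofReal, ← Complex.normSq_eq_norm_sq, ← Complex.normSq_eq_norm_sq,
      ← Complex.normSq_eq_norm_sq, Complex.normSq_sub]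
    ring
  have hsum : (1 / 2) * ∑ j, ∑ k, ∫ z, ‖dbar k (β j) z - dbar j (β k) z‖ ^ 2 * Real.exp (-ψ z)
      = (∑ j, ∑ k, ∫ z, ‖dbar k (β j) z‖ ^ 2 * Real.exp (-ψ z))
        - ∑ j, ∑ k, (∫ z, dbar k (β j) z * conj (dbar j (β k) z)
          * (Real.exp (-ψ z) : ℂ)).re := by
    simp only [hpt, Finset.sum_sub_distrib, Finset.sum_add_distrib, ← Finset.mul_sum]
    rw [Finset.sum_comm (f := fun j k => ∫ z, ‖dbar j (β k) z‖ ^ 2 * Real.exp (-ψ z))]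
    ring
  have hpos : 0 ≤ ∑ j, ∑ k, ∫ z, ‖dbar k (β j) z‖ ^ 2 * Real.exp (-ψ z) :=
    Finset.sum_nonneg fun j _ => Finset.sum_nonneg fun k _ =>
      integral_nonneg fun z => by positivity
  rw [key, hsum]
  linarith

/-- Convolution `∫ ρ(z - y) c(y) dy` with a real kernel. -/
def moll {F : Type*} [NormedAddCommGroup F] [NormedSpace ℝ F] (ρ : Cn n → ℝ) (c : Cn n → F)
    (z : Cn n) : F := ∫ y, ρ (z - y) • c y

/-- Smooth, rotation invariant probability densities supported in the ball of radius `ε`. -/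
structure IsMollifier (ρ : Cn n → ℝ) (ε : ℝ) : Prop where
  smooth : ContDiff ℝ ∞ ρ
  nonneg : ∀ z, 0 ≤ ρ z
  supp : ∀ z, ρ z ≠ 0 → ‖z‖ < ε
  integral_eq_one : ∫ z, ρ z = 1
  rot : ∀ (c : ℂ) (z : Cn n), ‖c‖ = 1 → ρ (c • z) = ρ z

section moll

variable {F : Type*} [NormedAddCommGroup F] [NormedSpace ℝ F]
  {ρ : Cn n → ℝ} {ε : ℝ} {c : Cn n → F}

lemma IsMollifier.hasCompactSupport (h : IsMollifier ρ ε) : HasCompactSupport ρ :=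
  HasCompactSupport.intro (isCompact_closedBall 0 ε) fun z hz => by
    by_contra h0
    exact hz (by simpa using (h.supp z h0).le)

lemma IsMollifier.integrable (h : IsMollifier ρ ε) : Integrable ρ :=
  h.smooth.continuous.integrable_of_hasCompactSupport h.hasCompactSupport

lemma IsMollifier.pos (h : IsMollifier ρ ε) : 0 < ε := by
  by_contra! hε
  have : ρ = 0 := by
    ext z
    by_contra h0
    exact absurd ((norm_nonneg z).trans_lt (h.supp z h0)) (not_lt.2 hε)
  simpa [this] using h.integral_eq_one

lemma IsMollifier.neg_apply (h : IsMollifier ρ ε) (z : Cn n) : ρ (-z) = ρ z := by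
  simpa using h.rot (-1) z (by simp)

lemma contDiff_sum_norm_sq : ContDiff ℝ ∞ (fun z : Cn n => ∑ j, ‖z j‖ ^ 2) :=
  ContDiff.sum fun j _ => (contDiff_apply ℝ ℂ j).norm_sq ℝ

lemma norm_sq_le_sum (z : Cn n) : ‖z‖ ^ 2 ≤ ∑ j, ‖z j‖ ^ 2 := by
  have h : ‖z‖ ≤ √(∑ j, ‖z j‖ ^ 2) := by
    refine (pi_norm_le_iff_of_nonneg (Real.sqrt_nonneg _)).2 fun j => Real.le_sqrt_of_sq_le ?_
    exact Finset.single_le_sum (f := fun j => ‖z j‖ ^ 2) (fun i _ => by positivity)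
      (Finset.mem_univ j)
  calc ‖z‖ ^ 2 ≤ √(∑ j, ‖z j‖ ^ 2) ^ 2 := by gcongr
    _ = _ := Real.sq_sqrt (by positivity)

lemma exists_isMollifier {ε : ℝ} (hε : 0 < ε) : ∃ ρ : Cn n → ℝ, IsMollifier ρ ε := by
  set ρ₀ : Cn n → ℝ := fun z => Real.smoothTransition (1 - (∑ j, ‖z j‖ ^ 2) / ε ^ 2) with hρ₀
  have hs : ContDiff ℝ ∞ ρ₀ :=
    Real.smoothTransition.contDiff.comp (contDiff_const.sub (contDiff_sum_norm_sq.div_const _))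
  have hsupp : ∀ z, ρ₀ z ≠ 0 → ‖z‖ < ε := by
    intro z hz
    have h1 : 0 < 1 - (∑ j, ‖z j‖ ^ 2) / ε ^ 2 := by
      by_contra! h
      exact hz (Real.smoothTransition.zero_of_nonpos h)
    have h2 : ∑ j, ‖z j‖ ^ 2 < ε ^ 2 := by
      rw [sub_pos, div_lt_one (by positivity)] at h1
      exact h1
    exact lt_of_pow_lt_pow_left₀ 2 hε.le ((norm_sq_le_sum z).trans_lt h2)
  have hc : HasCompactSupport ρ₀ :=
    HasCompactSupport.intro (isCompact_closedBall 0 ε) fun z hz => by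
      by_contra h0
      exact hz (by simpa using (hsupp z h0).le)
  have hpos : 0 < ∫ z, ρ₀ z := by
    refine hs.continuous.integral_pos_of_hasCompactSupport_nonneg_nonzero hc
      (fun z => Real.smoothTransition.nonneg _) (x := 0) ?_
    simp [hρ₀]
  refine ⟨fun z => (∫ z, ρ₀ z)⁻¹ * ρ₀ z, contDiff_const.mul hs,
    fun z => mul_nonneg (inv_nonneg.2 hpos.le) (Real.smoothTransition.nonneg _),
    fun z hz => hsupp z (right_ne_zero_of_mul hz), ?_, ?_⟩
  · rw [integral_const_mul, inv_mul_cancel₀ hpos.ne']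
  · intro c z hc
    simp [hρ₀, hc]

lemma moll_eq_convolution (ρ : Cn n → ℝ) (c : Cn n → F) :
    moll ρ c = convolution ρ c (ContinuousLinearMap.lsmul ℝ ℝ) volume := by
  ext z
  rw [convolution_lsmul_swap]
  rfl

lemma integrable_kernel_smul (hρ : Continuous ρ) (hρc : HasCompactSupport ρ)
    (hc : LocallyIntegrable c) (z : Cn n) : Integrable fun y => ρ (z - y) • c y :=
  hc.integrable_smul_left_of_hasCompactSupport (by fun_prop)
    (hρc.comp_homeomorph (Homeomorph.subLeft z))

lemma contDiff_moll (hρ : ContDiff ℝ ∞ ρ) (hρc : HasCompactSupport ρ)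
    (hc : LocallyIntegrable c) : ContDiff ℝ ∞ (moll ρ c) := by
  rw [moll_eq_convolution]
  exact hρc.contDiff_convolution_left _ hρ hc

lemma hasCompactSupport_moll (hρc : HasCompactSupport ρ) (hc : HasCompactSupport c) :
    HasCompactSupport (moll ρ c) := by
  rw [moll_eq_convolution]
  exact hρc.convolution _ hc

lemma fderiv_moll [CompleteSpace F] (hρ : ContDiff ℝ ∞ ρ) (hρc : HasCompactSupport ρ)
    (hc : LocallyIntegrable c) (z w : Cn n) :
    fderiv ℝ (moll ρ c) z w = ∫ y, (fderiv ℝ ρ (z - y) w) • c y := by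
  rw [moll_eq_convolution, (hρc.hasFDerivAt_convolution_left (ContinuousLinearMap.lsmul ℝ ℝ)
    (hρ.of_le (by simp)) hc z).fderiv, convolution_eq_swap, ContinuousLinearMap.integral_apply]
  · simp [ContinuousLinearMap.precompL_apply]
  · have hf : Continuous (fderiv ℝ ρ) := hρ.continuous_fderiv (by simp)
    have := (hρc.fderiv (𝕜 := ℝ)).convolutionExists_left
      ((ContinuousLinearMap.lsmul ℝ ℝ).precompL (Cn n) : (Cn n →L[ℝ] ℝ) →L[ℝ] F →L[ℝ] Cn n →L[ℝ] F)
      hf hc z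
    exact this.integrable_swap

end moll

lemma dbar_moll {ρ : Cn n → ℝ} {c : Cn n → ℂ} (hρ : ContDiff ℝ ∞ ρ) (hρc : HasCompactSupport ρ)
    (hc : LocallyIntegrable c) (k : Fin n) (z : Cn n) :
    dbar k (moll ρ c) z = ∫ y, dbar k (fun z => (ρ z : ℂ)) (z - y) * c y := by
  have hi : ∀ w, Integrable fun y => (fderiv ℝ ρ (z - y) w) • c y := fun w =>
    integrable_kernel_smul (ρ := fun z => fderiv ℝ ρ z w)
      ((hρ.continuous_fderiv (by simp)).clm_apply continuous_const)
      (hρc.fderiv_apply (𝕜 := ℝ) w) hc z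
  rw [dbar, fderiv_moll hρ hρc hc, fderiv_moll hρ hρc hc, ← integral_const_mul,
    ← integral_add (hi _) ((hi _).const_mul _), ← integral_const_mul]
  congr 1
  ext y
  simp only [dbar, fderiv_ofReal hρ, Complex.real_smul]
  ring

lemma dwir_moll {ρ : Cn n → ℝ} {c : Cn n → ℂ} (hρ : ContDiff ℝ ∞ ρ) (hρc : HasCompactSupport ρ)
    (hc : LocallyIntegrable c) (k : Fin n) (z : Cn n) :
    dwir k (moll ρ c) z = ∫ y, dwir k (fun z => (ρ z : ℂ)) (z - y) * c y := by
  have hi : ∀ w, Integrable fun y => (fderiv ℝ ρ (z - y) w) • c y := fun w =>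
    integrable_kernel_smul (ρ := fun z => fderiv ℝ ρ z w)
      ((hρ.continuous_fderiv (by simp)).clm_apply continuous_const)
      (hρc.fderiv_apply (𝕜 := ℝ) w) hc z
  rw [dwir, fderiv_moll hρ hρc hc, fderiv_moll hρ hρc hc, ← integral_const_mul,
    ← integral_sub (hi _) ((hi _).const_mul _), ← integral_const_mul]
  congr 1
  ext y
  simp only [dwir, fderiv_ofReal hρ, Complex.real_smul]
  ring

lemma fderiv_comp_const_sub {u : Cn n → ℂ} (z y w : Cn n) :
    fderiv ℝ (fun y => u (z - y)) y w = -fderiv ℝ u (z - y) w := by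
  have h := fderiv_comp_smul (𝕜 := ℝ) (f := fun y => u (z + y)) (x := y) (-1)
  rw [fderiv_comp_add_left] at h
  simp only [neg_smul, one_smul, ← sub_eq_add_neg] at h
  rw [h]
  rfl

lemma dbar_comp_const_sub (k : Fin n) (u : Cn n → ℂ) (z y : Cn n) :
    dbar k (fun y => u (z - y)) y = -dbar k u (z - y) := by
  simp only [dbar, fderiv_comp_const_sub]
  ring

lemma dwir_comp_const_sub (k : Fin n) (u : Cn n → ℂ) (z y : Cn n) :
    dwir k (fun y => u (z - y)) y = -dwir k u (z - y) := by
  simp only [dwir, fderiv_comp_const_sub]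
  ring

lemma norm_stdVec_le (j : Fin n) : ‖stdVec j‖ ≤ 1 := by
  refine (pi_norm_le_iff_of_nonneg zero_le_one).2 fun i => ?_
  by_cases h : i = j <;> simp [stdVec, h]

lemma norm_dbar_le (j : Fin n) (u : Cn n → ℂ) (z : Cn n) : ‖dbar j u z‖ ≤ ‖fderiv ℝ u z‖ := by
  have h1 := (fderiv ℝ u z).le_of_opNorm_le_of_le le_rfl (norm_stdVec_le j)
  have h2 := (fderiv ℝ u z).le_of_opNorm_le_of_le le_rfl
    (show ‖Complex.I • stdVec j‖ ≤ 1 by rw [norm_smul]; simpa using norm_stdVec_le j)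
  rw [dbar, norm_mul]
  have h3 := norm_add_le (fderiv ℝ u z (stdVec j)) (Complex.I * fderiv ℝ u z (Complex.I • stdVec j))
  rw [norm_mul, Complex.norm_I] at h3
  norm_num at h1 h2 h3 ⊢
  linarith

lemma norm_dwir_le (j : Fin n) (u : Cn n → ℂ) (z : Cn n) : ‖dwir j u z‖ ≤ ‖fderiv ℝ u z‖ := by
  have h1 := (fderiv ℝ u z).le_of_opNorm_le_of_le le_rfl (norm_stdVec_le j)
  have h2 := (fderiv ℝ u z).le_of_opNorm_le_of_le le_rfl
    (show ‖Complex.I • stdVec j‖ ≤ 1 by rw [norm_smul]; simpa using norm_stdVec_le j)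
  rw [dwir, norm_mul]
  have h3 := norm_sub_le (fderiv ℝ u z (stdVec j)) (Complex.I * fderiv ℝ u z (Complex.I • stdVec j))
  rw [norm_mul, Complex.norm_I] at h3
  norm_num at h1 h2 h3 ⊢
  linarith

/-- Cutoff functions with arbitrarily small gradient. -/
lemma exists_cutoff {K : Set (Cn n)} (hK : IsCompact K) {s : ℝ} (hs : 0 < s) :
    ∃ χ : Cn n → ℝ, ContDiff ℝ ∞ χ ∧ HasCompactSupport χ ∧ (∀ z, 0 ≤ χ z ∧ χ z ≤ 1) ∧
      (∀ z ∈ K, χ z = 1) ∧ (∀ j z, ‖dbar j (fun z => (χ z : ℂ)) z‖ ≤ s) ∧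
      (∀ j z, ‖dwir j (fun z => (χ z : ℂ)) z‖ ≤ s) := by
  let f : ContDiffBump (0 : Cn n) := ⟨1, 2, by norm_num, by norm_num⟩
  have hf : ContDiff ℝ ∞ (fun z => (f z : ℂ)) := contDiff_ofReal_comp f.contDiff
  obtain ⟨C, hC⟩ : ∃ C, ∀ z, ‖fderiv ℝ (fun z => (f z : ℂ)) z‖ ≤ C := by
    have hcs : HasCompactSupport (fun z => (f z : ℂ)) :=
      f.hasCompactSupport.comp_left (g := fun x : ℝ => (x : ℂ)) (by simp)
    exact (hcs.fderiv (𝕜 := ℝ)).exists_bound_of_continuous (hf.continuous_fderiv (by simp))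
  obtain ⟨R₀, hR₀⟩ := hK.isBounded.subset_closedBall 0
  set R := max (max R₀ 1) (C / s) with hR
  have hR1 : 0 < R := lt_max_of_lt_left (lt_max_of_lt_right one_pos)
  have hsm : ContDiff ℝ ∞ (fun z : Cn n => R⁻¹ • z) := contDiff_const_smul _
  have hd : ∀ z, ‖fderiv ℝ (fun z => (f (R⁻¹ • z) : ℂ)) z‖ ≤ s := fun z => by
    rw [show fderiv ℝ (fun z => (f (R⁻¹ • z) : ℂ)) z
      = R⁻¹ • fderiv ℝ (fun z => (f z : ℂ)) (R⁻¹ • z) from fderiv_comp_smul (f := fun z => (f z : ℂ)) R⁻¹ , norm_smul,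
      Real.norm_of_nonneg (inv_nonneg.2 hR1.le), inv_mul_le_iff₀ hR1]
    refine (hC _).trans ?_
    rw [← div_le_iff₀ hs]
    exact le_max_right _ _
  refine ⟨fun z => f (R⁻¹ • z), f.contDiff.comp hsm,
    f.hasCompactSupport.comp_smul (inv_ne_zero hR1.ne'), fun z => ⟨f.nonneg, f.le_one⟩,
    fun z hz => f.one_of_mem_closedBall ?_, fun j z => (norm_dbar_le j _ z).trans (hd z),
    fun j z => (norm_dwir_le j _ z).trans (hd z)⟩
  have := hR₀ hz
  simp only [mem_closedBall_zero_iff] at this ⊢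
  rw [norm_smul, Real.norm_of_nonneg (inv_nonneg.2 hR1.le), inv_mul_le_iff₀ hR1, mul_one]
  exact this.trans ((le_max_left _ _).trans (le_max_left _ _))

lemma locallyIntegrable_of_weighted {ψ : Cn n → ℝ} (hψ : Continuous ψ) {b : Cn n → ℂ}
    (hb : AEStronglyMeasurable b) (hi : Integrable fun z => ‖b z‖ ^ 2 * Real.exp (-ψ z)) :
    LocallyIntegrable b := by
  have h1 : LocallyIntegrable fun z => Real.exp (ψ z) :=
    (Real.continuous_exp.comp hψ).locallyIntegrable
  refine (h1.add hi.locallyIntegrable).mono hb (Eventually.of_forall fun z => ?_)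
  simp only [Pi.add_apply]
  rw [Real.norm_of_nonneg (by positivity), Real.exp_neg]
  have he := Real.exp_pos (ψ z)
  rw [← sub_nonneg, show Real.exp (ψ z) + ‖b z‖ ^ 2 * (Real.exp (ψ z))⁻¹ - ‖b z‖
    = ((Real.exp (ψ z) - ‖b z‖ / 2) ^ 2 + 3 / 4 * ‖b z‖ ^ 2) * (Real.exp (ψ z))⁻¹ by
      field_simp; ring]
  positivity

lemma sq_le_mul_of_quadratic {A B X : ℝ} (h : ∀ t : ℝ, 0 ≤ A * (t * t) + (-2 * X) * t + B) :
    X ^ 2 ≤ A * B := by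
  have := discrim_le_zero h
  rw [discrim] at this
  nlinarith

lemma quadratic_nonneg_of_sq_le {q l x : ℝ} (hq : 0 ≤ q) (hl : 0 ≤ l)
    (h : x ^ 2 ≤ q * l) (t : ℝ) : 0 ≤ q * (t * t) + (-2 * x) * t + l := by
  have h1 : |x * t| ≤ √q * √l * |t| := by
    rw [abs_mul]
    gcongr
    rw [← Real.sqrt_mul hq]
    exact Real.abs_le_sqrt h
  have h2 := le_abs_self (x * t)
  have h3 := sq_nonneg (√q * |t| - √l)
  have h4 := Real.sq_sqrt hq
  have h5 := Real.sq_sqrt hl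
  have h6 := sq_abs t
  nlinarith

section Jensen

variable {ρ : Cn n → ℝ} {ε : ℝ}

lemma IsMollifier.integral_sub_left (hρ : IsMollifier ρ ε) (z : Cn n) :
    ∫ y, ρ (z - y) = 1 := by
  rw [integral_sub_left_eq_self ρ volume z, hρ.integral_eq_one]

lemma IsMollifier.moll_sq_le (hρ : IsMollifier ρ ε) {G : Cn n → ℝ} (hG : LocallyIntegrable G)
    (hG2 : LocallyIntegrable fun z => G z ^ 2) (z : Cn n) :
    moll ρ G z ^ 2 ≤ moll ρ (fun z => G z ^ 2) z := by
  have i0 : Integrable fun y => ρ (z - y) := hρ.integrable.comp_sub_left z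
  have i1 := integrable_kernel_smul hρ.smooth.continuous hρ.hasCompactSupport hG z
  have i2 := integrable_kernel_smul hρ.smooth.continuous hρ.hasCompactSupport hG2 z
  simp only [smul_eq_mul] at i1 i2
  set e := moll ρ G z with he
  have h : 0 ≤ ∫ y, (ρ (z - y) * G y ^ 2 - 2 * e * (ρ (z - y) * G y) + e ^ 2 * ρ (z - y)) := by
    refine integral_nonneg fun y => ?_
    have := mul_nonneg (hρ.nonneg (z - y)) (sq_nonneg (G y - e))
    simp only [Pi.zero_apply]
    nlinarith
  have i3 : Integrable fun y => ρ (z - y) * G y ^ 2 - 2 * e * (ρ (z - y) * G y) :=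
    i2.sub (i1.const_mul _)
  rw [integral_add i3 (i0.const_mul _), integral_sub i2 (i1.const_mul _),
    integral_const_mul, integral_const_mul, hρ.integral_sub_left] at h
  have h1 : ∫ y, ρ (z - y) * G y = e := rfl
  have h2 : ∫ y, ρ (z - y) * G y ^ 2 = moll ρ (fun z => G z ^ 2) z := rfl
  rw [h1, h2] at h
  nlinarith

lemma IsMollifier.integrable_moll (hρ : IsMollifier ρ ε) {F : Type*} [NormedAddCommGroup F]
    [NormedSpace ℝ F] {g : Cn n → F} (hg : Integrable g) : Integrable (moll ρ g) := by
  rw [moll_eq_convolution]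
  exact hρ.integrable.integrable_convolution _ hg

lemma IsMollifier.integral_moll (hρ : IsMollifier ρ ε) {F : Type*} [NormedAddCommGroup F]
    [NormedSpace ℝ F] [CompleteSpace F] {g : Cn n → F} (hg : Integrable g) :
    ∫ z, moll ρ g z = ∫ z, g z := by
  rw [moll_eq_convolution, integral_convolution _ hρ.integrable hg]
  simp [hρ.integral_eq_one]

lemma IsMollifier.moll_mono (hρ : IsMollifier ρ ε) {g g' : Cn n → ℝ} (hg : LocallyIntegrable g)
    (hg' : LocallyIntegrable g') (z : Cn n) (h : ∀ y, ‖z - y‖ < ε → g y ≤ g' y) :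
    moll ρ g z ≤ moll ρ g' z := by
  refine integral_mono
    (integrable_kernel_smul hρ.smooth.continuous hρ.hasCompactSupport hg z)
    (integrable_kernel_smul hρ.smooth.continuous hρ.hasCompactSupport hg' z) fun y => ?_
  simp only [smul_eq_mul]
  by_cases h0 : ρ (z - y) = 0
  · simp [h0]
  · exact mul_le_mul_of_nonneg_left (h y (hρ.supp _ h0)) (hρ.nonneg _)

/-- Weighted Jensen inequality for mollifications of functions supported in `K`. -/
lemma IsMollifier.integral_moll_sq_le (hρ : IsMollifier ρ ε) {ψ : Cn n → ℝ} (hψ : Continuous ψ)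
    {s : ℝ} {K : Set (Cn n)} (hK : IsCompact K)
    (hψK : ∀ y ∈ K, ∀ z, ‖z - y‖ < ε → Real.exp (-ψ z) ≤ (1 + s) * Real.exp (-ψ y))
    {G : Cn n → ℝ} (hGK : ∀ z, z ∉ K → G z = 0) (hG : AEStronglyMeasurable G)
    (hi : Integrable fun z => G z ^ 2 * Real.exp (-ψ z)) :
    Integrable (fun z => moll ρ G z ^ 2 * Real.exp (-ψ z)) ∧
      ∫ z, moll ρ G z ^ 2 * Real.exp (-ψ z) ≤ (1 + s) * ∫ z, G z ^ 2 * Real.exp (-ψ z) := by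
  have hGc : HasCompactSupport G := HasCompactSupport.intro hK hGK
  have hGl : LocallyIntegrable G := by
    have := locallyIntegrable_of_weighted hψ (b := fun z => (G z : ℂ))
      (Complex.continuous_ofReal.comp_aestronglyMeasurable hG) (by simpa using hi)
    refine this.mono hG (Eventually.of_forall fun z => by simp)
  have hG2 : LocallyIntegrable fun z => G z ^ 2 := by
    have h1 := hi.locallyIntegrable.mul_continuous (Real.continuous_exp.comp hψ)
    refine h1.congr (Eventually.of_forall fun z => ?_)
    simp [mul_assoc, ← Real.exp_add]
  have hcont : Continuous (moll ρ G) :=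
    (contDiff_moll hρ.smooth hρ.hasCompactSupport hGl).continuous
  have hI : Integrable (fun z => moll ρ G z ^ 2 * Real.exp (-ψ z)) := by
    refine Continuous.integrable_of_hasCompactSupport (by fun_prop) ?_
    exact ((hasCompactSupport_moll hρ.hasCompactSupport hGc).comp_left (g := fun x : ℝ => x ^ 2)
      (by simp)).mul_right
  refine ⟨hI, ?_⟩
  rw [← hρ.integral_moll hi, ← integral_const_mul]
  refine integral_mono hI ((hρ.integrable_moll hi).const_mul _) fun z => ?_
  calc moll ρ G z ^ 2 * Real.exp (-ψ z)
      ≤ moll ρ (fun z => G z ^ 2) z * Real.exp (-ψ z) := by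
        gcongr; exact hρ.moll_sq_le hGl hG2 z
    _ = moll ρ (fun y => Real.exp (-ψ z) * G y ^ 2) z := by
        simp only [moll, smul_eq_mul]
        rw [mul_comm, ← integral_const_mul]
        congr 1; ext y; ring
    _ ≤ moll ρ (fun y => (1 + s) * (G y ^ 2 * Real.exp (-ψ y))) z := by
        refine hρ.moll_mono (hG2.smul (Real.exp (-ψ z)))
          (hi.locallyIntegrable.smul (1 + s)) z fun y hy => ?_
        by_cases hyK : y ∈ K
        · have := hψK y hyK z hy
          simp only [Pi.smul_apply, smul_eq_mul]
          nlinarith [sq_nonneg (G y)]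
        · simp [hGK y hyK]
    _ = (1 + s) * moll ρ (fun y => G y ^ 2 * Real.exp (-ψ y)) z := by
        simp only [moll, smul_eq_mul]
        rw [← integral_const_mul]
        congr 1; ext y; ring

end Jensen

/-- Mollification is weakly continuous at scale `0`. -/
lemma exists_moll_pairing_close {g c : Cn n → ℂ} (hg : Continuous g) (hgc : HasCompactSupport g)
    (hc : Integrable c) {κ : ℝ} (hκ : 0 < κ) : ∃ ε₀ > 0, ∀ ε ≤ ε₀, ∀ ρ : Cn n → ℝ,
      IsMollifier ρ ε → ‖(∫ z, g z * moll ρ c z) - ∫ z, g z * c z‖ ≤ κ := by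
  set A := (∫ z, ‖c z‖) + 1 with hA
  have hA0 : 0 < A := by
    have : 0 ≤ ∫ z, ‖c z‖ := integral_nonneg fun _ => norm_nonneg _
    linarith
  obtain ⟨ε₀, hε₀, hu⟩ := Metric.uniformContinuous_iff.1
    (hgc.uniformContinuous_of_continuous hg) (κ / A) (by positivity)
  refine ⟨ε₀, hε₀, fun ε hε ρ hρ => ?_⟩
  have hgi : Integrable g := hg.integrable_of_hasCompactSupport hgc
  obtain ⟨M, hM⟩ := hgc.exists_bound_of_continuous hg
  have hswap : ∫ z, g z * moll ρ c z = ∫ y, (moll ρ g y) * c y := by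
    simp only [moll, ← integral_const_mul, ← integral_mul_const]
    rw [integral_integral_swap]
    · congr 1; ext y; congr 1; ext z
      rw [show ρ (y - z) = ρ (z - y) by rw [← hρ.neg_apply, neg_sub]]
      simp only [Complex.real_smul]; ring
    · have h2 : Integrable (fun p : Cn n × Cn n => ρ (p.1 - p.2) • c p.2) (volume.prod volume) := by
        have h1 := hc.convolution_integrand (ContinuousLinearMap.lsmul ℝ ℝ).flip hρ.integrable
        simpa using h1
      refine h2.bdd_mul (c := M) ?_ ?_
      · exact (hg.comp continuous_fst).aestronglyMeasurable
      · exact Eventually.of_forall fun p => hM _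
  have hclose : ∀ y, ‖moll ρ g y - g y‖ ≤ κ / A := fun y => by
    have i1 := integrable_kernel_smul hρ.smooth.continuous hρ.hasCompactSupport
      hgi.locallyIntegrable y
    have i0 : Integrable fun y' => ρ (y - y') := hρ.integrable.comp_sub_left y
    have : moll ρ g y - g y = ∫ y', ρ (y - y') • (g y' - g y) := by
      simp only [smul_sub]
      rw [integral_sub i1 (i0.smul_const _), integral_smul_const, hρ.integral_sub_left, one_smul]
      rfl
    rw [this]
    calc _ ≤ ∫ y', ρ (y - y') * (κ / A) := by
          refine norm_integral_le_of_norm_le (i0.mul_const _) (Eventually.of_forall fun y' => ?_)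
          rw [norm_smul, Real.norm_of_nonneg (hρ.nonneg _)]
          by_cases h0 : ρ (y - y') = 0
          · simp [h0]
          · refine mul_le_mul_of_nonneg_left ?_ (hρ.nonneg _)
            rw [← dist_eq_norm]
            refine (hu ?_).le
            rw [dist_comm, dist_eq_norm]
            exact (hρ.supp _ h0).trans_le hε
      _ = κ / A := by rw [integral_mul_const, hρ.integral_sub_left, one_mul]
  have hm : Continuous (moll ρ g) :=
    (contDiff_moll hρ.smooth hρ.hasCompactSupport hgi.locallyIntegrable).continuous
  have j1 : Integrable fun y => moll ρ g y * c y := by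
    obtain ⟨M', hM'⟩ := (hasCompactSupport_moll hρ.hasCompactSupport
      hgc).exists_bound_of_continuous hm
    exact hc.bdd_mul hm.aestronglyMeasurable (Eventually.of_forall hM')
  have j2 : Integrable fun y => g y * c y :=
    hc.bdd_mul hg.aestronglyMeasurable (Eventually.of_forall hM)
  rw [hswap, ← integral_sub j1 j2]
  calc _ ≤ ∫ y, κ / A * ‖c y‖ := by
        refine norm_integral_le_of_norm_le (hc.norm.const_mul _) (Eventually.of_forall fun y => ?_)
        rw [← sub_mul, norm_mul]
        gcongr
        exact hclose y
    _ = κ / A * (A - 1) := by rw [integral_const_mul, hA]; ring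
    _ ≤ κ := by
        rw [div_mul_eq_mul_div, div_le_iff₀ hA0]
        nlinarith

section Kernel

variable {ρ : Cn n → ℝ} {ε : ℝ} {χ : Cn n → ℝ} {b : Cn n → ℂ}

lemma IsMollifier.integral_mul_dbar_kernel (hρ : IsMollifier ρ ε) (hχ : ContDiff ℝ ∞ χ)
    (hb : LocallyIntegrable b) (k : Fin n) (z : Cn n) :
    ∫ y, b y * dbar k (fun y => (ρ (z - y) : ℂ) * (χ y : ℂ)) y
      = -dbar k (moll ρ fun y => (χ y : ℂ) * b y) z
        + moll ρ (fun y => dbar k (fun y => (χ y : ℂ)) y * b y) z := by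
  have hχ' : ContDiff ℝ ∞ fun y => (χ y : ℂ) := contDiff_ofReal_comp hχ
  have hρ' : ContDiff ℝ ∞ fun y => (ρ y : ℂ) := contDiff_ofReal_comp hρ.smooth
  have l1 : LocallyIntegrable fun y => (χ y : ℂ) * b y := hb.continuous_mul hχ'.continuous
  have l2 : LocallyIntegrable fun y => dbar k (fun y => (χ y : ℂ)) y * b y :=
    hb.continuous_mul (contDiff_dbar k hχ').continuous
  rw [dbar_moll hρ.smooth hρ.hasCompactSupport l1, moll, ← integral_neg, ← integral_add]
  · congr 1; ext y
    rw [dbar_mul k (u := fun y => (ρ (z - y) : ℂ)) (v := fun y => (χ y : ℂ)),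
      dbar_comp_const_sub k (fun y => (ρ y : ℂ)), Complex.real_smul]
    · ring
    · exact (hρ'.comp (contDiff_const.sub contDiff_id)).differentiable (by simp) y
    · exact hχ'.differentiable (by simp) y
  · refine (l1.integrable_smul_left_of_hasCompactSupport (𝕜 := ℂ) ?_ ?_).neg
    · exact (contDiff_dbar k hρ').continuous.comp (continuous_const.sub continuous_id)
    · exact (hasCompactSupport_dbar k (hρ.hasCompactSupport.comp_left (g := fun x : ℝ => (x : ℂ))
        (by simp))).comp_homeomorph (Homeomorph.subLeft z)
  · exact integrable_kernel_smul hρ.smooth.continuous hρ.hasCompactSupport l2 z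

lemma IsMollifier.integral_mul_dwir_kernel (hρ : IsMollifier ρ ε) (hχ : ContDiff ℝ ∞ χ)
    (hb : LocallyIntegrable b) (k : Fin n) (z : Cn n) :
    ∫ y, b y * dwir k (fun y => (ρ (z - y) : ℂ) * (χ y : ℂ)) y
      = -dwir k (moll ρ fun y => (χ y : ℂ) * b y) z
        + moll ρ (fun y => dwir k (fun y => (χ y : ℂ)) y * b y) z := by
  have hχ' : ContDiff ℝ ∞ fun y => (χ y : ℂ) := contDiff_ofReal_comp hχ
  have hρ' : ContDiff ℝ ∞ fun y => (ρ y : ℂ) := contDiff_ofReal_comp hρ.smooth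
  have l1 : LocallyIntegrable fun y => (χ y : ℂ) * b y := hb.continuous_mul hχ'.continuous
  have l2 : LocallyIntegrable fun y => dwir k (fun y => (χ y : ℂ)) y * b y :=
    hb.continuous_mul (contDiff_dwir k hχ').continuous
  rw [dwir_moll hρ.smooth hρ.hasCompactSupport l1, moll, ← integral_neg, ← integral_add]
  · congr 1; ext y
    rw [dwir_mul k (u := fun y => (ρ (z - y) : ℂ)) (v := fun y => (χ y : ℂ)),
      dwir_comp_const_sub k (fun y => (ρ y : ℂ)), Complex.real_smul]
    · ring
    · exact (hρ'.comp (contDiff_const.sub contDiff_id)).differentiable (by simp) y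
    · exact hχ'.differentiable (by simp) y
  · refine (l1.integrable_smul_left_of_hasCompactSupport (𝕜 := ℂ) ?_ ?_).neg
    · exact (contDiff_dwir k hρ').continuous.comp (continuous_const.sub continuous_id)
    · exact (hasCompactSupport_dwir k (hρ.hasCompactSupport.comp_left (g := fun x : ℝ => (x : ℂ))
        (by simp))).comp_homeomorph (Homeomorph.subLeft z)
  · exact integrable_kernel_smul hρ.smooth.continuous hρ.hasCompactSupport l2 z

lemma IsMollifier.norm_moll_le (hρ : IsMollifier ρ ε) {c : Cn n → ℂ} {G : Cn n → ℝ}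
    (hG : LocallyIntegrable G) (z : Cn n) (h : ∀ y, ‖z - y‖ < ε → ‖c y‖ ≤ G y) :
    ‖moll ρ c z‖ ≤ moll ρ G z := by
  refine norm_integral_le_of_norm_le
    (integrable_kernel_smul hρ.smooth.continuous hρ.hasCompactSupport hG z)
    (Eventually.of_forall fun y => ?_)
  rw [norm_smul, Real.norm_of_nonneg (hρ.nonneg _), smul_eq_mul]
  by_cases h0 : ρ (z - y) = 0
  · simp [h0]
  · exact mul_le_mul_of_nonneg_left (h y (hρ.supp _ h0)) (hρ.nonneg _)

lemma moll_add (hρ : IsMollifier ρ ε) {F : Type*} [NormedAddCommGroup F] [NormedSpace ℝ F]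
    {c d : Cn n → F} (hc : LocallyIntegrable c) (hd : LocallyIntegrable d) (z : Cn n) :
    moll ρ (fun y => c y + d y) z = moll ρ c z + moll ρ d z := by
  simp only [moll, smul_add]
  exact integral_add (integrable_kernel_smul hρ.smooth.continuous hρ.hasCompactSupport hc z)
    (integrable_kernel_smul hρ.smooth.continuous hρ.hasCompactSupport hd z)

lemma moll_sub (hρ : IsMollifier ρ ε) {F : Type*} [NormedAddCommGroup F] [NormedSpace ℝ F]
    {c d : Cn n → F} (hc : LocallyIntegrable c) (hd : LocallyIntegrable d) (z : Cn n) :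
    moll ρ (fun y => c y - d y) z = moll ρ c z - moll ρ d z := by
  simp only [moll, smul_sub]
  exact integral_sub (integrable_kernel_smul hρ.smooth.continuous hρ.hasCompactSupport hc z)
    (integrable_kernel_smul hρ.smooth.continuous hρ.hasCompactSupport hd z)

lemma moll_sum (hρ : IsMollifier ρ ε) {ι F : Type*} [NormedAddCommGroup F] [NormedSpace ℝ F]
    {s : Finset ι} {c : ι → Cn n → F} (hc : ∀ i ∈ s, LocallyIntegrable (c i)) (z : Cn n) :
    moll ρ (fun y => ∑ i ∈ s, c i y) z = ∑ i ∈ s, moll ρ (c i) z := by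
  simp only [moll, Finset.smul_sum]
  exact integral_finsetSum _ fun i hi =>
    integrable_kernel_smul hρ.smooth.continuous hρ.hasCompactSupport (hc i hi) z

lemma moll_const_mul (ρ : Cn n → ℝ) (a : ℂ) (c : Cn n → ℂ) (z : Cn n) :
    moll ρ (fun y => a * c y) z = a * moll ρ c z := by
  simp only [moll, ← integral_const_mul]
  congr 1; ext y; simp only [Complex.real_smul]; ring

end Kernel

/-- Uniform control of a continuous function near a compact set. -/
lemma exists_forall_dist_lt_of_isCompact {K : Set (Cn n)} (hK : IsCompact K) {F : Type*}
    [PseudoMetricSpace F] {g : Cn n → F} (hg : Continuous g) {s : ℝ} (hs : 0 < s) :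
    ∃ ε₀ > 0, ∀ y ∈ K, ∀ z, ‖z - y‖ < ε₀ → dist (g z) (g y) < s := by
  have h := hK.uniformContinuousAt_of_continuousAt g (fun a _ => hg.continuousAt)
    (Metric.dist_mem_uniformity hs)
  obtain ⟨ε₀, hε₀, h⟩ := Metric.mem_uniformity_dist.1 h
  refine ⟨ε₀, hε₀, fun y hy z hz => ?_⟩
  rw [dist_comm]
  exact h (a := y) (b := z) (by rw [dist_comm, dist_eq_norm]; exact hz) hy

lemma norm_integral_sq_le_of_quadratic {q l w : Cn n → ℝ} {x : Cn n → ℂ}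
    (hq : ∀ z, 0 ≤ q z) (hl : ∀ z, 0 ≤ l z) (hw : ∀ z, 0 ≤ w z)
    (hx : ∀ z, ‖x z‖ ^ 2 ≤ q z * l z)
    (iq : Integrable fun z => q z * w z) (il : Integrable fun z => l z * w z)
    (ix : Integrable fun z => x z * (w z : ℂ)) :
    ‖∫ z, x z * (w z : ℂ)‖ ^ 2 ≤ (∫ z, q z * w z) * ∫ z, l z * w z := by
  have h1 : ‖∫ z, x z * (w z : ℂ)‖ ≤ ∫ z, ‖x z‖ * w z := by
    refine (norm_integral_le_integral_norm _).trans (le_of_eq ?_)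
    congr 1; ext z; rw [norm_mul, Complex.norm_real, Real.norm_of_nonneg (hw z)]
  have ix' : Integrable fun z => ‖x z‖ * w z := by
    refine ix.norm.congr (Eventually.of_forall fun z => ?_)
    simp [abs_of_nonneg (hw z)]
  calc _ ≤ (∫ z, ‖x z‖ * w z) ^ 2 := by gcongr
    _ ≤ _ := by
      refine sq_le_mul_of_quadratic fun t => ?_
      have i1 := iq.mul_const (t * t)
      have i2 := (ix'.const_mul (-2)).mul_const t
      have h : 0 ≤ ∫ z, (q z * w z * (t * t) + -2 * (‖x z‖ * w z) * t + l z * w z) := by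
        refine integral_nonneg fun z => ?_
        have := mul_nonneg (quadratic_nonneg_of_sq_le (hq z) (hl z) (hx z) t) (hw z)
        simp only [Pi.zero_apply]
        linarith
      have i3 : Integrable fun z => q z * w z * (t * t) + -2 * (‖x z‖ * w z) * t := i1.add i2
      rw [integral_add i3 il, integral_add i1 i2, integral_mul_const, integral_mul_const,
        integral_const_mul] at h
      linarith

/-- An `L²(e^{-ψ})` form `b`, weakly `∂̄`-closed, with weak weighted divergence `h`. -/
structure IsWeakForm (ψ : Cn n → ℝ) (b : Fin n → Cn n → ℂ) (h : Cn n → ℂ) : Prop where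
  meas : ∀ j, AEStronglyMeasurable (b j)
  int : ∀ j, Integrable fun z => ‖b j z‖ ^ 2 * Real.exp (-ψ z)
  cont : Continuous h
  cpt : HasCompactSupport h
  closed : ∀ g : Cn n → ℂ, ContDiff ℝ ∞ g → HasCompactSupport g → ∀ j k,
    ∫ z, b j z * dbar k g z = ∫ z, b k z * dbar j g z
  div : ∀ g : Cn n → ℂ, ContDiff ℝ ∞ g → HasCompactSupport g →
    ∑ j, ∫ z, b j z * dwir j g z
      = -∫ z, g z * (h z + ∑ j, dwir j (fun z => (ψ z : ℂ)) z * b j z)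

section WeakForm

variable {ψ : Cn n → ℝ} {b : Fin n → Cn n → ℂ} {h : Cn n → ℂ}

lemma IsWeakForm.locallyIntegrable (hb : IsWeakForm ψ b h) (hψ : ContDiff ℝ ∞ ψ) (j : Fin n) :
    LocallyIntegrable (b j) :=
  locallyIntegrable_of_weighted hψ.continuous (hb.meas j) (hb.int j)

lemma IsWeakForm.integrable_sum_sq (hb : IsWeakForm ψ b h) (hψ : ContDiff ℝ ∞ ψ) :
    Integrable fun z => (∑ j, ‖b j z‖) ^ 2 * Real.exp (-ψ z) := by
  have h1 : Integrable fun z => (n : ℝ) * ∑ j, ‖b j z‖ ^ 2 * Real.exp (-ψ z) :=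
    (integrable_finsetSum _ fun j _ => hb.int j).const_mul _
  refine h1.mono' ?_ (Eventually.of_forall fun z => ?_)
  · have : AEStronglyMeasurable (fun z => ∑ j, ‖b j z‖) volume :=
      Finset.aestronglyMeasurable_fun_sum _ fun j _ => (hb.meas j).norm
    exact (this.pow 2).mul (Real.continuous_exp.comp hψ.continuous.neg).aestronglyMeasurable
  · rw [Real.norm_of_nonneg (by positivity), ← Finset.sum_mul, ← mul_assoc]
    gcongr
    simpa using sq_sum_le_card_mul_sum_sq (s := Finset.univ) (f := fun j => ‖b j z‖)

lemma IsWeakForm.curl_moll (hb : IsWeakForm ψ b h) (hψ : ContDiff ℝ ∞ ψ) {ρ χ : Cn n → ℝ} {ε : ℝ}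
    (hρ : IsMollifier ρ ε) (hχ : ContDiff ℝ ∞ χ) (hχc : HasCompactSupport χ)
    (j k : Fin n) (z : Cn n) :
    dbar k (moll ρ fun y => (χ y : ℂ) * b j y) z - dbar j (moll ρ fun y => (χ y : ℂ) * b k y) z
      = moll ρ (fun y => dbar k (fun y => (χ y : ℂ)) y * b j y
          - dbar j (fun y => (χ y : ℂ)) y * b k y) z := by
  have hχ' : ContDiff ℝ ∞ fun y => (χ y : ℂ) := contDiff_ofReal_comp hχ
  have hg : ContDiff ℝ ∞ fun y => (ρ (z - y) : ℂ) * (χ y : ℂ) :=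
    ((contDiff_ofReal_comp hρ.smooth).comp (contDiff_const.sub contDiff_id)).mul hχ'
  have hgc : HasCompactSupport fun y => (ρ (z - y) : ℂ) * (χ y : ℂ) :=
    (hχc.comp_left (g := fun x : ℝ => (x : ℂ)) (by simp)).mul_left
  have l := fun i => hb.locallyIntegrable hψ i
  have := hb.closed _ hg hgc j k
  rw [hρ.integral_mul_dbar_kernel hχ (l j), hρ.integral_mul_dbar_kernel hχ (l k)] at this
  rw [moll_sub hρ ((l j).continuous_mul (contDiff_dbar k hχ').continuous)
    ((l k).continuous_mul (contDiff_dbar j hχ').continuous)]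
  linear_combination -this

lemma IsWeakForm.div_moll (hb : IsWeakForm ψ b h) (hψ : ContDiff ℝ ∞ ψ) {ρ χ : Cn n → ℝ} {ε : ℝ}
    (hρ : IsMollifier ρ ε) (hχ : ContDiff ℝ ∞ χ) (hχc : HasCompactSupport χ) (z : Cn n) :
    ∑ j, dadj ψ j (moll ρ fun y => (χ y : ℂ) * b j y) z
      = moll ρ (fun y => (χ y : ℂ) * h y + ∑ j, (dwir j (fun y => (χ y : ℂ)) y
          + (dwir j (fun z => (ψ z : ℂ)) y - dwir j (fun z => (ψ z : ℂ)) z) * (χ y : ℂ))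
            * b j y) z := by
  have hχ' : ContDiff ℝ ∞ fun y => (χ y : ℂ) := contDiff_ofReal_comp hχ
  have hψ' : ContDiff ℝ ∞ fun y => (ψ y : ℂ) := contDiff_ofReal_comp hψ
  have hg : ContDiff ℝ ∞ fun y => (ρ (z - y) : ℂ) * (χ y : ℂ) :=
    ((contDiff_ofReal_comp hρ.smooth).comp (contDiff_const.sub contDiff_id)).mul hχ'
  have hgc : HasCompactSupport fun y => (ρ (z - y) : ℂ) * (χ y : ℂ) :=
    (hχc.comp_left (g := fun x : ℝ => (x : ℂ)) (by simp)).mul_left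
  have l := fun i => hb.locallyIntegrable hψ i
  have l1 : ∀ j, LocallyIntegrable fun y => dwir j (fun y => (χ y : ℂ)) y * b j y :=
    fun j => (l j).continuous_mul (contDiff_dwir j hχ').continuous
  have l2 : ∀ j, LocallyIntegrable fun y => (χ y : ℂ) * b j y :=
    fun j => (l j).continuous_mul hχ'.continuous
  have l3 : ∀ j, LocallyIntegrable fun y =>
      dwir j (fun z => (ψ z : ℂ)) y * ((χ y : ℂ) * b j y) :=
    fun j => (l2 j).continuous_mul (contDiff_dwir j hψ').continuous
  have l4 : ∀ j, LocallyIntegrable fun y =>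
      dwir j (fun z => (ψ z : ℂ)) z * ((χ y : ℂ) * b j y) :=
    fun j => (l2 j).continuous_mul continuous_const
  have lh : LocallyIntegrable fun y => (χ y : ℂ) * h y :=
    (hχ'.continuous.mul hb.cont).locallyIntegrable
  have hd := hb.div _ hg hgc
  simp only [fun j => hρ.integral_mul_dwir_kernel hχ (l j) j z] at hd
  have e1 : ∫ y, (ρ (z - y) : ℂ) * (χ y : ℂ) * (h y + ∑ j, dwir j (fun z => (ψ z : ℂ)) y * b j y)
      = moll ρ (fun y => (χ y : ℂ) * h y + ∑ j,
          dwir j (fun z => (ψ z : ℂ)) y * ((χ y : ℂ) * b j y)) z := by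
    rw [moll]
    congr 1; ext y
    rw [Complex.real_smul, mul_assoc, mul_add, Finset.mul_sum]
    congr 3
    ext j; ring
  have ls : LocallyIntegrable fun y => ∑ j, dwir j (fun z => (ψ z : ℂ)) y * ((χ y : ℂ) * b j y) :=
    locallyIntegrable_finset_sum _ fun j _ => l3 j
  rw [e1, moll_add hρ lh ls, moll_sum hρ fun j _ => l3 j, Finset.sum_add_distrib,
    Finset.sum_neg_distrib] at hd
  have e2 : (fun y => (χ y : ℂ) * h y + ∑ j, (dwir j (fun y => (χ y : ℂ)) y
          + (dwir j (fun z => (ψ z : ℂ)) y - dwir j (fun z => (ψ z : ℂ)) z) * (χ y : ℂ))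
            * b j y) = fun y => (χ y : ℂ) * h y + ∑ j, (dwir j (fun y => (χ y : ℂ)) y * b j y
          + dwir j (fun z => (ψ z : ℂ)) y * ((χ y : ℂ) * b j y)
          - dwir j (fun z => (ψ z : ℂ)) z * ((χ y : ℂ) * b j y)) := by
    ext y
    congr 1
    refine Finset.sum_congr rfl fun j _ => by ring
  have ladd : ∀ j, LocallyIntegrable fun y => dwir j (fun y => (χ y : ℂ)) y * b j y
          + dwir j (fun z => (ψ z : ℂ)) y * ((χ y : ℂ) * b j y) := fun j => (l1 j).add (l3 j)
  have lsub : ∀ j, LocallyIntegrable fun y => dwir j (fun y => (χ y : ℂ)) y * b j y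
          + dwir j (fun z => (ψ z : ℂ)) y * ((χ y : ℂ) * b j y)
          - dwir j (fun z => (ψ z : ℂ)) z * ((χ y : ℂ) * b j y) := fun j => (ladd j).sub (l4 j)
  have lsum : LocallyIntegrable fun y => ∑ j, (dwir j (fun y => (χ y : ℂ)) y * b j y
          + dwir j (fun z => (ψ z : ℂ)) y * ((χ y : ℂ) * b j y)
          - dwir j (fun z => (ψ z : ℂ)) z * ((χ y : ℂ) * b j y)) :=
    locallyIntegrable_finset_sum _ fun j _ => lsub j
  rw [e2, moll_add hρ lh lsum, moll_sum hρ fun j _ => lsub j]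
  simp only [dadj, fun j => moll_sub hρ (ladd j) (l4 j) z, fun j => moll_add hρ (l1 j) (l3 j) z,
    moll_const_mul, Finset.sum_sub_distrib, Finset.sum_add_distrib]
  linear_combination -hd

end WeakForm

section WeakForm

variable {ψ : Cn n → ℝ} {b : Fin n → Cn n → ℂ} {h : Cn n → ℂ}

lemma continuous_levi_comp (hψ : ContDiff ℝ ∞ ψ) {β : Cn n → Cn n} (hβ : Continuous β) :
    Continuous fun z => levi ψ z (β z) := by
  have h2 : Continuous (fderiv ℝ (fderiv ℝ ψ)) :=
    (hψ.fderiv_right (m := ∞) (by simp)).continuous_fderiv (by simp)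
  unfold levi
  fun_prop

lemma add_sq_le_of_pos {s x y : ℝ} (hs : 0 < s) (hs1 : s ≤ 1) :
    (x + 2 * s * y) ^ 2 ≤ (1 + s) * x ^ 2 + 8 * s * y ^ 2 := by
  have h1 : 0 ≤ s * (x - 2 * y) ^ 2 := by positivity
  have h2 : 0 ≤ s * (1 - s) * y ^ 2 := by
    have : 0 ≤ 1 - s := by linarith
    positivity
  nlinarith

/-- The Morrey–Kohn–Hörmander bound for the truncated mollifications of a weak form. -/
lemma IsWeakForm.exists_levi_moll_le (hb : IsWeakForm ψ b h) (hψ : ContDiff ℝ ∞ ψ)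
    {χ : Cn n → ℝ} (hχ : ContDiff ℝ ∞ χ) (hχc : HasCompactSupport χ)
    (hχ01 : ∀ z, 0 ≤ χ z ∧ χ z ≤ 1) {s : ℝ} (hs : 0 < s) (hs1 : s ≤ 1)
    (hd : ∀ j z, ‖dbar j (fun z => (χ z : ℂ)) z‖ ≤ s)
    (hw : ∀ j z, ‖dwir j (fun z => (χ z : ℂ)) z‖ ≤ s) :
    ∃ ε₀ > 0, ∀ ε ≤ ε₀, ∀ ρ : Cn n → ℝ, IsMollifier ρ ε →
      ∫ z, levi ψ z (fun j => moll ρ (fun y => (χ y : ℂ) * b j y) z) * Real.exp (-ψ z)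
        ≤ (1 + s) * ((1 + s) * (∫ z, ‖h z‖ ^ 2 * Real.exp (-ψ z))
            + 8 * s * (1 + (n : ℝ) ^ 2) * ∫ z, (∑ j, ‖b j z‖) ^ 2 * Real.exp (-ψ z)) := by
  set K := tsupport χ with hK
  have hKc : IsCompact K := hχc
  have hχ' : ContDiff ℝ ∞ fun y => (χ y : ℂ) := contDiff_ofReal_comp hχ
  have hχc' : HasCompactSupport fun y => (χ y : ℂ) :=
    hχc.comp_left (g := fun x : ℝ => (x : ℂ)) (by simp)
  have hψ' : ContDiff ℝ ∞ fun y => (ψ y : ℂ) := contDiff_ofReal_comp hψ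
  have hsuppC : tsupport (fun y => (χ y : ℂ)) ⊆ K := by
    apply closure_mono
    intro y hy
    simpa using hy
  have hdK : ∀ j y, y ∉ K → dbar j (fun z => (χ z : ℂ)) y = 0 := fun j y hy => by
    have : fderiv ℝ (fun z => (χ z : ℂ)) y = 0 := by
      by_contra h0
      exact hy (hsuppC (support_fderiv_subset ℝ h0))
    simp [dbar, this]
  have hwK : ∀ j y, y ∉ K → dwir j (fun z => (χ z : ℂ)) y = 0 := fun j y hy => by
    have : fderiv ℝ (fun z => (χ z : ℂ)) y = 0 := by
      by_contra h0
      exact hy (hsuppC (support_fderiv_subset ℝ h0))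
    simp [dwir, this]
  have hχK : ∀ y, y ∉ K → χ y = 0 := fun y hy => image_eq_zero_of_notMem_tsupport hy
  obtain ⟨ε₁, hε₁, he1⟩ := exists_forall_dist_lt_of_isCompact hKc
    (g := ψ) hψ.continuous (Real.log_pos (show (1 : ℝ) < 1 + s by linarith))
  have hcd : Continuous fun z => fun j => dwir j (fun z => (ψ z : ℂ)) z :=
    continuous_pi fun j => (contDiff_dwir j hψ').continuous
  obtain ⟨ε₂, hε₂, he2⟩ := exists_forall_dist_lt_of_isCompact hKc hcd hs
  refine ⟨min ε₁ ε₂, lt_min hε₁ hε₂, fun ε hε ρ hρ => ?_⟩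
  have hexp : ∀ y ∈ K, ∀ z, ‖z - y‖ < ε → Real.exp (-ψ z) ≤ (1 + s) * Real.exp (-ψ y) := by
    intro y hy z hz
    have := he1 y hy z (hz.trans_le (hε.trans (min_le_left _ _)))
    rw [Real.dist_eq] at this
    have h2 := (abs_lt.1 this).1
    calc Real.exp (-ψ z) ≤ Real.exp (Real.log (1 + s) + -ψ y) := by
          apply Real.exp_le_exp.2; linarith
      _ = _ := by rw [Real.exp_add, Real.exp_log (by linarith)]
  have hder : ∀ y ∈ K, ∀ z, ‖z - y‖ < ε → ∀ j,
      ‖dwir j (fun z => (ψ z : ℂ)) y - dwir j (fun z => (ψ z : ℂ)) z‖ ≤ s := by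
    intro y hy z hz j
    have := he2 y hy z (hz.trans_le (hε.trans (min_le_right _ _)))
    rw [dist_comm] at this
    have h3 := (dist_le_pi_dist (fun j => dwir j (fun z => (ψ z : ℂ)) y)
      (fun j => dwir j (fun z => (ψ z : ℂ)) z) j).trans this.le
    rwa [dist_eq_norm] at h3
  set nb : Cn n → ℝ := fun z => ∑ j, ‖b j z‖ with hnb
  have hnbm : AEStronglyMeasurable nb :=
    Finset.aestronglyMeasurable_fun_sum _ fun j _ => (hb.meas j).norm
  have hnbi := hb.integrable_sum_sq hψ
  have hhi : Integrable fun z => ‖h z‖ ^ 2 * Real.exp (-ψ z) := by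
    refine Continuous.integrable_of_hasCompactSupport ?_ ?_
    · exact (hb.cont.norm.pow 2).mul (Real.continuous_exp.comp hψ.continuous.neg)
    · exact (hb.cpt.comp_left (g := fun x : ℂ => ‖x‖ ^ 2) (by simp)).mul_right
  set H := ∫ z, ‖h z‖ ^ 2 * Real.exp (-ψ z)
  set B := ∫ z, nb z ^ 2 * Real.exp (-ψ z)
  have hB : 0 ≤ B := integral_nonneg fun z => by positivity
  have hnb0 : ∀ z, 0 ≤ nb z := fun z => by positivity
  have hjnb : ∀ j z, ‖b j z‖ ≤ nb z := fun j z =>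
    Finset.single_le_sum (f := fun j => ‖b j z‖) (fun _ _ => norm_nonneg _) (Finset.mem_univ j)
  -- the two majorants
  set G₁ : Cn n → ℝ := K.indicator fun z => ‖h z‖ + 2 * s * nb z with hG₁
  set G₂ : Cn n → ℝ := K.indicator fun z => 2 * s * nb z with hG₂
  have hKm : MeasurableSet K := (isClosed_tsupport χ).measurableSet
  have hG₁m : AEStronglyMeasurable G₁ :=
    (hb.cont.norm.aestronglyMeasurable.add (hnbm.const_mul (2 * s))).indicator hKm
  have hG₂m : AEStronglyMeasurable G₂ := (hnbm.const_mul (2 * s)).indicator hKm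
  have hWm : AEStronglyMeasurable (fun z => Real.exp (-ψ z)) volume :=
    (Real.continuous_exp.comp hψ.continuous.neg).aestronglyMeasurable
  have b1 : ∀ z, G₁ z ^ 2 * Real.exp (-ψ z)
      ≤ (1 + s) * (‖h z‖ ^ 2 * Real.exp (-ψ z)) + 8 * s * (nb z ^ 2 * Real.exp (-ψ z)) := by
    intro z
    have he := Real.exp_pos (-ψ z)
    by_cases hz : z ∈ K
    · rw [hG₁, Set.indicator_of_mem hz]
      have := mul_le_mul_of_nonneg_right (add_sq_le_of_pos (x := ‖h z‖) (y := nb z) hs hs1) he.le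
      linarith
    · rw [hG₁, Set.indicator_of_notMem hz]
      rw [zero_pow two_ne_zero, zero_mul]
      positivity
  have b2 : ∀ z, G₂ z ^ 2 * Real.exp (-ψ z) ≤ 4 * s ^ 2 * (nb z ^ 2 * Real.exp (-ψ z)) := by
    intro z
    have he := Real.exp_pos (-ψ z)
    by_cases hz : z ∈ K
    · rw [hG₂, Set.indicator_of_mem hz]
      apply le_of_eq; ring
    · rw [hG₂, Set.indicator_of_notMem hz, zero_pow two_ne_zero, zero_mul]
      positivity
  have i1' : Integrable fun z => (1 + s) * (‖h z‖ ^ 2 * Real.exp (-ψ z))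
      + 8 * s * (nb z ^ 2 * Real.exp (-ψ z)) := (hhi.const_mul _).add (hnbi.const_mul _)
  have i1 : Integrable fun z => G₁ z ^ 2 * Real.exp (-ψ z) :=
    i1'.mono' ((hG₁m.pow 2).mul hWm) (Eventually.of_forall fun z => by
      rw [Real.norm_of_nonneg (by positivity)]; exact b1 z)
  have i2 : Integrable fun z => G₂ z ^ 2 * Real.exp (-ψ z) :=
    (hnbi.const_mul (4 * s ^ 2)).mono' ((hG₂m.pow 2).mul hWm) (Eventually.of_forall fun z => by
      rw [Real.norm_of_nonneg (by positivity)]; exact b2 z)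
  have I1 : ∫ z, G₁ z ^ 2 * Real.exp (-ψ z) ≤ (1 + s) * H + 8 * s * B := by
    refine (integral_mono i1 i1' b1).trans (le_of_eq ?_)
    rw [integral_add (hhi.const_mul _) (hnbi.const_mul _), integral_const_mul, integral_const_mul]
  have I2 : ∫ z, G₂ z ^ 2 * Real.exp (-ψ z) ≤ 4 * s ^ 2 * B := by
    refine (integral_mono i2 (hnbi.const_mul _) b2).trans (le_of_eq ?_)
    rw [integral_const_mul]
  have l1 : LocallyIntegrable G₁ := by
    have := locallyIntegrable_of_weighted hψ.continuous (b := fun z => (G₁ z : ℂ))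
      (Complex.continuous_ofReal.comp_aestronglyMeasurable hG₁m) (by simpa using i1)
    exact this.mono hG₁m (Eventually.of_forall fun z => by simp)
  have l2 : LocallyIntegrable G₂ := by
    have := locallyIntegrable_of_weighted hψ.continuous (b := fun z => (G₂ z : ℂ))
      (Complex.continuous_ofReal.comp_aestronglyMeasurable hG₂m) (by simpa using i2)
    exact this.mono hG₂m (Eventually.of_forall fun z => by simp)
  obtain ⟨J1, J1'⟩ := hρ.integral_moll_sq_le hψ.continuous hKc hexp
    (fun z hz => Set.indicator_of_notMem hz _) hG₁m i1
  obtain ⟨J2, J2'⟩ := hρ.integral_moll_sq_le hψ.continuous hKc hexp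
    (fun z hz => Set.indicator_of_notMem hz _) hG₂m i2
  have lc : ∀ j, LocallyIntegrable fun y => (χ y : ℂ) * b j y :=
    fun j => (hb.locallyIntegrable hψ j).continuous_mul hχ'.continuous
  have sβ : ∀ j, ContDiff ℝ ∞ (moll ρ fun y => (χ y : ℂ) * b j y) := fun j =>
    contDiff_moll hρ.smooth hρ.hasCompactSupport (lc j)
  have cβ : ∀ j, HasCompactSupport (moll ρ fun y => (χ y : ℂ) * b j y) := fun j =>
    hasCompactSupport_moll hρ.hasCompactSupport hχc'.mul_right
  have n1 : ∀ z, ‖∑ j, dadj ψ j (moll ρ fun y => (χ y : ℂ) * b j y) z‖ ≤ moll ρ G₁ z := by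
    intro z
    rw [hb.div_moll hψ hρ hχ hχc]
    refine hρ.norm_moll_le l1 z fun y hy => ?_
    by_cases hyK : y ∈ K
    · rw [hG₁, Set.indicator_of_mem hyK]
      have hχn : ‖(χ y : ℂ)‖ ≤ 1 := by
        rw [Complex.norm_real, Real.norm_of_nonneg (hχ01 y).1]; exact (hχ01 y).2
      refine (norm_add_le _ _).trans (add_le_add ?_ ?_)
      · rw [norm_mul]
        exact mul_le_of_le_one_left (norm_nonneg _) hχn
      · rw [hnb, Finset.mul_sum]
        refine (norm_sum_le _ _).trans (Finset.sum_le_sum fun j _ => ?_)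
        rw [norm_mul]
        gcongr
        refine (norm_add_le _ _).trans ?_
        rw [norm_mul]
        have h1 := hw j y
        have h2 := hder y hyK z hy j
        nlinarith [norm_nonneg (χ y : ℂ), norm_nonneg (dwir j (fun z => (ψ z : ℂ)) y - dwir j (fun z => (ψ z : ℂ)) z)]
    · rw [hG₁, Set.indicator_of_notMem hyK]
      simp [hχK y hyK, hwK _ y hyK]
  have n2 : ∀ j k z, ‖dbar k (moll ρ fun y => (χ y : ℂ) * b j y) z
      - dbar j (moll ρ fun y => (χ y : ℂ) * b k y) z‖ ≤ moll ρ G₂ z := by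
    intro j k z
    rw [hb.curl_moll hψ hρ hχ hχc]
    refine hρ.norm_moll_le l2 z fun y hy => ?_
    by_cases hyK : y ∈ K
    · rw [hG₂, Set.indicator_of_mem hyK]
      refine (norm_sub_le _ _).trans ?_
      rw [norm_mul, norm_mul]
      have h1 := mul_le_mul (hd k y) (hjnb j y) (norm_nonneg _) hs.le
      have h2 := mul_le_mul (hd j y) (hjnb k y) (norm_nonneg _) hs.le
      linarith
    · rw [hG₂, Set.indicator_of_notMem hyK]
      simp [hdK _ y hyK]
  have M := morrey_kohn_hormander hψ sβ cβ
  have hWc : Continuous fun z => Real.exp (-ψ z) := Real.continuous_exp.comp hψ.continuous.neg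
  have k1 : ∫ z, ‖∑ j, dadj ψ j (moll ρ fun y => (χ y : ℂ) * b j y) z‖ ^ 2 * Real.exp (-ψ z)
      ≤ (1 + s) * ((1 + s) * H + 8 * s * B) := by
    refine (integral_mono_of_nonneg (Eventually.of_forall fun z => ?_) J1
      (Eventually.of_forall fun z => ?_)).trans (J1'.trans ?_)
    · simp only [Pi.zero_apply]; positivity
    · have := n1 z
      simp only
      gcongr
    · gcongr
  have k2 : ∀ j k, ∫ z, ‖dbar k (moll ρ fun y => (χ y : ℂ) * b j y) z
      - dbar j (moll ρ fun y => (χ y : ℂ) * b k y) z‖ ^ 2 * Real.exp (-ψ z)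
      ≤ (1 + s) * (4 * s ^ 2 * B) := by
    intro j k
    refine (integral_mono_of_nonneg (Eventually.of_forall fun z => ?_) J2
      (Eventually.of_forall fun z => ?_)).trans (J2'.trans ?_)
    · simp only [Pi.zero_apply]; positivity
    · have := n2 j k z
      simp only
      gcongr
    · gcongr
  have k3 := Finset.sum_le_sum fun j (_ : j ∈ (Finset.univ : Finset (Fin n))) =>
    Finset.sum_le_sum fun k (_ : k ∈ (Finset.univ : Finset (Fin n))) => k2 j k
  simp only [Finset.sum_const, Finset.card_univ, Fintype.card_fin, nsmul_eq_mul] at k3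
  refine M.trans ((add_le_add k1 (mul_le_mul_of_nonneg_left k3 (by norm_num))).trans ?_)
  have e : 0 ≤ (1 + s) * ((n : ℝ) ^ 2 * B * (8 * s - 2 * s ^ 2)) := by
    have : 0 ≤ 8 * s - 2 * s ^ 2 := by nlinarith
    positivity
  nlinarith

/-- Hörmander's a priori estimate for weak forms. -/
theorem IsWeakForm.norm_pairing_sq_le (hb : IsWeakForm ψ b h) (hψ : ContDiff ℝ ∞ ψ)
    (hlevi : ∀ z c, 0 ≤ levi ψ z c) {v : Cn n → ℂ} (hv : ContDiff ℝ ∞ v)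
    (hvc : HasCompactSupport v) {Q : Cn n → ℝ} (hQ0 : ∀ z, 0 ≤ Q z)
    (hQi : Integrable fun z => Q z * Real.exp (-ψ z))
    (hQ : ∀ z c, ‖∑ j, conj (dbar j v z) * c j‖ ^ 2 ≤ Q z * levi ψ z c) :
    ‖∑ j, ∫ z, conj (dbar j v z) * (Real.exp (-ψ z) : ℂ) * b j z‖ ^ 2
      ≤ (∫ z, Q z * Real.exp (-ψ z)) * ∫ z, ‖h z‖ ^ 2 * Real.exp (-ψ z) := by
  set H := ∫ z, ‖h z‖ ^ 2 * Real.exp (-ψ z)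
  set B := ∫ z, (∑ j, ‖b j z‖) ^ 2 * Real.exp (-ψ z)
  set A := ∫ z, Q z * Real.exp (-ψ z)
  set X := ∑ j, ∫ z, conj (dbar j v z) * (Real.exp (-ψ z) : ℂ) * b j z
  have hA : 0 ≤ A := integral_nonneg fun z => mul_nonneg (hQ0 z) (Real.exp_pos _).le
  have hWc := (contDiff_expWeight hψ).continuous
  have hgc : ∀ j, Continuous fun z => conj (dbar j v z) * (Real.exp (-ψ z) : ℂ) := fun j =>
    (contDiff_conj (contDiff_dbar j hv)).continuous.mul hWc
  have hgs : ∀ j, HasCompactSupport fun z => conj (dbar j v z) * (Real.exp (-ψ z) : ℂ) := fun j =>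
    (hasCompactSupport_conj (hasCompactSupport_dbar j hvc)).mul_right
  have key : ∀ s : ℝ, 0 < s → s ≤ 1 → ‖X‖ ≤ n * s +
      √(A * ((1 + s) * ((1 + s) * H + 8 * s * (1 + (n : ℝ) ^ 2) * B))) := by
    intro s hs hs1
    obtain ⟨χ, hχ, hχc, hχ01, hχ1, hd, hw⟩ := exists_cutoff (show IsCompact (tsupport v) from hvc) hs
    have hχ' : ContDiff ℝ ∞ fun y => (χ y : ℂ) := contDiff_ofReal_comp hχ
    have hχc' : HasCompactSupport fun y => (χ y : ℂ) :=
      hχc.comp_left (g := fun x : ℝ => (x : ℂ)) (by simp)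
    obtain ⟨ε₀, hε₀, hM⟩ := hb.exists_levi_moll_le hψ hχ hχc hχ01 hs hs1 hd hw
    have hci : ∀ j, Integrable fun y => (χ y : ℂ) * b j y := fun j =>
      (hb.locallyIntegrable hψ j).integrable_smul_left_of_hasCompactSupport (𝕜 := ℂ)
        hχ'.continuous hχc'
    choose ε' hε' hpair using fun j => exists_moll_pairing_close (hgc j) (hgs j) (hci j) hs
    obtain ⟨ε, hε, hle0, hle⟩ : ∃ ε > 0, ε ≤ ε₀ ∧ ∀ j, ε ≤ ε' j := by
      have h1 : ∀ᶠ ε in 𝓝[>] (0 : ℝ), ε ≤ ε₀ := by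
        filter_upwards [Ioc_mem_nhdsGT hε₀] with x hx using hx.2
      have h2 : ∀ᶠ ε in 𝓝[>] (0 : ℝ), ∀ j, ε ≤ ε' j := by
        rw [eventually_all]
        intro j
        filter_upwards [Ioc_mem_nhdsGT (hε' j)] with x hx using hx.2
      obtain ⟨x, ⟨hx1, hx2⟩, hx⟩ := ((h1.and h2).and self_mem_nhdsWithin).exists
      exact ⟨x, hx, hx1, hx2⟩
    obtain ⟨ρ, hρ⟩ := exists_isMollifier (n := n) hε
    set β : Fin n → Cn n → ℂ := fun j => moll ρ fun y => (χ y : ℂ) * b j y with hβ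
    have hβc : ∀ j, Continuous (β j) := fun j => (contDiff_moll hρ.smooth hρ.hasCompactSupport
      (hci j).locallyIntegrable).continuous
    have hβs : ∀ j, HasCompactSupport (β j) := fun j =>
      hasCompactSupport_moll hρ.hasCompactSupport hχc'.mul_right
    have hβv : Continuous fun z => fun j => β j z := continuous_pi hβc
    have hL := hM ε hle0 ρ hρ
    have hlc := continuous_levi_comp hψ hβv
    have hWr : Continuous fun z => Real.exp (-ψ z) := Real.continuous_exp.comp hψ.continuous.neg
    have hls : HasCompactSupport fun z => levi ψ z (fun j => β j z) := by
      have : HasCompactSupport fun z => fun j => β j z := by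
        refine HasCompactSupport.intro (K := ⋃ j, tsupport (β j))
          (isCompact_iUnion fun j => hβs j) fun z hz => ?_
        ext j
        simp only [Set.mem_iUnion, not_exists] at hz
        exact image_eq_zero_of_notMem_tsupport (hz j)
      refine this.mono fun z hz => ?_
      rw [Function.mem_support] at hz ⊢
      contrapose! hz
      rw [hz]; simp [levi]
    have hli : Integrable fun z => levi ψ z (fun j => β j z) * Real.exp (-ψ z) :=
      (hlc.mul hWr).integrable_of_hasCompactSupport hls.mul_right
    have hxj : ∀ j, Integrable fun z => conj (dbar j v z) * (Real.exp (-ψ z) : ℂ) * β j z :=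
      fun j => ((hgc j).mul (hβc j)).integrable_of_hasCompactSupport (hgs j).mul_right
    have hxe : (fun z => (∑ j, conj (dbar j v z) * β j z) * (Real.exp (-ψ z) : ℂ))
        = fun z => ∑ j, conj (dbar j v z) * (Real.exp (-ψ z) : ℂ) * β j z := by
      ext z
      rw [Finset.sum_mul]
      refine Finset.sum_congr rfl fun j _ => by ring
    have hxi : Integrable fun z => (∑ j, conj (dbar j v z) * β j z) * (Real.exp (-ψ z) : ℂ) := by
      rw [hxe]
      exact integrable_finsetSum _ fun j _ => hxj j
    have CS := norm_integral_sq_le_of_quadratic (q := Q) (l := fun z => levi ψ z (fun j => β j z))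
      (w := fun z => Real.exp (-ψ z)) (x := fun z => ∑ j, conj (dbar j v z) * β j z) hQ0
      (fun z => hlevi z _) (fun z => (Real.exp_pos _).le) (fun z => hQ z _) hQi hli hxi
    rw [hxe, integral_finsetSum _ fun j _ => hxj j] at CS
    have h1 : ‖∑ j, ∫ z, conj (dbar j v z) * (Real.exp (-ψ z) : ℂ) * β j z‖ ≤
        √(A * ((1 + s) * ((1 + s) * H + 8 * s * (1 + (n : ℝ) ^ 2) * B))) :=
      Real.le_sqrt_of_sq_le (CS.trans (mul_le_mul_of_nonneg_left hL hA))
    have h2 : ‖X - ∑ j, ∫ z, conj (dbar j v z) * (Real.exp (-ψ z) : ℂ) * β j z‖ ≤ n * s := by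
      rw [← Finset.sum_sub_distrib]
      refine (norm_sum_le _ _).trans ((Finset.sum_le_sum fun j _ => ?_).trans_eq
        (show ∑ _j : Fin n, s = n * s by simp))
      rw [norm_sub_rev]
      refine le_trans (le_of_eq ?_) (hpair j ε (hle j) ρ hρ)
      congr 3
      ext z
      by_cases hz : z ∈ tsupport v
      · simp [hχ1 z hz]
      · have : dbar j v z = 0 := by
          have : fderiv ℝ v z = 0 := by
            by_contra h0
            exact hz (support_fderiv_subset ℝ h0)
          simp [dbar, this]
        simp [this]
    calc ‖X‖ ≤ _ := norm_le_norm_sub_add X _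
      _ ≤ _ := add_le_add h2 h1
  have hlim : Tendsto (fun s : ℝ => n * s +
      √(A * ((1 + s) * ((1 + s) * H + 8 * s * (1 + (n : ℝ) ^ 2) * B)))) (𝓝[>] 0)
      (𝓝 (√(A * H))) := by
    have : Continuous (fun s : ℝ => n * s +
      √(A * ((1 + s) * ((1 + s) * H + 8 * s * (1 + (n : ℝ) ^ 2) * B)))) := by fun_prop
    have h0 := this.tendsto 0
    simp only [mul_zero, add_zero, one_mul, zero_mul, zero_add] at h0
    exact h0.mono_left nhdsWithin_le_nhds
  have hX : ‖X‖ ≤ √(A * H) := by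
    refine ge_of_tendsto hlim ?_
    filter_upwards [Ioc_mem_nhdsGT (zero_lt_one (α := ℝ))] with s hs using key s hs.1 hs.2
  have hH : 0 ≤ H := integral_nonneg fun z => by positivity
  calc ‖X‖ ^ 2 ≤ √(A * H) ^ 2 := by gcongr
    _ = A * H := Real.sq_sqrt (mul_nonneg hA hH)

end WeakForm

section Dual

lemma exists_mem_orthogonal_inner_eq {H : Type*} [NormedAddCommGroup H] [InnerProductSpace ℂ H]
    [CompleteSpace H] (T : Submodule ℂ H) (y : H) :
    ∃ x ∈ T.orthogonal, ∀ u ∈ T.orthogonal, inner ℂ u x = inner ℂ u y := by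
  refine ⟨T.orthogonal.starProjection y, Submodule.starProjection_apply_mem _ _, fun u hu => ?_⟩
  have := Submodule.starProjection_inner_eq_zero (K := T.orthogonal) y u hu
  rw [inner_sub_left, sub_eq_zero] at this
  rw [← inner_conj_symm, ← this, inner_conj_symm]

/-- The Hilbert space of `L²` forms of bidegree `(0,1)`. -/
abbrev L2Form (n : ℕ) : Type := PiLp 2 fun _ : Fin n => Lp ℂ 2 (volume : Measure (Cn n))

/-- The class of a continuous compactly supported form. -/
def vecL2 (a : Fin n → Cn n → ℂ) (ha : ∀ j, Continuous (a j))
    (hc : ∀ j, HasCompactSupport (a j)) : L2Form n :=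
  WithLp.toLp 2 fun j => ((ha j).memLp_of_hasCompactSupport (p := 2) (hc j)).toLp (a j)

lemma inner_vecL2 {a : Fin n → Cn n → ℂ} (ha : ∀ j, Continuous (a j))
    (hc : ∀ j, HasCompactSupport (a j)) (x : L2Form n) :
    inner ℂ (vecL2 a ha hc) x = ∑ j, ∫ z, conj (a j z) * x j z := by
  rw [PiLp.inner_apply]
  refine Finset.sum_congr rfl fun j _ => ?_
  rw [L2.inner_def]
  refine integral_congr_ae ?_
  filter_upwards [((ha j).memLp_of_hasCompactSupport (p := 2) (hc j)).coeFn_toLp] with z hz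
  rw [RCLike.inner_apply, mul_comm]
  simp only [vecL2]
  rw [hz]

lemma inner_vecL2_vecL2 {a b : Fin n → Cn n → ℂ} (ha : ∀ j, Continuous (a j))
    (hc : ∀ j, HasCompactSupport (a j)) (hb : ∀ j, Continuous (b j))
    (hbc : ∀ j, HasCompactSupport (b j)) :
    inner ℂ (vecL2 a ha hc) (vecL2 b hb hbc) = ∑ j, ∫ z, conj (a j z) * b j z := by
  rw [inner_vecL2]
  refine Finset.sum_congr rfl fun j _ => integral_congr_ae ?_
  filter_upwards [((hb j).memLp_of_hasCompactSupport (p := 2) (hbc j)).coeFn_toLp] with z hz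
  simp only [vecL2]
  rw [hz]

variable {ψ : Cn n → ℝ}

lemma contDiff_expHalf (hψ : ContDiff ℝ ∞ ψ) (c : ℝ) :
    ContDiff ℝ ∞ fun z => (Real.exp (c * ψ z) : ℂ) :=
  contDiff_ofReal_comp (Real.contDiff_exp.comp (contDiff_const.mul hψ))

/-- The coefficients of the form `e^{ψ/2} conj(∂̄ₖg) eⱼ - e^{ψ/2} conj(∂̄ⱼg) eₖ`. -/
def curlTest (ψ : Cn n → ℝ) (g : Cn n → ℂ) (j k i : Fin n) (z : Cn n) : ℂ :=
  (Real.exp ((1 / 2) * ψ z) : ℂ) * ((if i = j then conj (dbar k g z) else 0)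
    - if i = k then conj (dbar j g z) else 0)

lemma continuous_curlTest (hψ : ContDiff ℝ ∞ ψ) {g : Cn n → ℂ} (hg : ContDiff ℝ ∞ g)
    (j k i : Fin n) : Continuous (curlTest ψ g j k i) := by
  have h1 := fun l => (contDiff_conj (contDiff_dbar l hg)).continuous
  have h2 := (contDiff_expHalf hψ (1 / 2)).continuous
  unfold curlTest
  split_ifs <;> fun_prop

lemma hasCompactSupport_curlTest (ψ : Cn n → ℝ) {g : Cn n → ℂ} (hg : HasCompactSupport g)
    (j k i : Fin n) : HasCompactSupport (curlTest ψ g j k i) := by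
  refine (hg.fderiv (𝕜 := ℝ)).mono fun z hz => ?_
  rw [Function.mem_support] at hz ⊢
  contrapose! hz
  simp [curlTest, dbar, hz]

lemma sum_integral_curlTest (hψ : ContDiff ℝ ∞ ψ) {g : Cn n → ℂ} (hg : ContDiff ℝ ∞ g)
    (hgc : HasCompactSupport g) (j k : Fin n) {x : Fin n → Cn n → ℂ}
    (hx : ∀ j, LocallyIntegrable (x j)) :
    ∑ i, ∫ z, conj (curlTest ψ g j k i z) * x i z
      = (∫ z, ((Real.exp ((1 / 2) * ψ z) : ℂ) * x j z) * dbar k g z)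
        - ∫ z, ((Real.exp ((1 / 2) * ψ z) : ℂ) * x k z) * dbar j g z := by
  have hi : ∀ i l, Integrable fun z => ((Real.exp ((1 / 2) * ψ z) : ℂ) * x i z) * dbar l g z := by
    intro i l
    have := ((hx i).continuous_mul (contDiff_expHalf hψ
      (1 / 2)).continuous).integrable_smul_right_of_hasCompactSupport (𝕜 := ℂ)
      (contDiff_dbar l hg).continuous (hasCompactSupport_dbar l hgc)
    simpa [mul_comm] using this
  have : ∀ i, ∫ z, conj (curlTest ψ g j k i z) * x i z
      = (if i = j then ∫ z, ((Real.exp ((1 / 2) * ψ z) : ℂ) * x i z) * dbar k g z else 0)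
        - if i = k then ∫ z, ((Real.exp ((1 / 2) * ψ z) : ℂ) * x i z) * dbar j g z else 0 := by
    intro i
    have e : ∀ z, conj (curlTest ψ g j k i z) * x i z
        = (if i = j then ((Real.exp ((1 / 2) * ψ z) : ℂ) * x i z) * dbar k g z else 0)
        - if i = k then ((Real.exp ((1 / 2) * ψ z) : ℂ) * x i z) * dbar j g z else 0 := by
      intro z
      simp only [curlTest, map_mul, map_sub, Complex.conj_ofReal]
      split_ifs <;> simp <;> ring
    simp only [e]
    rw [integral_sub]
    · split_ifs <;> simp
    · split_ifs
      · exact hi i k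
      · exact integrable_zero _ _ _
    · split_ifs
      · exact hi i j
      · exact integrable_zero _ _ _
  simp only [this, Finset.sum_sub_distrib, Finset.sum_ite_eq', Finset.mem_univ, if_true]

/-- **Hörmander's inequality**, in dual form. -/
theorem hormander_dual (hψ : ContDiff ℝ ∞ ψ)
    (hlevi : ∀ z c, 0 ≤ levi ψ z c) {v : Cn n → ℂ} (hv : ContDiff ℝ ∞ v)
    (hvc : HasCompactSupport v) {Q : Cn n → ℝ} (hQ0 : ∀ z, 0 ≤ Q z)
    (hQi : Integrable fun z => Q z * Real.exp (-ψ z))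
    (hQ : ∀ z c, ‖∑ j, conj (dbar j v z) * c j‖ ^ 2 ≤ Q z * levi ψ z c)
    {α : Fin n → Cn n → ℂ} (hα : ∀ j, ContDiff ℝ ∞ (α j)) (hαc : ∀ j, HasCompactSupport (α j)) :
    ‖∫ z, v z * ∑ j, dbar j (α j) z‖ ^ 2
      ≤ (∫ z, Q z * Real.exp (-ψ z)) * ∫ z, ‖∑ j, dbar j (α j) z‖ ^ 2 * Real.exp (ψ z) := by
  have hE := fun c => contDiff_expHalf hψ c
  set T : Submodule ℂ (L2Form n) := Submodule.span ℂ {y | ∃ (g : Cn n → ℂ) (hg : ContDiff ℝ ∞ g)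
    (hgc : HasCompactSupport g) (j k : Fin n), y = vecL2 (curlTest ψ g j k)
      (continuous_curlTest hψ hg j k) (hasCompactSupport_curlTest ψ hgc j k)} with hT
  set y : L2Form n := vecL2 (fun j z => (Real.exp ((1 / 2) * ψ z) : ℂ) * conj (α j z))
    (fun j => (hE _).continuous.mul (contDiff_conj (hα j)).continuous)
    (fun j => (hasCompactSupport_conj (hαc j)).mul_left) with hy
  obtain ⟨x, hxT, hproj⟩ := exists_mem_orthogonal_inner_eq T y
  have hxm : ∀ j, MemLp (x j) 2 volume := fun j => Lp.memLp _
  have hxl : ∀ j, LocallyIntegrable (x j) := fun j => (hxm j).locallyIntegrable (by norm_num)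
  -- the gradient of a test function is orthogonal to `T`
  have hgrad : ∀ w : Cn n → ℂ, ContDiff ℝ ∞ w → HasCompactSupport w →
      ∑ j, ∫ z, conj (dbar j w z) * (Real.exp (-(1 / 2) * ψ z) : ℂ) * x j z
        = -conj (∫ z, w z * ∑ j, dbar j (α j) z) := by
    intro w hw hwc
    have c1 : ∀ j, Continuous fun z => (Real.exp (-(1 / 2) * ψ z) : ℂ) * dbar j w z := fun j =>
      (hE _).continuous.mul (contDiff_dbar j hw).continuous
    have c2 : ∀ j, HasCompactSupport fun z => (Real.exp (-(1 / 2) * ψ z) : ℂ) * dbar j w z :=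
      fun j => (hasCompactSupport_dbar j hwc).mul_left
    have hmem : vecL2 _ c1 c2 ∈ T.orthogonal := by
      rw [hT, Submodule.mem_orthogonal]
      intro u hu
      induction hu using Submodule.span_induction with
      | zero => simp
      | add a b _ _ ha hb => rw [inner_add_left, ha, hb, add_zero]
      | smul c a _ ha => rw [inner_smul_left, ha, mul_zero]
      | mem u hu =>
        obtain ⟨g, hg, hgc, j, k, rfl⟩ := hu
        rw [inner_vecL2_vecL2, sum_integral_curlTest hψ hg hgc j k fun j =>
          (c1 j).locallyIntegrable]
        have e : ∀ j k, ∫ z, ((Real.exp ((1 / 2) * ψ z) : ℂ)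
            * ((Real.exp (-(1 / 2) * ψ z) : ℂ) * dbar j w z)) * dbar k g z
            = -∫ z, w z * dbar j (dbar k g) z := by
          intro j k
          rw [integral_mul_dbar j hw (contDiff_dbar k hg) hwc, neg_neg]
          congr 1; ext z
          have : (Real.exp ((1 / 2) * ψ z) : ℂ) * (Real.exp (-(1 / 2) * ψ z) : ℂ) = 1 := by
            rw [← Complex.ofReal_mul, ← Real.exp_add]; simp
          linear_combination (dbar j w z * dbar k g z) * this
        rw [e, e]
        simp only [dbar_dbar_comm j k hg, sub_self]
    have h1 := hproj _ hmem
    rw [inner_vecL2, hy, inner_vecL2_vecL2] at h1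
    have e1 : ∀ j, ∫ z, conj ((Real.exp (-(1 / 2) * ψ z) : ℂ) * dbar j w z) * x j z
        = ∫ z, conj (dbar j w z) * (Real.exp (-(1 / 2) * ψ z) : ℂ) * x j z := fun j => by
      congr 1; ext z
      rw [map_mul, Complex.conj_ofReal]; ring
    have e2 : ∀ j, ∫ z, conj ((Real.exp (-(1 / 2) * ψ z) : ℂ) * dbar j w z) *
        ((Real.exp ((1 / 2) * ψ z) : ℂ) * conj (α j z)) = -conj (∫ z, w z * dbar j (α j) z) := by
      intro j
      rw [integral_mul_dbar j hw (hα j) hwc, map_neg, neg_neg, ← integral_conj]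
      congr 1; ext z
      rw [map_mul, map_mul, Complex.conj_ofReal]
      have : (Real.exp (-(1 / 2) * ψ z) : ℂ) * (Real.exp ((1 / 2) * ψ z) : ℂ) = 1 := by
        rw [← Complex.ofReal_mul, ← Real.exp_add]; simp
      linear_combination (conj (dbar j w z) * conj (α j z)) * this
    simp only [e1, e2] at h1
    rw [h1, Finset.sum_neg_distrib, ← map_sum, ← integral_finsetSum]
    · simp only [Finset.mul_sum]
    · intro j _
      exact (hw.continuous.mul (contDiff_dbar j (hα j)).continuous).integrable_of_hasCompactSupport
        hwc.mul_right
  set b : Fin n → Cn n → ℂ := fun j z => (Real.exp ((1 / 2) * ψ z) : ℂ) * x j z with hb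
  have hD : Continuous fun z => ∑ j, dbar j (α j) z :=
    continuous_finsetSum _ fun j _ => (contDiff_dbar j (hα j)).continuous
  have hDc : HasCompactSupport fun z => ∑ j, dbar j (α j) z := by
    refine HasCompactSupport.intro (K := ⋃ j, tsupport (dbar j (α j)))
      (isCompact_iUnion fun j => hasCompactSupport_dbar j (hαc j)) fun z hz => ?_
    simp only [Set.mem_iUnion, not_exists] at hz
    exact Finset.sum_eq_zero fun j _ => image_eq_zero_of_notMem_tsupport (hz j)
  have hpair : ∀ w : Cn n → ℂ, ContDiff ℝ ∞ w → HasCompactSupport w →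
      ∑ j, ∫ z, conj (dbar j w z) * (Real.exp (-ψ z) : ℂ) * b j z
        = -conj (∫ z, w z * ∑ j, dbar j (α j) z) := by
    intro w hw hwc
    rw [← hgrad w hw hwc]
    refine Finset.sum_congr rfl fun j _ => ?_
    congr 1; ext z
    have : (Real.exp (-ψ z) : ℂ) * (Real.exp ((1 / 2) * ψ z) : ℂ)
        = (Real.exp (-(1 / 2) * ψ z) : ℂ) := by
      rw [← Complex.ofReal_mul, ← Real.exp_add]; congr 2; ring
    rw [hb, ← this]; ring
  have hweak : IsWeakForm ψ b fun z => (Real.exp (ψ z) : ℂ) * conj (∑ j, dbar j (α j) z) := by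
    refine ⟨fun j => ?_, fun j => ?_, ?_, ?_, fun g hg hgc j k => ?_, fun g hg hgc => ?_⟩
    · exact (hE _).continuous.aestronglyMeasurable.mul (hxm j).1
    · refine ((hxm j).integrable_norm_pow (by norm_num)).congr (Eventually.of_forall fun z => ?_)
      simp only [hb, norm_mul, Complex.norm_real, mul_pow, Real.norm_of_nonneg (Real.exp_pos _).le]
      rw [← Real.exp_nat_mul, mul_right_comm, ← Real.exp_add]
      norm_num
      ring_nf
      simp
    · have := hE 1
      simp only [one_mul] at this
      exact this.continuous.mul (Complex.continuous_conj.comp hD)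
    · exact (hasCompactSupport_conj hDc).mul_left
    · rw [← sub_eq_zero, ← sum_integral_curlTest hψ hg hgc j k hxl,
        ← inner_vecL2 (continuous_curlTest hψ hg j k) (hasCompactSupport_curlTest ψ hgc j k)]
      exact (Submodule.mem_orthogonal _ _).1 hxT _ (Submodule.subset_span ⟨g, hg, hgc, j, k, rfl⟩)
    · have hneg : ContDiff ℝ ∞ fun z => -ψ z := hψ.neg
      have hW : ContDiff ℝ ∞ fun z => (Real.exp (- -ψ z) : ℂ) := contDiff_expWeight hneg
      have hψ' : ContDiff ℝ ∞ fun z => (ψ z : ℂ) := contDiff_ofReal_comp hψ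
      have hp := hpair (fun z => conj (g z) * (Real.exp (- -ψ z) : ℂ)) ((contDiff_conj hg).mul hW)
        (hasCompactSupport_conj hgc).mul_right
      have e0 : ∀ j z, conj (dbar j (fun z => conj (g z) * (Real.exp (- -ψ z) : ℂ)) z)
          * (Real.exp (-ψ z) : ℂ) = dwir j g z + dwir j (fun z => (ψ z : ℂ)) z * g z := by
        intro j z
        have hz : (Real.exp (- -ψ z) : ℂ) * (Real.exp (-ψ z) : ℂ) = 1 := by
          rw [← Complex.ofReal_mul, ← Real.exp_add]; simp
        have hm : dbar j (fun z => ((-ψ z : ℝ) : ℂ)) z = -dbar j (fun z => (ψ z : ℂ)) z := by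
          simp only [Complex.ofReal_neg, dbar, fderiv_fun_neg, _root_.neg_apply]
          ring
        rw [dbar_mul j ((contDiff_conj hg).differentiable (by simp) z)
          (hW.differentiable (by simp) z), dbar_conj, dbar_expWeight hneg, hm, ← conj_dwir_ofReal]
        simp only [map_add, map_mul, map_neg, Complex.conj_conj, Complex.conj_ofReal]
        linear_combination (dwir j g z + dwir j (fun z => (ψ z : ℂ)) z * g z) * hz
      have bl : ∀ j, LocallyIntegrable (b j) := fun j =>
        (hxl j).continuous_mul (hE _).continuous
      have i1 : ∀ j, Integrable fun z => b j z * dwir j g z := fun j => by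
        have := (bl j).integrable_smul_right_of_hasCompactSupport (𝕜 := ℂ)
          (contDiff_dwir j hg).continuous (hasCompactSupport_dwir j hgc)
        simpa [mul_comm] using this
      have i2 : ∀ j, Integrable fun z => g z * (dwir j (fun z => (ψ z : ℂ)) z * b j z) := fun j =>
        ((bl j).continuous_mul (contDiff_dwir j hψ').continuous).integrable_smul_left_of_hasCompactSupport
          (𝕜 := ℂ) hg.continuous hgc
      have i3 : Integrable fun z => g z * ((Real.exp (ψ z) : ℂ) * conj (∑ j, dbar j (α j) z)) := by
        have := hE 1
        simp only [one_mul] at this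
        exact (hg.continuous.mul (this.continuous.mul
          (Complex.continuous_conj.comp hD))).integrable_of_hasCompactSupport hgc.mul_right
      have e1 : ∀ j, ∫ z, conj (dbar j (fun z => conj (g z) * (Real.exp (- -ψ z) : ℂ)) z)
          * (Real.exp (-ψ z) : ℂ) * b j z = (∫ z, b j z * dwir j g z)
            + ∫ z, g z * (dwir j (fun z => (ψ z : ℂ)) z * b j z) := fun j => by
        rw [← integral_add (i1 j) (i2 j)]
        congr 1; ext z
        rw [e0]; ring
      have e2 : conj (∫ z, conj (g z) * (Real.exp (- -ψ z) : ℂ) * ∑ j, dbar j (α j) z)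
          = ∫ z, g z * ((Real.exp (ψ z) : ℂ) * conj (∑ j, dbar j (α j) z)) := by
        rw [← integral_conj]
        congr 1; ext z
        simp only [map_mul, Complex.conj_conj, Complex.conj_ofReal, neg_neg]
        ring
      simp only [e1, e2, Finset.sum_add_distrib] at hp
      simp only [mul_add, Finset.mul_sum]
      rw [integral_add i3 (integrable_finsetSum _ fun j _ => i2 j),
        integral_finsetSum _ fun j _ => i2 j]
      linear_combination hp
  have main := hweak.norm_pairing_sq_le hψ hlevi hv hvc hQ0 hQi hQ
  rw [hpair v hv hvc, norm_neg, RCLike.norm_conj] at main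
  refine main.trans_eq ?_
  congr 2; ext z
  rw [norm_mul, RCLike.norm_conj, Complex.norm_real, Real.norm_of_nonneg (Real.exp_pos _).le,
    Real.exp_neg]
  have := Real.exp_pos (ψ z)
  field_simp

end Dual

section Disc

open Real in
lemma exists_polynomial_re_close {h : ℂ → ℝ} (hh : Continuous h) {δ : ℝ} (hδ : 0 < δ) :
    ∃ Q : Polynomial ℂ, ∀ w : ℂ, ‖w‖ = 1 → |h w - (Q.eval w).re| < δ := by
  have : Fact (0 < 2 * π) := ⟨Real.two_pi_pos⟩
  let H : C(AddCircle (2 * π), ℂ) :=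
    ⟨fun x => ((h (AddCircle.toCircle x : ℂ) : ℝ) : ℂ), by
      have := AddCircle.continuous_toCircle (T := 2 * π)
      fun_prop⟩
  have key : ∀ p ∈ Submodule.span ℂ (Set.range (@fourier (2 * π))),
      ∃ Q : Polynomial ℂ, ∀ x, (p x).re = (Q.eval (AddCircle.toCircle x : ℂ)).re := by
    intro p hp
    have key' : ∀ k : ℤ, ∀ c : ℂ, ∃ Q : Polynomial ℂ, ∀ x,
        (c * fourier (T := 2 * π) k x).re = (Q.eval (AddCircle.toCircle x : ℂ)).re := by
      intro k c
      have hpow : ∀ (k : ℕ) (x : AddCircle (2 * π)),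
          fourier (T := 2 * π) (k : ℤ) x = (AddCircle.toCircle x : ℂ) ^ k := by
        intro k x
        rw [fourier_apply, natCast_zsmul, AddCircle.toCircle_nsmul, Circle.coe_pow]
      obtain ⟨k, rfl | rfl⟩ := k.eq_nat_or_neg
      · exact ⟨Polynomial.C c * Polynomial.X ^ k, fun x => by simp [hpow]⟩
      · refine ⟨Polynomial.C (conj c) * Polynomial.X ^ k, fun x => ?_⟩
        rw [fourier_neg, hpow, ← Complex.conj_re]
        simp
    suffices h : ∀ c : ℂ, ∃ Q : Polynomial ℂ, ∀ x,
        (c * p x).re = (Q.eval (AddCircle.toCircle x : ℂ)).re by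
      simpa using h 1
    induction hp using Submodule.span_induction with
    | mem p hp =>
      obtain ⟨k, rfl⟩ := hp
      exact key' k
    | zero => exact fun c => ⟨0, by simp⟩
    | add p q _ _ hp hq =>
      intro c
      obtain ⟨P, hP⟩ := hp c
      obtain ⟨Q, hQ⟩ := hq c
      exact ⟨P + Q, fun x => by
        rw [Polynomial.eval_add, Complex.add_re, ← hP, ← hQ, ContinuousMap.add_apply, mul_add,
          Complex.add_re]⟩
    | smul d p _ hp =>
      intro c
      obtain ⟨P, hP⟩ := hp (c * d)
      exact ⟨P, fun x => by rw [← hP, ContinuousMap.smul_apply, smul_eq_mul, mul_assoc]⟩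
  have hmem : H ∈ (Submodule.span ℂ (Set.range (@fourier (2 * π)))).topologicalClosure := by
    rw [span_fourier_closure_eq_top]; trivial
  obtain ⟨p, hp, hpH⟩ := Metric.mem_closure_iff.1 hmem δ hδ
  obtain ⟨Q, hQ⟩ := key p hp
  refine ⟨Q, fun w hw => ?_⟩
  obtain ⟨x, hx⟩ := (AddCircle.homeomorphCircle two_pi_pos.ne').surjective ⟨w, by simp [Submonoid.unitSphere, hw]⟩
  have hx' : (AddCircle.toCircle x : ℂ) = w := by
    have := congrArg (fun c : Circle => (c : ℂ)) hx
    rwa [AddCircle.homeomorphCircle_apply] at this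
  have h1 : ‖H x - p x‖ < δ := by
    rw [← dist_eq_norm]
    exact (ContinuousMap.dist_apply_le_dist x).trans_lt hpH
  rw [← hx', ← hQ]
  have h2 := (Complex.abs_re_le_norm (H x - p x)).trans_lt h1
  simpa [H] using h2

lemma submean_le_of_re_le {g : ℂ → ℝ} (hg : UpperSemicontinuousOn g (Metric.closedBall 0 1))
    (hgi : ∀ c r, 0 ≤ r → Metric.closedBall c r ⊆ Metric.ball (0 : ℂ) 1 → CircleIntegrable g c r)
    (hsub : ∀ c ∈ Metric.ball (0 : ℂ) 1, ∃ ε > 0, ∀ r, 0 < r → r < ε →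
      g c ≤ Real.circleAverage g c r)
    {Q : ℂ → ℂ} (hQ : Differentiable ℂ Q) (hle : ∀ w, ‖w‖ = 1 → g w ≤ (Q w).re) :
    g 0 ≤ (Q 0).re := by
  have hQc : Continuous fun w => (Q w).re := Complex.continuous_re.comp hQ.continuous
  have main : ∀ κ : ℝ, 0 < κ → g 0 - (Q 0).re ≤ κ := by
    intro κ hκ
    have hcont : Continuous fun w : ℂ => - (Q w).re + κ * ‖w‖ ^ 2 := by fun_prop
    have husc : UpperSemicontinuousOn (fun w => g w + (- (Q w).re + κ * ‖w‖ ^ 2))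
        (Metric.closedBall 0 1) := hg.add hcont.continuousOn.upperSemicontinuousOn
    obtain ⟨c, hc, hmax⟩ := husc.exists_isMaxOn ⟨0, by simp⟩ (isCompact_closedBall _ _)
    have h0 := hmax (show (0 : ℂ) ∈ Metric.closedBall 0 1 by simp)
    simp only [Set.mem_setOf_eq, norm_zero] at h0
    have hc1 : ‖c‖ ≤ 1 := by simpa using hc
    rcases hc1.lt_or_eq with hlt | heq
    · exfalso
      obtain ⟨ε, hε, hs⟩ := hsub c (by simpa using hlt)
      set r := min (ε / 2) ((1 - ‖c‖) / 2) with hr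
      have hr0 : 0 < r := lt_min (by linarith) (by linarith)
      have hr1 : r < ε := (min_le_left _ _).trans_lt (by linarith)
      have hr2 : r ≤ (1 - ‖c‖) / 2 := min_le_right _ _
      have hsubset : Metric.closedBall c r ⊆ Metric.ball (0 : ℂ) 1 := by
        intro w hw
        rw [Metric.mem_closedBall, dist_eq_norm] at hw
        rw [Metric.mem_ball, dist_zero_right]
        have := norm_add_le (w - c) c
        rw [sub_add_cancel] at this
        linarith
      let P : ℂ → ℂ := fun w => Q w - κ * (2 * (conj c * (w - c))) - κ * (‖c‖ ^ 2 + r ^ 2)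
      have hP : Differentiable ℂ P := by fun_prop
      have hPc : Continuous fun w => (P w).re := Complex.continuous_re.comp hP.continuous
      have hPi : CircleIntegrable P c r := hP.continuous.continuousOn.circleIntegrable hr0.le
      have hPri : CircleIntegrable (fun w => (P w).re) c r :=
        hPc.continuousOn.circleIntegrable hr0.le
      have hPav : Real.circleAverage (fun w => (P w).re) c r = (P c).re := by
        have h1 : Real.circleAverage P c r = P c := hP.diffContOnCl.circleAverage
        rw [← h1]
        have h2 := Complex.reCLM.circleAverage_comp_comm hPi
        exact h2
      have hcomp : Real.circleAverage g c r ≤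
          Real.circleAverage (fun w => (P w).re + (g c + (-(Q c).re + κ * ‖c‖ ^ 2))) c r := by
        refine Real.circleAverage_mono (hgi c r hr0.le hsubset) (hPri.add (circleIntegrable_const _ _ _)) ?_
        intro w hw
        rw [abs_of_pos hr0] at hw
        have hw1 := hmax (Metric.ball_subset_closedBall (hsubset (Metric.sphere_subset_closedBall hw)))
        simp only [Set.mem_setOf_eq] at hw1
        have hw2 : ‖w - c‖ = r := by simpa [dist_eq_norm] using hw
        have hw3 : ‖w‖ ^ 2 = ‖c‖ ^ 2 + (2 * (conj c * (w - c))).re + r ^ 2 := by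
          rw [← hw2, ← Complex.normSq_eq_norm_sq, ← Complex.normSq_eq_norm_sq,
            ← Complex.normSq_eq_norm_sq]
          simp [Complex.normSq_apply]
          ring
        have hw4 : (P w).re = (Q w).re - κ * ‖w‖ ^ 2 := by
          rw [hw3]
          simp only [P, Complex.sub_re, Complex.re_ofReal_mul]
          norm_cast
          ring
        rw [hw4]
        linarith
      rw [Real.circleAverage_fun_add hPri (circleIntegrable_const _ _ _), hPav,
        Real.circleAverage_const] at hcomp
      have hP0 : (P c).re = (Q c).re - κ * (‖c‖ ^ 2 + r ^ 2) := by
        simp only [P, Complex.sub_re, Complex.re_ofReal_mul, sub_self, mul_zero, Complex.zero_re]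
        norm_cast
        ring
      have := hs r hr0 hr1
      rw [hP0] at hcomp
      nlinarith [mul_pos hκ (pow_pos hr0 2)]
    · have := hle c heq
      rw [heq] at h0
      linarith
  have := le_of_forall_pos_le_add (a := g 0 - (Q 0).re) (b := 0) (fun κ hκ => by
    simpa using main κ hκ)
  linarith

/-- A Lipschitz majorant of `g` on the unit circle. -/
def supConv (g : ℂ → ℝ) (k : ℕ) (x : ℂ) : ℝ :=
  ⨆ y : Metric.sphere (0 : ℂ) 1, (g y - k * ‖x - y‖)

lemma bddAbove_supConv {g : ℂ → ℝ} {M : ℝ} (hM : ∀ w, ‖w‖ = 1 → |g w| ≤ M) (k : ℕ) (x : ℂ) :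
    BddAbove (Set.range fun y : Metric.sphere (0 : ℂ) 1 => (g y - k * ‖x - y‖)) := by
  refine ⟨M, ?_⟩
  rintro _ ⟨y, rfl⟩
  have h1 := (abs_le.1 (hM y (by simp))).2
  have : 0 ≤ (k : ℝ) * ‖x - y‖ := by positivity
  simp only
  linarith

instance : Nonempty (Metric.sphere (0 : ℂ) 1) := ⟨⟨1, by simp⟩⟩

lemma continuous_supConv {g : ℂ → ℝ} {M : ℝ} (hM : ∀ w, ‖w‖ = 1 → |g w| ≤ M) (k : ℕ) :
    Continuous (supConv g k) := by
  refine (LipschitzWith.of_le_add_mul (K := (k : ℝ≥0)) fun x x' => ?_).continuous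
  refine ciSup_le fun y => ?_
  have h1 := le_ciSup (bddAbove_supConv hM k x') y
  have h2 : ‖x' - y‖ ≤ dist x x' + ‖x - y‖ := by
    rw [dist_comm, dist_eq_norm]
    simpa using norm_add_le (x' - x) (x - y)
  have h3 : (k : ℝ) * ‖x' - y‖ ≤ k * (dist x x' + ‖x - y‖) := by gcongr
  simp only [supConv, NNReal.coe_natCast] at *
  nlinarith

lemma le_supConv {g : ℂ → ℝ} {M : ℝ} (hM : ∀ w, ‖w‖ = 1 → |g w| ≤ M) (k : ℕ) {w : ℂ}
    (hw : ‖w‖ = 1) : g w ≤ supConv g k w := by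
  have := le_ciSup (bddAbove_supConv hM k w) ⟨w, by simpa using hw⟩
  simpa [supConv] using this

lemma supConv_le {g : ℂ → ℝ} {M : ℝ} (hM : ∀ w, ‖w‖ = 1 → |g w| ≤ M) (k : ℕ) (x : ℂ) :
    supConv g k x ≤ M := by
  refine ciSup_le fun y => ?_
  have h1 := (abs_le.1 (hM y (by simp))).2
  have : 0 ≤ (k : ℝ) * ‖x - y‖ := by positivity
  linarith

lemma tendsto_supConv {g : ℂ → ℝ} {M : ℝ} (hM : ∀ w, ‖w‖ = 1 → |g w| ≤ M)
    (hg : UpperSemicontinuousOn g (Metric.sphere 0 1)) {w : ℂ} (hw : ‖w‖ = 1) :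
    Tendsto (fun k => supConv g k w) atTop (𝓝 (g w)) := by
  rw [Metric.tendsto_atTop]
  intro δ hδ
  have h1 := hg w (by simpa using hw) (g w + δ / 2) (by linarith)
  rw [eventually_nhdsWithin_iff, Metric.eventually_nhds_iff] at h1
  obtain ⟨η, hη, h1⟩ := h1
  obtain ⟨K, hK⟩ := exists_nat_ge (2 * M / η)
  refine ⟨K, fun k hk => ?_⟩
  have hkK : 2 * M ≤ k * η := by
    rw [div_le_iff₀ hη] at hK
    exact hK.trans (by gcongr)
  have h2 : supConv g k w ≤ g w + δ / 2 := by
    refine ciSup_le fun y => ?_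
    have hp : 0 ≤ (k : ℝ) * ‖w - y‖ := by positivity
    by_cases hy : dist (y : ℂ) w < η
    · have := h1 hy y.2
      linarith
    · have h3 : (k : ℝ) * η ≤ k * ‖w - y‖ := by
        rw [← dist_eq_norm, dist_comm]
        gcongr
        exact not_lt.1 hy
      have h4 := (abs_le.1 (hM y (by simp))).2
      have h5 := (abs_le.1 (hM w hw)).1
      linarith
  have h3 := le_supConv hM k hw
  rw [Real.dist_eq, abs_lt]
  constructor <;> linarith

lemma circleIntegrable_of_usc {g : ℂ → ℝ} {c : ℂ} {r M : ℝ} {s : Set ℂ} (hr : 0 ≤ r)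
    (hs : Metric.sphere c r ⊆ s) (hg : UpperSemicontinuousOn g s) (hM : ∀ w ∈ s, |g w| ≤ M) :
    CircleIntegrable g c r := by
  have hmem : ∀ θ, circleMap c r θ ∈ s := fun θ => hs (circleMap_mem_sphere c hr θ)
  have h1 : UpperSemicontinuous fun θ => g (circleMap c r θ) := by
    rw [← upperSemicontinuousOn_univ_iff]
    exact hg.comp (continuous_circleMap c r).continuousOn fun θ _ => hmem θ
  have h2 : IntegrableOn (fun θ => g (circleMap c r θ)) (Set.uIoc 0 (2 * Real.pi)) :=
    Measure.integrableOn_of_bounded (M := M) (by simp [Set.uIoc])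
      h1.measurable.aestronglyMeasurable (Eventually.of_forall fun θ => hM _ (hmem θ))
  exact intervalIntegrable_iff.2 h2

/-- Local sub-mean value inequalities imply the global one on the unit disc. -/
theorem le_circleAverage_of_local {g : ℂ → ℝ} {M : ℝ}
    (hg : UpperSemicontinuousOn g (Metric.closedBall 0 1))
    (hM : ∀ w ∈ Metric.closedBall (0 : ℂ) 1, |g w| ≤ M)
    (hsub : ∀ c ∈ Metric.ball (0 : ℂ) 1, ∃ ε > 0, ∀ r, 0 < r → r < ε →
      g c ≤ Real.circleAverage g c r) :
    g 0 ≤ Real.circleAverage g 0 1 := by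
  have hM1 : ∀ w, ‖w‖ = 1 → |g w| ≤ M := fun w hw => hM w (by simp [hw])
  have hgi : CircleIntegrable g 0 1 :=
    circleIntegrable_of_usc zero_le_one Metric.sphere_subset_closedBall hg hM
  have hstep : ∀ k, g 0 ≤ Real.circleAverage (supConv g k) 0 1 := by
    intro k
    have hc := continuous_supConv hM1 k
    refine le_of_forall_pos_le_add fun δ hδ => ?_
    obtain ⟨Q, hQ⟩ := exists_polynomial_re_close hc (half_pos hδ)
    have hle := submean_le_of_re_le hg (fun c r hr hcr => ?_) hsub
      (Q := fun w => Q.eval w + ((δ / 2 : ℝ) : ℂ)) (by fun_prop) (fun w hw => by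
        have h1 := le_supConv hM1 k hw
        have h2 := (abs_lt.1 (hQ w hw)).2
        simp only [Complex.add_re, Complex.ofReal_re]
        linarith)
    · have hQd : Differentiable ℂ fun w => Q.eval w := Q.differentiable
      have hQi : CircleIntegrable (fun w => Q.eval w) 0 1 :=
        hQd.continuous.continuousOn.circleIntegrable zero_le_one
      have h1 : Real.circleAverage (fun w => (Q.eval w).re) 0 1 = (Q.eval 0).re := by
        have h1 : Real.circleAverage (fun w => Q.eval w) 0 1 = Q.eval 0 :=
          hQd.diffContOnCl.circleAverage
        rw [← h1]
        exact Complex.reCLM.circleAverage_comp_comm hQi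
      have h2 : Real.circleAverage (fun w => (Q.eval w).re) 0 1
          ≤ Real.circleAverage (fun w => supConv g k w + δ / 2) 0 1 := by
        refine Real.circleAverage_mono ?_ ?_ fun w hw => ?_
        · exact (Complex.continuous_re.comp hQd.continuous).continuousOn.circleIntegrable zero_le_one
        · exact (hc.add continuous_const).continuousOn.circleIntegrable zero_le_one
        · have := (abs_lt.1 (hQ w (by simpa using hw))).1
          linarith
      rw [Real.circleAverage_fun_add (hc.continuousOn.circleIntegrable zero_le_one)
        (circleIntegrable_const _ _ _), Real.circleAverage_const, h1] at h2
      simp only [Complex.add_re, Complex.ofReal_re] at hle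
      linarith
    · exact circleIntegrable_of_usc hr
        ((Metric.sphere_subset_closedBall.trans hcr).trans Metric.ball_subset_closedBall) hg hM
  refine ge_of_tendsto' (x := atTop) ?_ hstep
  unfold Real.circleAverage
  refine Tendsto.const_smul ?_ _
  refine intervalIntegral.tendsto_integral_filter_of_dominated_convergence (fun _ => M) ?_ ?_ ?_ ?_
  · exact Eventually.of_forall fun k =>
      ((continuous_supConv hM1 k).comp (continuous_circleMap _ _)).aestronglyMeasurable
  · refine Eventually.of_forall fun k => Eventually.of_forall fun θ _ => ?_
    have hw : ‖circleMap 0 1 θ‖ = 1 := by simp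
    rw [Real.norm_eq_abs, abs_le]
    exact ⟨(abs_le.1 (hM1 _ hw)).1.trans (le_supConv hM1 k hw), supConv_le hM1 k _⟩
  · simp
  · refine Eventually.of_forall fun θ _ => ?_
    exact tendsto_supConv hM1 (hg.mono Metric.sphere_subset_closedBall) (by simp)

end Disc

section Truncation

/-- The truncation of `φ` at height `-m`, as a real function. -/
def trunc (φ : Cn n → EReal) (m : ℕ) (z : Cn n) : ℝ :=
  (max (φ z) ((-(m : ℝ) : ℝ) : EReal)).toReal

variable {φ : Cn n → EReal} {Ω : Set (Cn n)} {m : ℕ}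

lemma coe_trunc {z : Cn n} (h : φ z < ⊤) :
    ((trunc φ m z : ℝ) : EReal) = max (φ z) ((-(m : ℝ) : ℝ) : EReal) := by
  refine EReal.coe_toReal ?_ ?_
  · exact (max_lt h (EReal.coe_lt_top _)).ne
  · exact ((EReal.bot_lt_coe _).trans_le (le_max_right _ _)).ne'

lemma trunc_lt_iff {z : Cn n} (h : φ z < ⊤) {y : ℝ} :
    trunc φ m z < y ↔ φ z < (y : EReal) ∧ -(m : ℝ) < y := by
  rw [← EReal.coe_lt_coe_iff, coe_trunc h, max_lt_iff, EReal.coe_lt_coe_iff]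

lemma trunc_le_iff {z : Cn n} (h : φ z < ⊤) {y : ℝ} :
    trunc φ m z ≤ y ↔ φ z ≤ (y : EReal) ∧ -(m : ℝ) ≤ y := by
  rw [← EReal.coe_le_coe_iff, coe_trunc h, max_le_iff, EReal.coe_le_coe_iff]

lemma neg_le_trunc {z : Cn n} (h : φ z < ⊤) : -(m : ℝ) ≤ trunc φ m z := by
  rw [← EReal.coe_le_coe_iff, coe_trunc h]
  exact le_max_right _ _

lemma le_coe_trunc {z : Cn n} (h : φ z < ⊤) : φ z ≤ ((trunc φ m z : ℝ) : EReal) := by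
  rw [coe_trunc h]
  exact le_max_left _ _

lemma PSHOn.usc_trunc (hφ : PSHOn φ Ω) (m : ℕ) : UpperSemicontinuousOn (trunc φ m) Ω := by
  intro z hz y hy
  obtain ⟨h1, h2⟩ := (trunc_lt_iff (hφ.lt_top z hz)).1 hy
  filter_upwards [hφ.usc z hz y h1, self_mem_nhdsWithin] with w hw hwΩ
  exact (trunc_lt_iff (hφ.lt_top w hwΩ)).2 ⟨hw, h2⟩

lemma PSHOn.exists_le_on_isCompact (hφ : PSHOn φ Ω) {K : Set (Cn n)} (hK : IsCompact K)
    (hKΩ : K ⊆ Ω) : ∃ M : ℝ, 0 ≤ M ∧ ∀ z ∈ K, φ z ≤ (M : EReal) := by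
  rcases K.eq_empty_or_nonempty with rfl | hne
  · exact ⟨0, le_rfl, by simp⟩
  · obtain ⟨z, hz, hmax⟩ := (hφ.usc.mono hKΩ).exists_isMaxOn hne hK
    refine ⟨max 0 (φ z).toReal, le_max_left _ _, fun w hw => (hmax hw).trans ?_⟩
    refine (EReal.le_coe_toReal (hφ.lt_top z (hKΩ hz)).ne).trans ?_
    exact_mod_cast le_max_right _ _

lemma circleAvg_eq_circleAverage (z w : Cn n) (c : ℂ) (r : ℝ) :
    circleAvg φ (z + c • w) w r m = Real.circleAverage (fun l => trunc φ m (z + l • w)) c r := by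
  simp only [circleAvg, Real.circleAverage, smul_eq_mul]
  congr 2
  ext θ
  rw [trunc, circleMap, add_smul, add_assoc, mul_comm Complex.I]

lemma trunc_le_circleAverage (hφ : PSHOn φ Ω) {z w : Cn n}
    (hzw : ∀ l : ℂ, ‖l‖ ≤ 1 → z + l • w ∈ Ω) (m : ℕ) :
    trunc φ m z ≤ Real.circleAverage (fun l => trunc φ m (z + l • w)) 0 1 := by
  have hcont : Continuous fun l : ℂ => z + l • w := by fun_prop
  have hmaps : Set.MapsTo (fun l : ℂ => z + l • w) (Metric.closedBall 0 1) Ω :=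
    fun l hl => hzw l (by simpa using hl)
  have husc : UpperSemicontinuousOn (fun l : ℂ => trunc φ m (z + l • w)) (Metric.closedBall 0 1) :=
    (hφ.usc_trunc m).comp hcont.continuousOn hmaps
  obtain ⟨M, hM0, hM⟩ := hφ.exists_le_on_isCompact ((isCompact_closedBall (0 : ℂ) 1).image hcont)
    hmaps.image_subset
  have hbd : ∀ l ∈ Metric.closedBall (0 : ℂ) 1, |trunc φ m (z + l • w)| ≤ max M m := by
    intro l hl
    have hlt := hφ.lt_top _ (hmaps hl)
    rw [abs_le]
    constructor
    · exact (neg_le_neg (le_max_right _ _)).trans (neg_le_trunc hlt)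
    · refine ((trunc_le_iff hlt).2 ⟨hM _ ⟨l, hl, rfl⟩, ?_⟩).trans (le_max_left _ _)
      linarith [(Nat.cast_nonneg m : (0 : ℝ) ≤ m)]
  have := le_circleAverage_of_local husc hbd fun c hc => ?_
  · simpa using this
  have hcΩ := hmaps (Metric.ball_subset_closedBall hc)
  have hc1 : ‖c‖ < 1 := by simpa using hc
  obtain ⟨ε, hε, hs⟩ := hφ.submean _ hcΩ w
  refine ⟨min ε (1 - ‖c‖), lt_min hε (by linarith), fun r hr hrε => ?_⟩
  have h1 := (hs r hr (hrε.trans_le (min_le_left _ _))).trans (iInf_le _ m)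
  rw [circleAvg_eq_circleAverage] at h1
  have hsub : Metric.sphere c r ⊆ Metric.closedBall (0 : ℂ) 1 := by
    intro l hl
    have h2 : ‖l - c‖ = r := by simpa [dist_eq_norm] using hl
    have h3 := norm_add_le (l - c) c
    rw [sub_add_cancel] at h3
    have := hrε.trans_le (min_le_right _ _)
    simpa using (by linarith : ‖l‖ ≤ 1)
  refine (trunc_le_iff (hφ.lt_top _ hcΩ)).2 ⟨h1, ?_⟩
  rw [← Real.circleAverage_const (-(m : ℝ)) c r]
  refine Real.circleAverage_mono (circleIntegrable_const _ _ _)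
    (circleIntegrable_of_usc hr.le hsub husc hbd) fun l hl => ?_
  rw [abs_of_pos hr] at hl
  exact neg_le_trunc (hφ.lt_top _ (hmaps (hsub hl)))

lemma PSHOn.measurable_indicator_trunc (hφ : PSHOn φ Ω) {K : Set (Cn n)} (hK : IsClosed K)
    (hKΩ : K ⊆ Ω) (m : ℕ) : Measurable (K.indicator (trunc φ m)) := by
  refine measurable_of_Iio fun y => ?_
  obtain ⟨u, hu, hu'⟩ := upperSemicontinuousOn_iff_preimage_Iio.1 ((hφ.usc_trunc m).mono hKΩ) y
  have : K.indicator (trunc φ m) ⁻¹' Set.Iio y = (K ∩ u) ∪ (Kᶜ ∩ {_z | 0 < y}) := by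
    rw [← hu']
    ext z
    by_cases hz : z ∈ K <;> simp [hz]
  rw [this]
  exact (hK.measurableSet.inter hu.measurableSet).union
    (hK.measurableSet.compl.inter (MeasurableSet.const _))

end Truncation

section CircleFubini

variable {ρ : Cn n → ℝ} {ε : ℝ}

lemma IsMollifier.average_integral (hρ : IsMollifier ρ ε) {c : Cn n → ℝ} (hc : Measurable c)
    {B : ℝ} (hB : ∀ z, |c z| ≤ B) {T : ℂ → Cn n → Cn n} (hT : Continuous (Function.uncurry T)) :
    Real.circleAverage (fun l => ∫ y, ρ y * c (T l y)) 0 1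
      = ∫ y, ρ y * Real.circleAverage (fun l => c (T l y)) 0 1 := by
  simp only [Real.circleAverage, smul_eq_mul]
  have hT' : Continuous fun p : ℝ × Cn n => T (circleMap 0 1 p.1) p.2 :=
    hT.comp ((by fun_prop : Continuous fun p : ℝ × Cn n => (circleMap 0 1 p.1, p.2)))
  rw [intervalIntegral_integral_swap, ← integral_const_mul]
  · congr 1
    ext y
    rw [intervalIntegral.integral_const_mul]
    ring
  · have h1 : Integrable (fun p : ℝ × Cn n => (B : ℝ) * ρ p.2)
        ((volume.restrict (Set.uIoc 0 (2 * Real.pi))).prod volume) := by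
      have : IsFiniteMeasure (volume.restrict (Set.uIoc 0 (2 * Real.pi))) :=
        ⟨by simp [Set.uIoc]⟩
      have := (integrable_const (μ := volume.restrict (Set.uIoc 0 (2 * Real.pi))) B).mul_prod
        hρ.integrable
      exact this
    refine h1.mono' ?_ (Eventually.of_forall fun p => ?_)
    · refine ((hρ.smooth.continuous.comp continuous_snd).measurable.mul
        (hc.comp hT'.measurable)).aestronglyMeasurable
    · simp only [Function.uncurry, norm_mul, Real.norm_of_nonneg (hρ.nonneg _), Real.norm_eq_abs]
      rw [mul_comm]
      exact mul_le_mul_of_nonneg_right (hB _) (hρ.nonneg _)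

lemma moll_eq_integral_sub (ρ c : Cn n → ℝ) (z : Cn n) : moll ρ c z = ∫ y, ρ y * c (z - y) := by
  rw [moll, ← integral_sub_left_eq_self _ volume z]
  simp

lemma measurePreserving_smul {l : ℂ} (hl : ‖l‖ = 1) :
    MeasurePreserving (fun z : Cn n => l • z) volume volume := by
  let a : Circle := ⟨l, by simp [Submonoid.unitSphere, hl]⟩
  have := volume_preserving_pi (ι := Fin n) (f := fun _ => rotation a) fun _ =>
    (rotation a).measurePreserving
  exact this

lemma IsMollifier.moll_eq_integral_rot (hρ : IsMollifier ρ ε) (c : Cn n → ℝ) (z : Cn n) {l : ℂ}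
    (hl : ‖l‖ = 1) : moll ρ c z = ∫ y, ρ y * c (z - l • y) := by
  have hl0 : l ≠ 0 := by rintro rfl; simp at hl
  have := (measurePreserving_smul (n := n) hl).integral_comp
    (Homeomorph.smulOfNeZero l hl0).measurableEmbedding (fun y => ρ y * c (z - y))
  rw [moll_eq_integral_sub, ← this]
  simp only [hρ.rot l _ hl]

end CircleFubini

section SmoothSubmean

lemma exists_taylor_two {u : Cn n → ℝ} (hu : ContDiff ℝ ∞ u) (z : Cn n) {κ : ℝ} (hκ : 0 < κ) :
    ∃ δ > 0, ∀ h : Cn n, ‖h‖ < δ →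
      |u (z + h) - u z - fderiv ℝ u z h - fderiv ℝ (fderiv ℝ u) z h h / 2| ≤ κ * ‖h‖ ^ 2 := by
  have hu1 : ContDiff ℝ ∞ (fderiv ℝ u) := hu.fderiv_right (by simp)
  have hud : Differentiable ℝ u := hu.differentiable (by simp)
  have hu1d : Differentiable ℝ (fderiv ℝ u) := hu1.differentiable (by simp)
  set B := fderiv ℝ (fderiv ℝ u) z with hB
  have hsym : ∀ a b, B a b = B b a := fun a b =>
    isSymmSndFDerivAt_of_contDiff (z := z) hu a b
  have hlo := (hu1d z).hasFDerivAt.isLittleO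
  rw [Asymptotics.isLittleO_iff] at hlo
  obtain ⟨δ, hδ, h1⟩ := Metric.eventually_nhds_iff.1 (hlo hκ)
  refine ⟨δ, hδ, fun h hh => ?_⟩
  set R : Cn n → ℝ := fun h => u (z + h) - u z - fderiv ℝ u z h - B h h / 2 with hR
  have hRd : ∀ x, HasFDerivAt R (fderiv ℝ u (z + x) - fderiv ℝ u z - B x) x := by
    intro x
    have e1 : HasFDerivAt (fun h => u (z + h)) (fderiv ℝ u (z + x)) x := by
      exact ((hud (z + x)).hasFDerivAt.comp x ((hasFDerivAt_id x).const_add z)).congr_fderiv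
        (ContinuousLinearMap.comp_id _)
    have e2 : HasFDerivAt (fun h => B h h) (B x + B.flip x) x := by
      have := B.hasFDerivAt.clm_apply (hasFDerivAt_id x) (x := x)
      refine this.congr_fderiv ?_
      ext y
      simp
    have e3 := ((e1.sub_const (u z)).sub (fderiv ℝ u z).hasFDerivAt).sub (e2.const_mul (1 / 2))
    refine (e3.congr_fderiv ?_).congr_of_eventuallyEq (Eventually.of_forall fun y => ?_)
    · ext y
      simp [hsym y x]
      ring
    · simp [hR]
      ring
  have hbound : ∀ x ∈ Metric.closedBall (0 : Cn n) ‖h‖,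
      ‖fderiv ℝ u (z + x) - fderiv ℝ u z - B x‖ ≤ κ * ‖h‖ := by
    intro x hx
    have hx' : ‖x‖ ≤ ‖h‖ := by simpa using hx
    have := h1 (y := z + x) (by simpa [dist_eq_norm] using hx'.trans_lt hh)
    simp only [add_sub_cancel_left] at this
    exact this.trans (by gcongr)
  have := (convex_closedBall (0 : Cn n) ‖h‖).norm_image_sub_le_of_norm_hasFDerivWithin_le
    (fun x _ => (hRd x).hasFDerivWithinAt) hbound (x := 0) (y := h) (by simp) (by simp)
  have hR0 : R 0 = 0 := by simp [hR]
  rw [hR0, sub_zero, sub_zero, Real.norm_eq_abs] at this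
  calc |R h| ≤ κ * ‖h‖ * ‖h‖ := this
    _ = κ * ‖h‖ ^ 2 := by ring

lemma fderiv_smul_complex (L : Cn n →L[ℝ] ℝ) (l : ℂ) (w : Cn n) :
    L (l • w) = (((L w : ℂ) - Complex.I * L (Complex.I • w)) * l).re := by
  have : l • w = l.re • w + l.im • (Complex.I • w) := by
    ext j
    simp only [Pi.smul_apply, Pi.add_apply, smul_eq_mul, Complex.real_smul]
    conv_lhs => rw [← Complex.re_add_im l]
    ring
  rw [this, map_add, map_smul, map_smul]
  simp
  ring

lemma bilin_smul_complex (B : Cn n →L[ℝ] Cn n →L[ℝ] ℝ) (hB : ∀ a b, B a b = B b a) {l : ℂ}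
    (hl : ‖l‖ = 1) (w : Cn n) :
    B (l • w) (l • w) = (B w w + B (Complex.I • w) (Complex.I • w)) / 2
      + (((((B w w - B (Complex.I • w) (Complex.I • w)) / 2 : ℝ) : ℂ)
          - Complex.I * B w (Complex.I • w)) * l ^ 2).re := by
  have : l • w = l.re • w + l.im • (Complex.I • w) := by
    ext j
    simp only [Pi.smul_apply, Pi.add_apply, smul_eq_mul, Complex.real_smul]
    conv_lhs => rw [← Complex.re_add_im l]
    ring
  rw [this]
  simp only [map_add, map_smul, _root_.add_apply, _root_.smul_apply, smul_eq_mul,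
    hB (Complex.I • w) w]
  have h1 : l.re ^ 2 + l.im ^ 2 = 1 := by
    have := Complex.normSq_eq_norm_sq l
    rw [hl, Complex.normSq_apply] at this
    nlinarith
  simp [pow_two]
  linear_combination ((B w w + B (Complex.I • w) (Complex.I • w)) / 2) * h1

lemma levi_nonneg_of_submean {u : Cn n → ℝ} (hu : ContDiff ℝ ∞ u) {z : Cn n} {δ : ℝ} (hδ : 0 < δ)
    (hsub : ∀ w : Cn n, ‖w‖ < δ → u z ≤ Real.circleAverage (fun l : ℂ => u (z + l • w)) 0 1)
    (w : Cn n) : 0 ≤ levi u z w := by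
  by_contra! hneg
  obtain ⟨κ, hκ, hκw⟩ : ∃ κ > 0, κ * ‖w‖ ^ 2 < - levi u z w := by
    refine ⟨- levi u z w / (‖w‖ ^ 2 + 1), by apply div_pos <;> [linarith; positivity], ?_⟩
    rw [div_mul_eq_mul_div, div_lt_iff₀ (by positivity)]
    nlinarith
  obtain ⟨δ', hδ', hT⟩ := exists_taylor_two hu z hκ
  obtain ⟨s, hs0, hs⟩ : ∃ s : ℝ, 0 < s ∧ s * ‖w‖ < min δ δ' := by
    have hm : 0 < min δ δ' := lt_min hδ hδ'
    refine ⟨min δ δ' / (‖w‖ + 1), by positivity, ?_⟩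
    rw [div_mul_eq_mul_div, div_lt_iff₀ (by positivity)]
    nlinarith
  have hnw : ‖s • w‖ = s * ‖w‖ := by rw [norm_smul, Real.norm_of_nonneg hs0.le]
  set v := s • w with hv
  have h1 := hsub v (hnw ▸ hs.trans_le (min_le_left _ _))
  set B := fderiv ℝ (fderiv ℝ u) z with hB
  have hsym : ∀ a b, B a b = B b a := fun a b =>
    isSymmSndFDerivAt_of_contDiff (z := z) hu a b
  set L := fderiv ℝ u z with hL
  let P : ℂ → ℂ := fun l => ((L v : ℂ) - Complex.I * L (Complex.I • v)) * l
    + ((((B v v - B (Complex.I • v) (Complex.I • v)) / 2 : ℝ) : ℂ)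
          - Complex.I * B v (Complex.I • v)) * l ^ 2 / 2
  have hP : Differentiable ℂ P := by fun_prop
  have hPi : CircleIntegrable P 0 1 := hP.continuous.continuousOn.circleIntegrable zero_le_one
  have hPri : CircleIntegrable (fun l => (P l).re) 0 1 :=
    (Complex.continuous_re.comp hP.continuous).continuousOn.circleIntegrable zero_le_one
  have hPav : Real.circleAverage (fun l => (P l).re) 0 1 = 0 := by
    have e1 : Real.circleAverage P 0 1 = P 0 := hP.diffContOnCl.circleAverage
    have e2 : P 0 = 0 := by simp [P]
    have e3 := Complex.reCLM.circleAverage_comp_comm hPi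
    rw [e1, e2] at e3
    rw [map_zero] at e3
    exact e3
  have hlev : levi u z v = s ^ 2 * levi u z w := by
    simp only [levi, ← hB, hv, smul_comm Complex.I s w, map_smul, _root_.smul_apply, smul_eq_mul]
    ring
  have h2 : Real.circleAverage (fun l : ℂ => u (z + l • v)) 0 1
      ≤ Real.circleAverage (fun l => (P l).re + (u z + levi u z v + κ * ‖v‖ ^ 2)) 0 1 := by
    refine Real.circleAverage_mono ?_ (hPri.add (circleIntegrable_const _ _ _)) fun l hl => ?_
    · have := hu.continuous
      exact (by fun_prop : Continuous fun l : ℂ => u (z + l • v)).continuousOn.circleIntegrable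
        zero_le_one
    · have hl1 : ‖l‖ = 1 := by simpa using hl
      have hlv : ‖l • v‖ = ‖v‖ := by rw [norm_smul, hl1, one_mul]
      have h3 := (abs_le.1 (hT (l • v) (by rw [hlv, hnw]; exact hs.trans_le (min_le_right _ _)))).2
      rw [fderiv_smul_complex, bilin_smul_complex B hsym hl1, hlv] at h3
      have h4 : (P l).re = (((L v : ℂ) - Complex.I * L (Complex.I • v)) * l).re
        + (((((B v v - B (Complex.I • v) (Complex.I • v)) / 2 : ℝ) : ℂ)
          - Complex.I * B v (Complex.I • v)) * l ^ 2).re / 2 := by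
        simp only [P, Complex.add_re]
        rw [show (2 : ℂ) = ((2 : ℝ) : ℂ) by norm_num, Complex.div_ofReal_re]
      rw [h4]
      simp only [levi, ← hB]
      linarith
  rw [Real.circleAverage_fun_add hPri (circleIntegrable_const _ _ _), hPav,
    Real.circleAverage_const, hlev, hnw] at h2
  nlinarith [mul_pos hs0 hs0]

end SmoothSubmean

section Approximation

variable {φ : Cn n → EReal}

/-- Plurisubharmonic functions are limits of smooth plurisubharmonic majorants. -/
theorem PSHOn.exists_smooth_approx (hφ : PSHOn φ (Metric.ball 0 1)) {r : ℝ} (hr : r < 1) :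
    ∃ (u : ℕ → Cn n → ℝ) (M : ℝ), (∀ k, ContDiff ℝ ∞ (u k)) ∧ ∀ z ∈ Metric.ball (0 : Cn n) r,
      (∀ k w, 0 ≤ levi (u k) z w) ∧ (∀ k, φ z ≤ (u k z : EReal)) ∧ (∀ k, u k z ≤ M) ∧
      Tendsto (fun k => (u k z : EReal)) atTop (𝓝 (φ z)) := by
  set R := (1 + r) / 2 with hR
  have hR1 : R < 1 := by rw [hR]; linarith
  have hrR : r < R := by rw [hR]; linarith
  set K : Set (Cn n) := Metric.closedBall 0 R with hK
  have hKΩ : K ⊆ Metric.ball 0 1 := Metric.closedBall_subset_ball hR1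
  have hεpos : ∀ k : ℕ, 0 < (R - r) / (k + 1) := fun k => div_pos (by linarith) (by positivity)
  have hεle : ∀ k : ℕ, (R - r) / (k + 1) ≤ R - r := fun k =>
    div_le_self (by linarith) (by linarith [(Nat.cast_nonneg k : (0 : ℝ) ≤ k)])
  have hεlim : Tendsto (fun k : ℕ => (R - r) / ((k : ℝ) + 1)) atTop (𝓝 0) := by
    have := (tendsto_one_div_add_atTop_nhds_zero_nat (𝕜 := ℝ)).const_mul (R - r)
    simpa only [mul_one_div, mul_zero] using this
  choose ρ hρ using fun k => exists_isMollifier (n := n) (hεpos k)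
  obtain ⟨M, hM0, hM⟩ := hφ.exists_le_on_isCompact (isCompact_closedBall 0 R) hKΩ
  set c : ℕ → Cn n → ℝ := fun k => K.indicator (trunc φ k) with hc
  have hcm : ∀ k, Measurable (c k) := fun k =>
    hφ.measurable_indicator_trunc Metric.isClosed_closedBall hKΩ k
  have hcK : ∀ k, ∀ z ∈ K, c k z = trunc φ k z := fun k z hz => Set.indicator_of_mem hz _
  have hcub : ∀ k z, c k z ≤ M := by
    intro k z
    by_cases hz : z ∈ K
    · rw [hcK k z hz, trunc_le_iff (hφ.lt_top z (hKΩ hz))]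
      exact ⟨hM z hz, by linarith [(Nat.cast_nonneg k : (0 : ℝ) ≤ k)]⟩
    · simpa [hc, hz] using hM0
  have hclb : ∀ (k : ℕ) z, -(k : ℝ) ≤ c k z := by
    intro k z
    by_cases hz : z ∈ K
    · rw [hcK k z hz]
      exact neg_le_trunc (hφ.lt_top z (hKΩ hz))
    · simp [hc, hz]
  have hcb : ∀ k z, |c k z| ≤ max M k := fun k z => abs_le.2
    ⟨(neg_le_neg (le_max_right _ _)).trans (hclb k z), (hcub k z).trans (le_max_left _ _)⟩
  have hcl : ∀ k, LocallyIntegrable (c k) := by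
    intro k
    refine (locallyIntegrable_const (max M k)).mono (hcm k).aestronglyMeasurable
      (Eventually.of_forall fun z => ?_)
    exact (hcb k z).trans (le_abs_self _)
  have hgInt : ∀ k (g : Cn n → ℝ) (B : ℝ), Measurable g → (∀ y, |g y| ≤ B) →
      Integrable fun y => ρ k y * g y := by
    intro k g B hg hB
    exact (hρ k).integrable.mul_bdd hg.aestronglyMeasurable (Eventually.of_forall hB)
  have hmean : ∀ k (z w : Cn n), (∀ l : ℂ, ‖l‖ ≤ 1 → z + l • w ∈ K) →
      c k z ≤ Real.circleAverage (fun l : ℂ => c k (z + l • w)) 0 1 := by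
    intro k z w hzw
    have h0 : z ∈ K := by simpa using hzw 0 (by simp)
    rw [hcK k z h0, Real.circleAverage_congr_sphere (f₂ := fun l : ℂ => trunc φ k (z + l • w))
      fun l hl => hcK k _ (hzw l (by
        have : ‖l‖ = 1 := by simpa using hl
        exact this.le))]
    exact trunc_le_circleAverage hφ (fun l hl => hKΩ (hzw l hl)) k
  have hmeas : ∀ k (T : Cn n → ℂ → Cn n), Continuous (Function.uncurry T) →
      Measurable fun y => Real.circleAverage (fun l : ℂ => c k (T y l)) 0 1 := by
    intro k T hT
    have h1 : StronglyMeasurable (Function.uncurry fun (y : Cn n) (θ : ℝ) =>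
        c k (T y (circleMap 0 1 θ))) :=
      ((hcm k).comp (hT.comp (by fun_prop : Continuous fun p : Cn n × ℝ =>
        (p.1, circleMap 0 1 p.2))).measurable).stronglyMeasurable
    simp only [Real.circleAverage, intervalIntegral.integral_of_le Real.two_pi_pos.le]
    exact (h1.integral_prod_right (ν := volume.restrict
      (Set.Ioc 0 (2 * Real.pi)))).measurable.const_mul (2 * Real.pi)⁻¹
  have hbdd : ∀ k (T : ℂ → Cn n), |Real.circleAverage (fun l : ℂ => c k (T l)) 0 1| ≤ max M k := by
    intro k T
    have h2 := intervalIntegral.norm_integral_le_of_norm_le_const (a := 0) (b := 2 * Real.pi)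
      (C := max M k) (f := fun θ => c k (T (circleMap 0 1 θ))) fun θ _ => hcb k _
    rw [Real.circleAverage, smul_eq_mul, abs_mul, abs_of_pos (inv_pos.2 Real.two_pi_pos)]
    rw [sub_zero, abs_of_pos Real.two_pi_pos, Real.norm_eq_abs] at h2
    rw [inv_mul_le_iff₀ Real.two_pi_pos, mul_comm _ (max M (k : ℝ))]
    exact h2
  refine ⟨fun k => moll (ρ k) (c k), M, fun k =>
    contDiff_moll (hρ k).smooth (hρ k).hasCompactSupport (hcl k), fun z hz => ?_⟩
  have hz' : ‖z‖ < r := by simpa using hz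
  have hzK : z ∈ K := by simpa [hK] using (hz'.trans hrR).le
  have hlow : ∀ k, φ z ≤ ((moll (ρ k) (c k) z : ℝ) : EReal) := by
    intro k
    have e1 : Real.circleAverage (fun l : ℂ => ∫ y, ρ k y * c k (z - l • y)) 0 1
        = moll (ρ k) (c k) z := by
      rw [Real.circleAverage_congr_sphere (f₂ := fun _ => moll (ρ k) (c k) z),
        Real.circleAverage_const]
      intro l hl
      exact ((hρ k).moll_eq_integral_rot (c k) z (by simpa using hl)).symm
    rw [(hρ k).average_integral (hcm k) (hcb k) (T := fun l y => z - l • y)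
      (by simp only [Function.uncurry_def]; fun_prop)] at e1
    refine (le_coe_trunc (m := k) (hφ.lt_top z (hKΩ hzK))).trans ?_
    rw [EReal.coe_le_coe_iff, ← hcK k z hzK, ← e1]
    calc c k z = ∫ y, ρ k y * c k z := by
          rw [integral_mul_const, (hρ k).integral_eq_one, one_mul]
      _ ≤ _ := by
        refine integral_mono ((hρ k).integrable.mul_const _) (hgInt k _ (max M k) (hmeas k
          (fun y l => z - l • y) (by simp only [Function.uncurry_def]; fun_prop))
            fun y => hbdd k _) fun y => ?_
        by_cases hy : ρ k y = 0
        · simp [hy]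
        · refine mul_le_mul_of_nonneg_left ?_ ((hρ k).nonneg y)
          have := hmean k z (-y) fun l hl => ?_
          · simpa [sub_eq_add_neg] using this
          · have h1 := (hρ k).supp y hy
            have h2 : ‖l • (-y)‖ ≤ R - r := by
              rw [norm_smul, norm_neg]
              nlinarith [hεle k, norm_nonneg y, norm_nonneg l]
            have h3 := norm_add_le z (l • (-y))
            simpa [hK] using (by linarith : ‖z + l • (-y)‖ ≤ R)
  refine ⟨fun k w => ?_, hlow, fun k => ?_, ?_⟩
  · refine levi_nonneg_of_submean (contDiff_moll (hρ k).smooth (hρ k).hasCompactSupport (hcl k))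
      (sub_pos.2 hz') (fun w hw => ?_) w
    simp only [moll_eq_integral_sub]
    rw [(hρ k).average_integral (hcm k) (hcb k) (T := fun l y => z + l • w - y)
      (by simp only [Function.uncurry_def]; fun_prop)]
    refine integral_mono (hgInt k _ (max M k) ((hcm k).comp (by fun_prop)) fun y => hcb k _)
      (hgInt k _ (max M k) (hmeas k (fun y l => z + l • w - y)
        (by simp only [Function.uncurry_def]; fun_prop)) fun y => hbdd k _) fun y => ?_
    by_cases hy : ρ k y = 0
    · simp [hy]
    · refine mul_le_mul_of_nonneg_left ?_ ((hρ k).nonneg y)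
      have := hmean k (z - y) w fun l hl => ?_
      · simpa [sub_add_eq_add_sub] using this
      · have h1 := (hρ k).supp y hy
        have h2 : ‖l • w‖ ≤ r - ‖z‖ := by
          rw [norm_smul]
          nlinarith [norm_nonneg w, norm_nonneg l]
        have h3 := norm_add_le (z - y) (l • w)
        have h4 := norm_sub_le z y
        simpa [hK] using (by linarith [hεle k] : ‖z - y + l • w‖ ≤ R)
  · simp only [moll_eq_integral_sub]
    calc _ ≤ ∫ y, ρ k y * M := integral_mono (hgInt k _ (max M k) ((hcm k).comp (by fun_prop))
          fun y => hcb k _) ((hρ k).integrable.mul_const _) fun y =>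
            mul_le_mul_of_nonneg_left (hcub k _) ((hρ k).nonneg y)
      _ = M := by rw [integral_mul_const, (hρ k).integral_eq_one, one_mul]
  · refine tendsto_order.2 ⟨fun a ha => Eventually.of_forall fun k => ha.trans_le (hlow k),
      fun a ha => ?_⟩
    obtain ⟨b, hb1, hb2⟩ := EReal.lt_iff_exists_real_btwn.1 ha
    have hev := hφ.usc z (hKΩ hzK) b hb1
    rw [eventually_nhdsWithin_iff, Metric.eventually_nhds_iff] at hev
    obtain ⟨η, hη, hev⟩ := hev
    filter_upwards [hεlim.eventually (gt_mem_nhds hη), eventually_ge_atTop ⌈-b⌉₊] with k hk1 hk2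
    refine lt_of_le_of_lt ?_ hb2
    rw [EReal.coe_le_coe_iff, moll_eq_integral_sub]
    calc _ ≤ ∫ y, ρ k y * b := by
          refine integral_mono (hgInt k _ (max M k) ((hcm k).comp (by fun_prop))
            fun y => hcb k _) ((hρ k).integrable.mul_const _) fun y => ?_
          by_cases hy : ρ k y = 0
          · simp [hy]
          refine mul_le_mul_of_nonneg_left ?_ ((hρ k).nonneg y)
          have h1 := (hρ k).supp y hy
          have h2 : z - y ∈ K := by
            have := norm_sub_le z y
            simpa [hK] using (by linarith [hεle k] : ‖z - y‖ ≤ R)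
          rw [hcK k _ h2, trunc_le_iff (hφ.lt_top _ (hKΩ h2))]
          refine ⟨(hev (by simpa [dist_eq_norm] using h1.trans hk1) (hKΩ h2)).le, ?_⟩
          have := (Nat.le_ceil (-b)).trans (Nat.cast_le.2 hk2)
          linarith
      _ = b := by rw [integral_mul_const, (hρ k).integral_eq_one, one_mul]

end Approximation

section LeviCalculus

variable {u ψ : Cn n → ℝ}

lemma levi_add (hu : ContDiff ℝ ∞ u) (hψ : ContDiff ℝ ∞ ψ) (z w : Cn n) :
    levi (fun z => u z + ψ z) z w = levi u z w + levi ψ z w := by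
  have h1 : fderiv ℝ (fun z => u z + ψ z) = fun z => fderiv ℝ u z + fderiv ℝ ψ z := by
    ext1 z
    exact fderiv_fun_add (hu.differentiable (by simp) z) (hψ.differentiable (by simp) z)
  have h2 : fderiv ℝ (fun z => fderiv ℝ u z + fderiv ℝ ψ z) z
      = fderiv ℝ (fderiv ℝ u) z + fderiv ℝ (fderiv ℝ ψ) z :=
    fderiv_fun_add ((hu.fderiv_right (m := ∞) (by simp)).differentiable (by simp) z)
      ((hψ.fderiv_right (m := ∞) (by simp)).differentiable (by simp) z)
  simp only [levi, h1, h2, _root_.add_apply]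
  ring

lemma levi_comp {g : ℝ → ℝ} (hg : ContDiff ℝ ∞ g) (hu : ContDiff ℝ ∞ u) (z w : Cn n) :
    levi (fun z => g (u z)) z w = deriv g (u z) * levi u z w
      + deriv (deriv g) (u z) * ((fderiv ℝ u z w) ^ 2 + (fderiv ℝ u z (Complex.I • w)) ^ 2) / 4 := by
  have hud : Differentiable ℝ u := hu.differentiable (by simp)
  have hgd : Differentiable ℝ g := hg.differentiable (by simp)
  have hg1 : ContDiff ℝ ∞ (deriv g) := (contDiff_infty_iff_deriv.1 hg).2
  have h1 : fderiv ℝ (fun z => g (u z)) = fun z => deriv g (u z) • fderiv ℝ u z := by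
    ext1 z
    exact ((hgd (u z)).hasDerivAt.comp_hasFDerivAt z (hud z).hasFDerivAt).fderiv
  have e1 : HasFDerivAt (fun z => deriv g (u z)) (deriv (deriv g) (u z) • fderiv ℝ u z) z :=
    (hg1.differentiable (by simp) (u z)).hasDerivAt.comp_hasFDerivAt z (hud z).hasFDerivAt
  have e2 := ((hu.fderiv_right (m := ∞) (by simp)).differentiable (by simp) z).hasFDerivAt
  have h2 := (e1.smul e2).fderiv
  simp only [levi, h1]
  simp only [Pi.smul_def'] at h2
  rw [h2]
  simp
  ring

lemma hasFDerivAt_sum_norm_sq (z : Cn n) :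
    HasFDerivAt (fun z : Cn n => ∑ j, ‖z j‖ ^ 2)
      (∑ j, 2 • (innerSL ℝ (z j)).comp (ContinuousLinearMap.proj (R := ℝ) j)) z := by
  refine HasFDerivAt.fun_sum fun j _ => ?_
  have h1 : HasFDerivAt (fun z : Cn n => z j)
    (ContinuousLinearMap.proj (R := ℝ) (φ := fun _ : Fin n => ℂ) j) z :=
      (ContinuousLinearMap.proj (R := ℝ) (φ := fun _ : Fin n => ℂ) j).hasFDerivAt
  exact h1.norm_sq

lemma levi_sum_norm_sq (z w : Cn n) :
    levi (fun z : Cn n => ∑ j, ‖z j‖ ^ 2) z w = ∑ j, ‖w j‖ ^ 2 := by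
  have h1 : ∀ z v, fderiv ℝ (fun z : Cn n => ∑ j, ‖z j‖ ^ 2) z v = ∑ j, 2 * inner ℝ (z j) (v j) := by
    intro z v
    rw [(hasFDerivAt_sum_norm_sq z).fderiv]
    simp only [ContinuousLinearMap.sum_apply]
    refine Finset.sum_congr rfl fun j _ => ?_
    simp
    ring
  have h2 : ∀ v : Cn n, fderiv ℝ (fderiv ℝ (fun z : Cn n => ∑ j, ‖z j‖ ^ 2)) z v v
      = ∑ j, 2 * ‖v j‖ ^ 2 := by
    intro v
    have h : DifferentiableAt ℝ (fderiv ℝ (fun z : Cn n => ∑ j, ‖z j‖ ^ 2)) z :=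
      ((contDiff_sum_norm_sq.fderiv_right (m := ∞) (by simp)).differentiable (by simp)) z
    have h0 : fderiv ℝ (fderiv ℝ (fun z : Cn n => ∑ j, ‖z j‖ ^ 2)) z v v
        = fderiv ℝ (fun y => fderiv ℝ (fun z : Cn n => ∑ j, ‖z j‖ ^ 2) y v) z v := by
      rw [fderiv_clm_apply h (differentiableAt_const _)]
      simp
    rw [h0]
    simp only [h1]
    have h3 : HasFDerivAt (fun z : Cn n => ∑ j, 2 * inner ℝ (z j) (v j))
        (∑ j, (2 : ℝ) • ((innerSL ℝ (v j)).comp (ContinuousLinearMap.proj (R := ℝ) j))) z := by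
      refine HasFDerivAt.fun_sum fun j _ => ?_
      refine (((innerSL ℝ (v j)).comp (ContinuousLinearMap.proj (R := ℝ)
        (φ := fun _ : Fin n => ℂ) j)).hasFDerivAt.const_mul 2).congr_of_eventuallyEq
          (Eventually.of_forall fun y => ?_)
      simp [real_inner_comm]
    rw [h3.fderiv]
    simp
  rw [levi, h2, h2, ← Finset.sum_add_distrib, Finset.mul_sum]
  refine Finset.sum_congr rfl fun j _ => ?_
  simp
  ring

lemma abs_levi_le (u : Cn n → ℝ) (z w : Cn n) :
    |levi u z w| ≤ ‖fderiv ℝ (fderiv ℝ u) z‖ * ‖w‖ ^ 2 := by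
  have h1 : ∀ v : Cn n, ‖v‖ = ‖w‖ →
      |fderiv ℝ (fderiv ℝ u) z v v| ≤ ‖fderiv ℝ (fderiv ℝ u) z‖ * ‖w‖ ^ 2 := by
    intro v hv
    have := (fderiv ℝ (fderiv ℝ u) z).le_opNorm₂ v v
    rw [hv, Real.norm_eq_abs] at this
    linarith
  have h2 := h1 w rfl
  have h3 := h1 (Complex.I • w) (by simp [norm_smul])
  have h4 : 0 ≤ ‖fderiv ℝ (fderiv ℝ u) z‖ * ‖w‖ ^ 2 := by positivity
  rw [abs_le] at *
  unfold levi
  constructor <;> linarith [h2.1, h2.2, h3.1, h3.2]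

end LeviCalculus

section LocalHormander

variable {ψ : Cn n → ℝ}

lemma levi_congr {u : Cn n → ℝ} {z : Cn n} (h : u =ᶠ[𝓝 z] ψ) (w : Cn n) :
    levi u z w = levi ψ z w := by
  have h1 : fderiv ℝ u =ᶠ[𝓝 z] fderiv ℝ ψ := h.fderiv
  rw [levi, levi, h1.fderiv_eq]

lemma isCompact_sum_norm_sq_le (B : ℝ) : IsCompact {z : Cn n | ∑ j, ‖z j‖ ^ 2 ≤ B} := by
  refine Metric.isCompact_of_isClosed_isBounded
    (isClosed_le contDiff_sum_norm_sq.continuous continuous_const) ?_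
  refine (Metric.isBounded_iff_subset_closedBall 0).2 ⟨|B| + 1, fun z hz => ?_⟩
  have h1 := norm_sq_le_sum z
  have h2 : ∑ j, ‖z j‖ ^ 2 ≤ B := hz
  rw [mem_closedBall_zero_iff]
  nlinarith [norm_nonneg z, le_abs_self B, abs_nonneg B]

lemma norm_sq_mul_le_levi_pow {B : ℝ} (hB : 0 < B) (M : ℕ) (z w : Cn n) :
    0 ≤ levi (fun z : Cn n => ((∑ j, ‖z j‖ ^ 2) / B) ^ M) z w ∧
    (B ≤ ∑ j, ‖z j‖ ^ 2 →
      M / B * ‖w‖ ^ 2 ≤ levi (fun z : Cn n => ((∑ j, ‖z j‖ ^ 2) / B) ^ M) z w) := by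
  have hg : ContDiff ℝ ∞ fun x : ℝ => (x / B) ^ M := (contDiff_id.div_const B).pow M
  have hd : ∀ M : ℕ, deriv (fun x : ℝ => (x / B) ^ M) = fun x => M / B * (x / B) ^ (M - 1) := by
    intro M
    ext x
    have := ((hasDerivAt_id x).div_const B).pow M
    rw [show (fun x : ℝ => (x / B) ^ M) = (fun x => id x / B) ^ M from rfl, this.deriv]
    simp
    ring
  have h1 := levi_comp hg contDiff_sum_norm_sq z w
  have h2 : deriv (deriv fun x : ℝ => (x / B) ^ M) (∑ j, ‖z j‖ ^ 2)
      = M / B * ((M - 1 : ℕ) / B * ((∑ j, ‖z j‖ ^ 2) / B) ^ (M - 1 - 1)) := by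
    rw [hd, deriv_const_mul _ (by fun_prop), hd]
  have hE : 0 ≤ ∑ j, ‖z j‖ ^ 2 := by positivity
  rw [h1, h2, hd, levi_sum_norm_sq]
  have h3 : 0 ≤ M / B * ((M - 1 : ℕ) / B * ((∑ j, ‖z j‖ ^ 2) / B) ^ (M - 1 - 1))
    * ((fderiv ℝ (fun z : Cn n => ∑ j, ‖z j‖ ^ 2) z w) ^ 2
      + (fderiv ℝ (fun z : Cn n => ∑ j, ‖z j‖ ^ 2) z (Complex.I • w)) ^ 2) / 4 := by positivity
  refine ⟨by positivity, fun h => ?_⟩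
  have h4 : 1 ≤ ((∑ j, ‖z j‖ ^ 2) / B) ^ (M - 1) := one_le_pow₀ ((one_le_div hB).2 h)
  have h5 : M / B * ‖w‖ ^ 2 ≤ M / B * ((∑ j, ‖z j‖ ^ 2) / B) ^ (M - 1) * ∑ j, ‖w j‖ ^ 2 := by
    have := norm_sq_le_sum w
    have h6 : (0 : ℝ) ≤ M / B := by positivity
    calc M / B * ‖w‖ ^ 2 ≤ M / B * 1 * ∑ j, ‖w j‖ ^ 2 := by rw [mul_one]; gcongr
      _ ≤ _ := by gcongr
  linarith

/-- Every smooth function which is plurisubharmonic on a Euclidean ball agrees there, up to an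
error in `[0, 1]`, with a globally plurisubharmonic function. -/
lemma exists_levi_nonneg_extension {B : ℝ} (hB : 0 < B) (hψ : ContDiff ℝ ∞ ψ)
    (hlevi : ∀ z, ∑ j, ‖z j‖ ^ 2 < B → ∀ w, 0 ≤ levi ψ z w) :
    ∃ Ψ : Cn n → ℝ, ContDiff ℝ ∞ Ψ ∧ (∀ z w, 0 ≤ levi Ψ z w) ∧
      ∀ z, ∑ j, ‖z j‖ ^ 2 < B → ψ z ≤ Ψ z ∧ Ψ z ≤ ψ z + 1 ∧ ∀ w, levi ψ z w ≤ levi Ψ z w := by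
  obtain ⟨θ, hθ, hθc, -, hθ1, -⟩ := exists_cutoff (isCompact_sum_norm_sq_le (n := n) B) one_pos
  have hθψ : ContDiff ℝ ∞ fun z => θ z * ψ z := hθ.mul hψ
  have hθψc : HasCompactSupport fun z => θ z * ψ z := hθc.mul_right
  obtain ⟨S, hS⟩ := (((hθψc.fderiv ℝ).fderiv ℝ).isCompact_range (((hθψ.fderiv_right (m := ∞)
    (by simp)).fderiv_right (m := ∞) (by simp)).continuous)).isBounded.exists_norm_le
  obtain ⟨M, hM⟩ := exists_nat_ge (S * B)
  have hP : ContDiff ℝ ∞ fun z : Cn n => ((∑ j, ‖z j‖ ^ 2) / B) ^ M :=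
    (contDiff_sum_norm_sq.div_const B).pow M
  have hin : ∀ z, ∑ j, ‖z j‖ ^ 2 < B → ∀ w, levi (fun z => θ z * ψ z) z w = levi ψ z w := by
    intro z hz w
    refine levi_congr ?_ w
    filter_upwards [(isOpen_lt contDiff_sum_norm_sq.continuous continuous_const).mem_nhds hz]
      with y hy
    rw [hθ1 y (show _ ≤ _ from le_of_lt hy), one_mul]
  refine ⟨fun z => θ z * ψ z + ((∑ j, ‖z j‖ ^ 2) / B) ^ M, hθψ.add hP, fun z w => ?_,
    fun z hz => ⟨?_, ?_, fun w => ?_⟩⟩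
  · rw [levi_add hθψ hP]
    obtain ⟨h1, h2⟩ := norm_sq_mul_le_levi_pow hB M z w
    rcases lt_or_ge (∑ j, ‖z j‖ ^ 2) B with hz | hz
    · rw [hin z hz]
      linarith [hlevi z hz w]
    · have h3 := abs_levi_le (fun z => θ z * ψ z) z w
      have h4 : ‖fderiv ℝ (fderiv ℝ fun z => θ z * ψ z) z‖ ≤ S := hS _ ⟨z, rfl⟩
      have h5 : S * ‖w‖ ^ 2 ≤ M / B * ‖w‖ ^ 2 := by
        gcongr
        rwa [le_div_iff₀ hB]
      have h6 := mul_le_mul_of_nonneg_right h4 (sq_nonneg ‖w‖)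
      linarith [h2 hz, neg_abs_le (levi (fun z => θ z * ψ z) z w)]
  · have : 0 ≤ ((∑ j, ‖z j‖ ^ 2) / B) ^ M := by positivity
    simp only [hθ1 z (show _ ≤ _ from hz.le)]
    linarith
  · have : ((∑ j, ‖z j‖ ^ 2) / B) ^ M ≤ 1 :=
      pow_le_one₀ (by positivity) ((div_le_one hB).2 hz.le)
    simp only [hθ1 z (show _ ≤ _ from hz.le)]
    linarith
  · rw [levi_add hθψ hP, hin z hz]
    linarith [(norm_sq_mul_le_levi_pow hB M z w).1]

lemma dbar_eq_zero_of_notMem_tsupport {v : Cn n → ℂ} {z : Cn n} (h : z ∉ tsupport v)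
    (j : Fin n) : dbar j v z = 0 := by
  have : fderiv ℝ v z = 0 := by
    by_contra h1
    exact h (support_fderiv_subset ℝ h1)
  simp [dbar, this]

lemma hasCompactSupport_sum_dbar {α : Fin n → Cn n → ℂ} (hαc : ∀ j, HasCompactSupport (α j)) :
    HasCompactSupport fun z => ∑ j, dbar j (α j) z := by
  refine HasCompactSupport.intro (K := ⋃ j, tsupport (dbar j (α j)))
    (isCompact_iUnion fun j => hasCompactSupport_dbar j (hαc j)) fun z hz => ?_
  simp only [Set.mem_iUnion, not_exists] at hz
  exact Finset.sum_eq_zero fun j _ => image_eq_zero_of_notMem_tsupport (hz j)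

/-- The dual form of the Hörmander estimate on a Euclidean ball. -/
theorem hormander_dual_ball {B : ℝ} (hB : 0 < B) (hψ : ContDiff ℝ ∞ ψ)
    (hlevi : ∀ z, ∑ j, ‖z j‖ ^ 2 < B → ∀ w, 0 ≤ levi ψ z w) {v : Cn n → ℂ}
    (hv : ContDiff ℝ ∞ v) (hvc : HasCompactSupport v)
    (hvB : tsupport v ⊆ {z | ∑ j, ‖z j‖ ^ 2 < B}) {Q : Cn n → ℝ} (hQ0 : ∀ z, 0 ≤ Q z)
    (hQB : ∀ z, B ≤ ∑ j, ‖z j‖ ^ 2 → Q z = 0) (hQm : AEStronglyMeasurable Q volume)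
    (hQi : Integrable fun z => Q z * Real.exp (-ψ z))
    (hQ : ∀ z, ∑ j, ‖z j‖ ^ 2 < B → ∀ c,
      ‖∑ j, conj (dbar j v z) * c j‖ ^ 2 ≤ Q z * levi ψ z c)
    {α : Fin n → Cn n → ℂ} (hα : ∀ j, ContDiff ℝ ∞ (α j)) (hαc : ∀ j, HasCompactSupport (α j))
    (hαB : ∀ j, tsupport (α j) ⊆ {z | ∑ j, ‖z j‖ ^ 2 < B}) :
    ‖∫ z, v z * ∑ j, dbar j (α j) z‖ ^ 2 ≤ (∫ z, Q z * Real.exp (-ψ z))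
      * (Real.exp 1 * ∫ z, ‖∑ j, dbar j (α j) z‖ ^ 2 * Real.exp (ψ z)) := by
  obtain ⟨Ψ, hΨ, hΨl, hΨB⟩ := exists_levi_nonneg_extension hB hψ hlevi
  have hle : ∀ z, Q z * Real.exp (-Ψ z) ≤ Q z * Real.exp (-ψ z) := by
    intro z
    rcases lt_or_ge (∑ j, ‖z j‖ ^ 2) B with hz | hz
    · have := (hΨB z hz).1
      have h0 := hQ0 z
      gcongr
    · simp [hQB z hz]
  have hQi' : Integrable fun z => Q z * Real.exp (-Ψ z) := by
    refine hQi.mono (hQm.mul (hΨ.continuous.neg.rexp).aestronglyMeasurable)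
      (Eventually.of_forall fun z => ?_)
    have h0 := hQ0 z
    rw [Real.norm_of_nonneg (by positivity), Real.norm_of_nonneg (by positivity)]
    exact hle z
  have hS : Continuous fun z => ‖∑ j, dbar j (α j) z‖ ^ 2 :=
    (continuous_finsetSum _ fun j _ => (contDiff_dbar j (hα j)).continuous).norm.pow 2
  have hSc : HasCompactSupport fun z => ‖∑ j, dbar j (α j) z‖ ^ 2 := by
    have h1 := hasCompactSupport_sum_dbar hαc
    exact h1.comp_left (g := fun x : ℂ => ‖x‖ ^ 2) (by simp)
  refine (hormander_dual hΨ hΨl hv hvc hQ0 hQi' ?_ hα hαc).trans ?_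
  · intro z c
    rcases lt_or_ge (∑ j, ‖z j‖ ^ 2) B with hz | hz
    · exact (hQ z hz c).trans (mul_le_mul_of_nonneg_left ((hΨB z hz).2.2 c) (hQ0 z))
    · have : z ∉ tsupport v := fun h => absurd (hvB h) (not_lt.2 hz)
      simp [dbar_eq_zero_of_notMem_tsupport this, hQB z hz]
  · refine mul_le_mul (integral_mono hQi' hQi hle) ?_
      (integral_nonneg fun z => by positivity) (integral_nonneg fun z => ?_)
    · rw [← integral_const_mul]
      refine integral_mono ((hS.mul hΨ.continuous.rexp).integrable_of_hasCompactSupport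
        hSc.mul_right) (((hS.mul hψ.continuous.rexp).integrable_of_hasCompactSupport
        hSc.mul_right).const_mul _) fun z => ?_
      rcases lt_or_ge (∑ j, ‖z j‖ ^ 2) B with hz | hz
      · have h2 : Real.exp (Ψ z) ≤ Real.exp 1 * Real.exp (ψ z) := by
          rw [← Real.exp_add]
          exact Real.exp_le_exp.2 (by linarith [(hΨB z hz).2.1])
        calc ‖∑ j, dbar j (α j) z‖ ^ 2 * Real.exp (Ψ z)
            ≤ ‖∑ j, dbar j (α j) z‖ ^ 2 * (Real.exp 1 * Real.exp (ψ z)) := by gcongr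
          _ = _ := by ring
      · have : ∀ j, dbar j (α j) z = 0 := fun j => dbar_eq_zero_of_notMem_tsupport
          (fun h => absurd (hαB j h) (not_lt.2 hz)) j
        simp [this]
    · have := hQ0 z
      positivity

end LocalHormander

section Holomorphic

variable {ρ : Cn n → ℝ} {ε : ℝ}

lemma IsMollifier.moll_eq_of_circleAverage (hρ : IsMollifier ρ ε) {c : Cn n → ℝ} {z : Cn n}
    (hc : ContinuousOn c (Metric.closedBall z ε))
    (hmean : ∀ y, ‖y‖ < ε → Real.circleAverage (fun l : ℂ => c (z - l • y)) 0 1 = c z) :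
    moll ρ c z = c z := by
  set K := Metric.closedBall z ε
  set d : Cn n → ℝ := K.indicator c with hd
  have hdm : Measurable d := by
    classical
    rw [hd, ← Set.piecewise_eq_indicator]
    exact hc.measurable_piecewise continuousOn_const Metric.isClosed_closedBall.measurableSet
  obtain ⟨B, hB⟩ := (isCompact_closedBall z ε).exists_bound_of_continuousOn hc
  have hB0 : 0 ≤ max B 0 := le_max_right _ _
  have hdB : ∀ y, |d y| ≤ max B 0 := by
    intro y
    by_cases hy : y ∈ K
    · rw [hd, Set.indicator_of_mem hy]
      exact (hB y hy).trans (le_max_left _ _)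
    · rw [hd, Set.indicator_of_notMem hy, abs_zero]
      exact hB0
  have hmem : ∀ (l : ℂ) (y : Cn n), ‖l‖ ≤ 1 → ‖y‖ < ε → z - l • y ∈ K := by
    intro l y hl hy
    have : ‖l • y‖ ≤ 1 * ε := by
      rw [norm_smul]
      gcongr
    simpa [K, dist_eq_norm] using this
  have e0 : moll ρ c z = moll ρ d z := by
    rw [moll_eq_integral_sub, moll_eq_integral_sub]
    congr 1; ext y
    by_cases hy : ρ y = 0
    · simp [hy]
    · rw [hd, Set.indicator_of_mem]
      simpa using hmem 1 y (by simp) (hρ.supp y hy)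
  have e1 : Real.circleAverage (fun l : ℂ => ∫ y, ρ y * d (z - l • y)) 0 1 = moll ρ d z := by
    rw [Real.circleAverage_congr_sphere (f₂ := fun _ => moll ρ d z), Real.circleAverage_const]
    intro l hl
    exact (hρ.moll_eq_integral_rot d z (by simpa using hl)).symm
  rw [hρ.average_integral hdm hdB (T := fun l y => z - l • y)
      (by simp only [Function.uncurry_def]; fun_prop)] at e1
  rw [e0, ← e1]
  calc _ = ∫ y, ρ y * c z := by
        congr 1; ext y
        by_cases hy : ρ y = 0
        · simp [hy]
        · congr 1
          rw [← hmean y (hρ.supp y hy)]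
          refine Real.circleAverage_congr_sphere fun l hl => ?_
          rw [hd]
          exact Set.indicator_of_mem (hmem l y (by simpa using (le_of_eq (by simpa using hl)))
            (hρ.supp y hy)) c
    _ = c z := by rw [integral_mul_const, hρ.integral_eq_one, one_mul]

/-- Mollification by a rotation invariant kernel reproduces holomorphic functions. -/
lemma IsMollifier.moll_eq_of_differentiableOn (hρ : IsMollifier ρ ε) {f : Cn n → ℂ} {z : Cn n}
    (hf : DifferentiableOn ℂ f (Metric.closedBall z ε)) : moll ρ f z = f z := by
  have hfc : ContinuousOn f (Metric.closedBall z ε) := hf.continuousOn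
  have hε := hρ.pos
  have hmem : ∀ (l : ℂ) (y : Cn n), ‖l‖ ≤ 1 → ‖y‖ < ε → z - l • y ∈ Metric.closedBall z ε := by
    intro l y hl hy
    have : ‖l • y‖ ≤ 1 * ε := by
      rw [norm_smul]
      gcongr
    simpa [dist_eq_norm] using this
  have hmean : ∀ y, ‖y‖ < ε → Real.circleAverage (fun l : ℂ => f (z - l • y)) 0 1 = f z := by
    intro y hy
    have h1 : DifferentiableOn ℂ (fun l : ℂ => f (z - l • y)) (closure (Metric.ball 0 |1|)) := by
      refine hf.comp (by fun_prop) fun l hl => hmem l y ?_ hy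
      simpa [closure_ball] using hl
    simpa using h1.diffContOnCl.circleAverage
  have hci : ∀ y, ‖y‖ < ε → CircleIntegrable (fun l : ℂ => f (z - l • y)) 0 1 := by
    intro y hy
    refine ContinuousOn.circleIntegrable zero_le_one ?_
    refine hfc.comp (by fun_prop) fun l hl => hmem l y ?_ hy
    exact (le_of_eq (by simpa using hl))
  have hgInt : Integrable fun y => ρ (z - y) • f y := by
    have h1 : IntegrableOn (fun y => ρ (z - y) • f y) (Metric.closedBall z ε) :=
      ((hρ.smooth.continuous.comp (continuous_const.sub continuous_id)).continuousOn.smul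
        hfc).integrableOn_compact (isCompact_closedBall z ε)
    refine (integrableOn_iff_integrable_of_support_subset fun y hy => ?_).1 h1
    have h2 : ρ (z - y) ≠ 0 := fun h => hy (by simp [h])
    have := hρ.supp _ h2
    rw [Metric.mem_closedBall, dist_comm, dist_eq_norm]
    exact this.le
  have key : ∀ L : ℂ →L[ℝ] ℝ, L (moll ρ f z) = L (f z) := by
    intro L
    have h1 : L (moll ρ f z) = moll ρ (fun y => L (f y)) z := by
      rw [moll, ← L.integral_comp_comm hgInt, moll]
      simp only [map_smul]
    rw [h1]
    refine hρ.moll_eq_of_circleAverage (c := fun y => L (f y)) (L.continuous.comp_continuousOn hfc)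
      fun y hy => ?_
    rw [← hmean y hy, ← L.circleAverage_comp_comm (hci y hy)]
    rfl
  exact Complex.ext (key Complex.reCLM) (key Complex.imCLM)

lemma dbar_eq_zero_of_differentiableAt {f : Cn n → ℂ} {z : Cn n} (h : DifferentiableAt ℂ f z)
    (j : Fin n) : dbar j f z = 0 := by
  have : fderiv ℝ f z = (fderiv ℂ f z).restrictScalars ℝ :=
    (h.hasFDerivAt.restrictScalars ℝ).fderiv
  rw [dbar, this]
  simp [← mul_assoc]

lemma differentiableAt_of_dbar_eq_zero {f : Cn n → ℂ} {z : Cn n} (h : DifferentiableAt ℝ f z)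
    (h0 : ∀ j, dbar j f z = 0) : DifferentiableAt ℂ f z := by
  have hI : ∀ j, fderiv ℝ f z (Complex.I • stdVec j) = Complex.I * fderiv ℝ f z (stdVec j) := by
    intro j
    have h1 := h0 j
    simp only [dbar, mul_eq_zero] at h1
    have h2 := h1.resolve_left (by norm_num)
    linear_combination (-Complex.I) * h2 + fderiv ℝ f z (Complex.I • stdVec j) * Complex.I_sq
  set L : Cn n →L[ℂ] ℂ := ∑ j, (fderiv ℝ f z (stdVec j)) •
    (ContinuousLinearMap.proj (R := ℂ) (φ := fun _ : Fin n => ℂ) j) with hL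
  have hLe : L.restrictScalars ℝ = fderiv ℝ f z := by
    ext w
    have hw : w = ∑ j, ((w j).re • stdVec j + (w j).im • (Complex.I • stdVec j)) := by
      ext i
      simp [stdVec, Finset.sum_apply, Pi.single_apply, Finset.sum_add_distrib]
    conv_rhs => rw [hw]
    simp only [hL, map_sum, map_add, map_smul, hI]
    simp
    refine Finset.sum_congr rfl fun j _ => ?_
    conv_lhs => rw [← Complex.re_add_im (w j)]
    ring
  exact (hasFDerivAt_of_restrictScalars ℝ h.hasFDerivAt hLe).differentiableAt

lemma moll_comm {σ : Cn n → ℝ} {δ : ℝ} (hρ : IsMollifier ρ ε) (hσ : IsMollifier σ δ) {h : Cn n → ℂ}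
    (hh : Integrable h) (z : Cn n) : moll ρ (moll σ h) z = moll σ (moll ρ h) z := by
  have key : ∀ {ρ σ : Cn n → ℝ} {ε δ : ℝ}, IsMollifier ρ ε → IsMollifier σ δ →
      moll ρ (moll σ h) z = ∫ x, (∫ y, ρ (z - y) * σ (y - x)) • h x := by
    intro ρ σ ε δ hρ hσ
    obtain ⟨S, hS⟩ := hσ.hasCompactSupport.exists_bound_of_continuous hσ.smooth.continuous
    have hi : Integrable (Function.uncurry fun y x => ρ (z - y) • σ (y - x) • h x)
        (volume.prod volume) := by
      have h1 : Integrable (fun p : Cn n × Cn n => ρ (z - p.1) • h p.2) (volume.prod volume) :=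
        (hρ.integrable.comp_sub_left z).smul_prod hh
      have h2 : Continuous fun p : Cn n × Cn n => σ (p.1 - p.2) :=
        hσ.smooth.continuous.comp (continuous_fst.sub continuous_snd)
      have h3 := h1.bdd_smul (𝕜 := ℝ) S h2.aestronglyMeasurable
        (Eventually.of_forall fun p => hS _)
      refine h3.congr (Eventually.of_forall fun p => ?_)
      simp only [Function.uncurry, Pi.smul_apply', smul_smul]
      rw [mul_comm]
    have e1 : moll ρ (moll σ h) z = ∫ y, ∫ x, ρ (z - y) • σ (y - x) • h x := by
      simp only [moll, integral_smul]
    rw [e1, integral_integral_swap hi]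
    congr 1; ext x
    rw [← integral_smul_const]
    simp only [smul_smul]
  rw [key hρ hσ, key hσ hρ]
  congr 1; ext x
  congr 1
  rw [← integral_sub_left_eq_self _ volume (z + x)]
  congr 1; ext y
  rw [mul_comm]
  congr 2 <;> abel_nf

lemma exists_contDiff_eq_of_differentiableOn {f : Cn n → ℂ} {r s : ℝ} (hsr : s < r)
    (hf : DifferentiableOn ℂ f (Metric.ball 0 r)) :
    ∃ g : Cn n → ℂ, ContDiff ℝ ∞ g ∧ ∀ z ∈ Metric.ball 0 s, g z = f z := by
  obtain ⟨ρ, hρ⟩ := exists_isMollifier (n := n) (half_pos (sub_pos.2 hsr))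
  set K : Set (Cn n) := Metric.closedBall 0 (s + (r - s) / 2) with hK
  have hKr : K ⊆ Metric.ball 0 r := Metric.closedBall_subset_ball (by linarith)
  have hgInt : Integrable (K.indicator f) :=
    ((hf.continuousOn.mono hKr).integrableOn_compact
      (isCompact_closedBall _ _)).integrable_indicator Metric.isClosed_closedBall.measurableSet
  refine ⟨moll ρ (K.indicator f), contDiff_moll hρ.smooth hρ.hasCompactSupport
    hgInt.locallyIntegrable, fun z hz => ?_⟩
  rw [mem_ball_zero_iff] at hz
  have hsub : Metric.closedBall z ((r - s) / 2) ⊆ K := by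
    refine Metric.closedBall_subset_closedBall' ?_
    rw [dist_zero_right]
    linarith
  have hd : DifferentiableOn ℂ (K.indicator f) (Metric.closedBall z ((r - s) / 2)) :=
    (hf.mono (hsub.trans hKr)).congr fun y hy => Set.indicator_of_mem (hsub hy) f
  rw [hρ.moll_eq_of_differentiableOn hd,
    Set.indicator_of_mem (hsub (Metric.mem_closedBall_self hρ.pos.le))]

/-- **Weyl's lemma** for the Cauchy-Riemann operator. -/
theorem exists_differentiableOn_ae_eq_of_weak {h : Cn n → ℂ} (hh : Integrable h) {r s : ℝ}
    (hsr : s < r)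
    (hw : ∀ (j : Fin n) (α : Cn n → ℂ), ContDiff ℝ ∞ α → HasCompactSupport α →
      tsupport α ⊆ Metric.ball 0 r → ∫ z, h z * dbar j α z = 0) :
    ∃ F : Cn n → ℂ, ContDiff ℝ ∞ F ∧ DifferentiableOn ℂ F (Metric.ball 0 s) ∧
      ∀ᵐ z, z ∈ Metric.ball (0 : Cn n) s → h z = F z := by
  set η := (r - s) / 3 with hη
  have hη0 : 0 < η := by rw [hη]; linarith
  have hd : ∀ {ρ : Cn n → ℝ} {ε : ℝ}, IsMollifier ρ ε → ε ≤ η →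
      ContDiff ℝ ∞ (moll ρ h) ∧ DifferentiableOn ℂ (moll ρ h) (Metric.ball 0 (s + 2 * η)) := by
    intro ρ ε hρ hε
    have hsm := contDiff_moll hρ.smooth hρ.hasCompactSupport hh.locallyIntegrable
    refine ⟨hsm, fun z hz => (differentiableAt_of_dbar_eq_zero
      (hsm.differentiable (by simp) z) fun j => ?_).differentiableWithinAt⟩
    rw [mem_ball_zero_iff] at hz
    have hρ' : ContDiff ℝ ∞ fun y => (ρ y : ℂ) := contDiff_ofReal_comp hρ.smooth
    have hc : HasCompactSupport fun y => (ρ (z - y) : ℂ) :=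
      (hρ.hasCompactSupport.comp_left (g := fun x : ℝ => (x : ℂ)) (by simp)).comp_homeomorph
        (Homeomorph.subLeft z)
    have h1 := hw j (fun y => (ρ (z - y) : ℂ)) (hρ'.comp (contDiff_const.sub contDiff_id)) hc ?_
    · rw [dbar_moll hρ.smooth hρ.hasCompactSupport hh.locallyIntegrable, ← neg_eq_zero,
        ← integral_neg, ← h1]
      congr 1; ext y
      rw [dbar_comp_const_sub j (fun y => (ρ y : ℂ))]
      ring
    · have h2 : tsupport (fun y => (ρ (z - y) : ℂ)) ⊆ Metric.closedBall z ε := by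
        refine closure_minimal (fun y hy => ?_) Metric.isClosed_closedBall
        have h3 : ρ (z - y) ≠ 0 := fun h0 => hy (by simp [h0])
        rw [Metric.mem_closedBall, dist_comm, dist_eq_norm]
        exact (hρ.supp _ h3).le
      refine h2.trans (Metric.closedBall_subset_ball' ?_)
      rw [dist_zero_right]
      linarith
  have hrep : ∀ {ρ σ : Cn n → ℝ} {ε δ : ℝ}, IsMollifier ρ ε → IsMollifier σ δ → ε ≤ η → δ ≤ η →
      ∀ z ∈ Metric.ball (0 : Cn n) s, moll ρ (moll σ h) z = moll σ h z := by
    intro ρ σ ε δ hρ hσ hε hδ z hz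
    refine hρ.moll_eq_of_differentiableOn ((hd hσ hδ).2.mono
      (Metric.closedBall_subset_ball' ?_))
    rw [mem_ball_zero_iff] at hz
    rw [dist_zero_right]
    linarith
  obtain ⟨σ, hσ⟩ := exists_isMollifier (n := n) hη0
  obtain ⟨hF, hFd⟩ := hd hσ le_rfl
  refine ⟨moll σ h, hF, hFd.mono (Metric.ball_subset_ball (by linarith)), ?_⟩
  have hzero : ∀ᵐ z, z ∈ Metric.ball (0 : Cn n) s → h z - moll σ h z = 0 := by
    refine Metric.isOpen_ball.ae_eq_zero_of_integral_contDiff_smul_eq_zero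
      ((hh.locallyIntegrable.sub hF.continuous.locallyIntegrable).locallyIntegrableOn _)
      fun g hg hgc hgs => ?_
    have hgC : Continuous fun z => (g z : ℂ) := Complex.continuous_ofReal.comp hg.continuous
    have hgCc : HasCompactSupport fun z => (g z : ℂ) :=
      hgc.comp_left (g := fun x : ℝ => (x : ℂ)) (by simp)
    have i1 : Integrable fun z => (g z : ℂ) * h z :=
      hh.locallyIntegrable.integrable_smul_left_of_hasCompactSupport (𝕜 := ℂ) hgC hgCc
    have i2 : Integrable fun z => (g z : ℂ) * moll σ h z :=
      (hgC.mul hF.continuous).integrable_of_hasCompactSupport hgCc.mul_right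
    have e1 : ∫ z, g z • (h z - moll σ h z)
        = (∫ z, (g z : ℂ) * h z) - ∫ z, (g z : ℂ) * moll σ h z := by
      rw [← integral_sub i1 i2]
      congr 1; ext z
      rw [Complex.real_smul]; ring
    have e2 : ∀ κ > 0, ‖∫ z, g z • (h z - moll σ h z)‖ ≤ κ := by
      intro κ hκ
      obtain ⟨ε₀, hε₀, H⟩ := exists_moll_pairing_close hgC hgCc hh hκ
      obtain ⟨ρ, hρ⟩ := exists_isMollifier (n := n) (lt_min hε₀ hη0)
      have h1 := H _ (min_le_left _ _) ρ hρ
      have e3 : ∫ z, (g z : ℂ) * moll σ h z = ∫ z, (g z : ℂ) * moll ρ h z := by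
        congr 1; ext z
        by_cases hz : g z = 0
        · simp [hz]
        · have hz' : z ∈ Metric.ball (0 : Cn n) s := hgs (subset_tsupport _ hz)
          rw [← hrep hρ hσ (min_le_right _ _) le_rfl z hz', moll_comm hρ hσ hh,
            hrep hσ hρ le_rfl (min_le_right _ _) z hz']
      rwa [e1, norm_sub_rev, e3]
    exact norm_le_zero_iff.1 (le_of_forall_pos_le_add fun κ hκ => by simpa using e2 κ hκ)
  filter_upwards [hzero] with z hz hzs using sub_eq_zero.1 (hz hzs)

end Holomorphic

section CutoffEstimate

lemma deriv_smoothTransition_eq_zero {x : ℝ} (hx : x ≤ 0 ∨ 1 ≤ x) :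
    deriv Real.smoothTransition x = 0 := by
  rcases hx with hx | hx
  · refine IsLocalMin.deriv_eq_zero (Eventually.of_forall fun y => ?_)
    rw [Real.smoothTransition.zero_of_nonpos hx]
    exact Real.smoothTransition.nonneg y
  · refine IsLocalMax.deriv_eq_zero (Eventually.of_forall fun y => ?_)
    rw [Real.smoothTransition.one_of_one_le hx]
    exact Real.smoothTransition.le_one y

lemma exists_abs_deriv_smoothTransition_le :
    ∃ K : ℝ, 0 ≤ K ∧ ∀ x, |deriv Real.smoothTransition x| ≤ K := by
  have hc : Continuous (deriv Real.smoothTransition) :=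
    (Real.smoothTransition.contDiff (n := 1)).continuous_deriv (by simp)
  obtain ⟨K, hK⟩ := (HasCompactSupport.intro (isCompact_Icc (a := (0 : ℝ)) (b := 1)) fun x hx =>
    deriv_smoothTransition_eq_zero (by
      rw [Set.mem_Icc, not_and_or, not_le, not_le] at hx
      exact hx.imp le_of_lt le_of_lt)).exists_bound_of_continuous hc
  exact ⟨K, (norm_nonneg _).trans (hK 0), hK⟩

lemma sum_dwir_ofReal_mul {u : Cn n → ℝ} (hu : ContDiff ℝ ∞ u) (z c : Cn n) :
    ∑ j, dwir j (fun z => (u z : ℂ)) z * c j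
      = (1 / 2) * (fderiv ℝ u z c - Complex.I * fderiv ℝ u z (Complex.I • c)) := by
  have hw : ∀ w : Cn n, (fderiv ℝ u z w : ℂ) = ∑ j, ((w j).re * fderiv ℝ u z (stdVec j)
      + (w j).im * fderiv ℝ u z (Complex.I • stdVec j)) := by
    intro w
    have hw : w = ∑ j, ((w j).re • stdVec j + (w j).im • (Complex.I • stdVec j)) := by
      ext i
      simp [stdVec, Finset.sum_apply, Pi.single_apply, Finset.sum_add_distrib]
    conv_lhs => rw [hw]
    simp
  rw [hw, hw, Complex.ofReal_sum, Complex.ofReal_sum, Finset.mul_sum, ← Finset.sum_sub_distrib, Finset.mul_sum]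
  refine Finset.sum_congr rfl fun j _ => ?_
  simp only [dwir, fderiv_ofReal hu]
  have hc : c j = (c j).re + (c j).im * Complex.I := (Complex.re_add_im _).symm
  generalize (c j).re = a at hc
  generalize (c j).im = b at hc
  simp only [hc, Pi.smul_apply, smul_eq_mul]
  simp
  ring_nf
  simp
  ring

lemma norm_sum_dwir_ofReal_mul_sq {u : Cn n → ℝ} (hu : ContDiff ℝ ∞ u) (z c : Cn n) :
    ‖∑ j, dwir j (fun z => (u z : ℂ)) z * c j‖ ^ 2
      = ((fderiv ℝ u z c) ^ 2 + (fderiv ℝ u z (Complex.I • c)) ^ 2) / 4 := by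
  rw [sum_dwir_ofReal_mul hu, ← Complex.normSq_eq_norm_sq, Complex.normSq_apply]
  simp
  ring

/-- A cut-off of `g` supported where `u < -t`. -/
def cutoffFun (r t : ℝ) (u : Cn n → ℝ) (g : Cn n → ℂ) : Cn n → ℂ :=
  (Metric.ball (0 : Cn n) r).indicator fun z => (Real.smoothTransition (-t - u z) : ℂ) * g z

variable {u u₀ : Cn n → ℝ} {g : Cn n → ℂ} {r s t η : ℝ}

lemma cutoffFun_ne_zero {z : Cn n} (h : cutoffFun r t u g z ≠ 0) :
    z ∈ Metric.ball (0 : Cn n) r ∧ u z < -t := by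
  have hz : z ∈ Metric.ball (0 : Cn n) r := Set.mem_of_indicator_ne_zero h
  refine ⟨hz, ?_⟩
  rw [cutoffFun, Set.indicator_of_mem hz] at h
  by_contra! h1
  exact h (by simp [Real.smoothTransition.zero_of_nonpos (by linarith : -t - u z ≤ 0)])

lemma norm_cutoffFun_le (r t : ℝ) (u : Cn n → ℝ) (g : Cn n → ℂ) (z : Cn n) :
    ‖cutoffFun r t u g z‖ ≤ ‖g z‖ := by
  by_cases hz : z ∈ Metric.ball (0 : Cn n) r
  · rw [cutoffFun, Set.indicator_of_mem hz, norm_mul, Complex.norm_real, Real.norm_eq_abs,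
      abs_of_nonneg (Real.smoothTransition.nonneg _)]
    exact mul_le_of_le_one_left (norm_nonneg _) (Real.smoothTransition.le_one _)
  · rw [cutoffFun, Set.indicator_of_notMem hz, norm_zero]
    exact norm_nonneg _

lemma tsupport_cutoffFun_subset (hsub : ∀ z ∈ Metric.ball (0 : Cn n) r, u z < -t → ‖z‖ ≤ s) :
    tsupport (cutoffFun r t u g) ⊆ Metric.closedBall 0 s :=
  closure_minimal (fun z hz => by
    obtain ⟨h1, h2⟩ := cutoffFun_ne_zero hz
    simpa using hsub z h1 h2) Metric.isClosed_closedBall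

lemma contDiff_cutoffFun (hu : ContDiff ℝ ∞ u) (hg : ContDiff ℝ ∞ g) (hsr : s < r)
    (hsub : ∀ z ∈ Metric.ball (0 : Cn n) r, u z < -t → ‖z‖ ≤ s) :
    ContDiff ℝ ∞ (cutoffFun r t u g) := by
  have hτ : ContDiff ℝ ∞ fun z => (Real.smoothTransition (-t - u z) : ℂ) * g z :=
    (contDiff_ofReal_comp (Real.smoothTransition.contDiff.comp (contDiff_const.sub hu))).mul hg
  rw [contDiff_iff_contDiffAt]
  intro z
  by_cases hz : z ∈ Metric.ball (0 : Cn n) r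
  · refine hτ.contDiffAt.congr_of_eventuallyEq ?_
    filter_upwards [Metric.isOpen_ball.mem_nhds hz] with y hy
    exact Set.indicator_of_mem hy _
  · have h1 : z ∉ tsupport (cutoffFun r t u g) := fun h =>
      hz (Metric.closedBall_subset_ball hsr (tsupport_cutoffFun_subset hsub h))
    exact contDiffAt_const.congr_of_eventuallyEq (notMem_tsupport_iff_eventuallyEq.1 h1)

lemma dbar_cutoffFun (hu : ContDiff ℝ ∞ u) (hg : ContDiff ℝ ∞ g)
    (hgd : DifferentiableOn ℂ g (Metric.ball 0 r)) {z : Cn n}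
    (hz : z ∈ Metric.ball (0 : Cn n) r) (j : Fin n) :
    dbar j (cutoffFun r t u g) z
      = -((deriv Real.smoothTransition (-t - u z) : ℝ) : ℂ) * g z * dbar j (fun z => (u z : ℂ)) z := by
  have hd : HasFDerivAt (fun z => (Real.smoothTransition (-t - u z)))
      (deriv Real.smoothTransition (-t - u z) • (-fderiv ℝ u z)) z := by
    have h1 := (hu.differentiable (by simp) z).hasFDerivAt.const_sub (-t)
    exact ((Real.smoothTransition.contDiff (n := 1)).differentiable (by simp)
      _).hasDerivAt.comp_hasFDerivAt z h1
  have hτ : ContDiff ℝ ∞ fun z => Real.smoothTransition (-t - u z) :=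
    Real.smoothTransition.contDiff.comp (contDiff_const.sub hu)
  have he : cutoffFun r t u g =ᶠ[𝓝 z] fun z => (Real.smoothTransition (-t - u z) : ℂ) * g z := by
    filter_upwards [Metric.isOpen_ball.mem_nhds hz] with y hy
    exact Set.indicator_of_mem hy _
  have h1 : dbar j (cutoffFun r t u g) z
      = dbar j (fun z => (Real.smoothTransition (-t - u z) : ℂ) * g z) z := by
    rw [dbar, dbar, he.fderiv_eq]
  rw [h1, dbar_mul j ((contDiff_ofReal_comp hτ).differentiable (by simp) z)
    (hg.differentiable (by simp) z), dbar_eq_zero_of_differentiableAt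
      (hgd.differentiableAt (Metric.isOpen_ball.mem_nhds hz))]
  simp only [dbar, fderiv_ofReal hτ, fderiv_ofReal hu, hd.fderiv]
  simp
  ring

/-- The estimate for the cut-off of a holomorphic function, for smooth weights. -/
lemma norm_integral_cutoffFun_sq_le (hr : 0 < r) (hη : 0 < η) (hu : ContDiff ℝ ∞ u)
    (hu₀ : ContDiff ℝ ∞ u₀)
    (hul : ∀ z ∈ Metric.ball (0 : Cn n) r, ∀ w, 0 ≤ levi u z w)
    (hu₀l : ∀ z ∈ Metric.ball (0 : Cn n) r, ∀ w, 0 ≤ levi u₀ z w) (hg : ContDiff ℝ ∞ g)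
    (hgd : DifferentiableOn ℂ g (Metric.ball 0 r)) (hs : s < r) (hns : n * s ^ 2 < r ^ 2)
    (hsub : ∀ z ∈ Metric.ball (0 : Cn n) r, u z < -t → ‖z‖ ≤ s) {K : ℝ} (hK0 : 0 ≤ K)
    (hK : ∀ x, |deriv Real.smoothTransition x| ≤ K) {I : ℝ} (hI : 0 ≤ I)
    (hgInt : ∫⁻ z in {z | u z < -t} ∩ Metric.ball (0 : Cn n) r,
      ENNReal.ofReal (‖g z‖ ^ 2 * Real.exp (-2 * u₀ z)) ≤ ENNReal.ofReal I)
    {α : Fin n → Cn n → ℂ} (hα : ∀ j, ContDiff ℝ ∞ (α j)) (hαc : ∀ j, HasCompactSupport (α j))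
    (hαB : ∀ j, tsupport (α j) ⊆ {z | ∑ j, ‖z j‖ ^ 2 < r ^ 2}) :
    ‖∫ z, cutoffFun r t u g z * ∑ j, dbar j (α j) z‖ ^ 2
      ≤ (K ^ 2 / η ^ 2 * Real.exp ((2 + η) * (t + 1)) * I) * (Real.exp 1 *
        ∫ z, ‖∑ j, dbar j (α j) z‖ ^ 2
          * Real.exp (2 * u₀ z + 2 * u z + Real.exp (η * u z))) := by
  have hball : ∀ z : Cn n, ∑ j, ‖z j‖ ^ 2 < r ^ 2 → z ∈ Metric.ball (0 : Cn n) r := by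
    intro z hz
    rw [mem_ball_zero_iff]
    exact lt_of_pow_lt_pow_left₀ 2 hr.le ((norm_sq_le_sum z).trans_lt hz)
  have hexp : ContDiff ℝ ∞ fun x : ℝ => Real.exp (η * x) :=
    Real.contDiff_exp.comp (contDiff_const.mul contDiff_id)
  have h2 : ∀ {w : Cn n → ℝ}, ContDiff ℝ ∞ w → ContDiff ℝ ∞ fun z => 2 * w z :=
    fun hw => contDiff_const.mul hw
  have hl2 : ∀ {w : Cn n → ℝ}, ContDiff ℝ ∞ w → ∀ z c,
      levi (fun z => 2 * w z) z c = 2 * levi w z c := by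
    intro w hw z c
    have : (fun z => 2 * w z) = fun z => w z + w z := by ext; ring
    rw [this, levi_add hw hw]
    ring
  have hd1 : deriv (fun x : ℝ => Real.exp (η * x)) = fun x => η * Real.exp (η * x) := by
    ext x
    have := (((hasDerivAt_id x).const_mul η).exp).deriv
    simpa [mul_comm] using this
  have hd2 : deriv (deriv (fun x : ℝ => Real.exp (η * x)))
      = fun x => η * (η * Real.exp (η * x)) := by
    rw [hd1]
    ext x
    rw [deriv_const_mul _ (by fun_prop), hd1]
  have hexpu : ContDiff ℝ ∞ fun z => Real.exp (η * u z) := hexp.comp hu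
  have hψ : ContDiff ℝ ∞ fun z => 2 * u₀ z + 2 * u z + Real.exp (η * u z) :=
    ((h2 hu₀).add (h2 hu)).add hexpu
  have hψl : ∀ z ∈ Metric.ball (0 : Cn n) r, ∀ c, η ^ 2 * Real.exp (η * u z)
      * ‖∑ j, dwir j (fun z => (u z : ℂ)) z * c j‖ ^ 2
        ≤ levi (fun z => 2 * u₀ z + 2 * u z + Real.exp (η * u z)) z c := by
    intro z hz c
    rw [levi_add ((h2 hu₀).add (h2 hu)) hexpu, levi_add (h2 hu₀) (h2 hu), hl2 hu₀, hl2 hu,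
      levi_comp hexp hu, hd2, hd1, norm_sum_dwir_ofReal_mul_sq hu]
    have e1 := hul z hz c
    have e2 := hu₀l z hz c
    have e3 : 0 ≤ η * Real.exp (η * u z) * levi u z c := by positivity
    nlinarith
  set Q : Cn n → ℝ := {z : Cn n | ∑ j, ‖z j‖ ^ 2 < r ^ 2}.indicator fun z =>
    (deriv Real.smoothTransition (-t - u z)) ^ 2 * ‖g z‖ ^ 2 * Real.exp (-η * u z) / η ^ 2 with hQ
  have hmE : MeasurableSet {z : Cn n | ∑ j, ‖z j‖ ^ 2 < r ^ 2} :=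
    (isOpen_lt contDiff_sum_norm_sq.continuous continuous_const).measurableSet
  have hQ0 : ∀ z, 0 ≤ Q z := fun z => Set.indicator_nonneg (fun z _ => by positivity) z
  have hτc : Continuous (deriv Real.smoothTransition) :=
    (Real.smoothTransition.contDiff (n := 1)).continuous_deriv (by simp)
  have huc := hu.continuous
  have hQm : AEStronglyMeasurable Q volume := by
    refine AEStronglyMeasurable.indicator (Continuous.aestronglyMeasurable ?_) hmE
    have := hg.continuous
    fun_prop
  have hQle : ∀ z, ENNReal.ofReal
      (Q z * Real.exp (-(2 * u₀ z + 2 * u z + Real.exp (η * u z))))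
      ≤ ({z | u z < -t} ∩ Metric.ball (0 : Cn n) r).indicator (fun z => ENNReal.ofReal
        (K ^ 2 / η ^ 2 * Real.exp ((2 + η) * (t + 1))) *
          ENNReal.ofReal (‖g z‖ ^ 2 * Real.exp (-2 * u₀ z))) z := by
    intro z
    by_cases hz : z ∈ {z : Cn n | ∑ j, ‖z j‖ ^ 2 < r ^ 2}
    · by_cases h0 : deriv Real.smoothTransition (-t - u z) = 0
      · rw [hQ, Set.indicator_of_mem hz, h0]
        simp
      · have h1 : 0 < -t - u z ∧ -t - u z < 1 := by
          by_contra h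
          rw [not_and_or, not_lt, not_lt] at h
          exact h0 (deriv_smoothTransition_eq_zero h)
        have h2 : z ∈ {z | u z < -t} ∩ Metric.ball (0 : Cn n) r :=
          ⟨show u z < -t by linarith [h1.1], hball z hz⟩
        rw [hQ, Set.indicator_of_mem hz, Set.indicator_of_mem h2, ← ENNReal.ofReal_mul (by positivity)]
        refine ENNReal.ofReal_le_ofReal ?_
        have e1 : (deriv Real.smoothTransition (-t - u z)) ^ 2 ≤ K ^ 2 := by
          rw [← sq_abs]
          exact pow_le_pow_left₀ (abs_nonneg _) (hK _) 2
        have e2 : Real.exp (-η * u z) * Real.exp (-(2 * u₀ z + 2 * u z + Real.exp (η * u z)))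
            ≤ Real.exp ((2 + η) * (t + 1)) * Real.exp (-2 * u₀ z) := by
          rw [← Real.exp_add, ← Real.exp_add]
          refine Real.exp_le_exp.2 ?_
          have := Real.exp_pos (η * u z)
          nlinarith [h1.1, h1.2]
        calc _ = (deriv Real.smoothTransition (-t - u z)) ^ 2 * (‖g z‖ ^ 2 / η ^ 2) *
              (Real.exp (-η * u z) * Real.exp (-(2 * u₀ z + 2 * u z + Real.exp (η * u z)))) := by
              ring
          _ ≤ K ^ 2 * (‖g z‖ ^ 2 / η ^ 2) *
              (Real.exp ((2 + η) * (t + 1)) * Real.exp (-2 * u₀ z)) := by gcongr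
          _ = _ := by ring
    · rw [hQ, Set.indicator_of_notMem hz]
      simp
  have hmS : MeasurableSet ({z | u z < -t} ∩ Metric.ball (0 : Cn n) r) :=
    ((isOpen_lt huc continuous_const).inter Metric.isOpen_ball).measurableSet
  have hlint : ∫⁻ z, ENNReal.ofReal
      (Q z * Real.exp (-(2 * u₀ z + 2 * u z + Real.exp (η * u z))))
      ≤ ENNReal.ofReal (K ^ 2 / η ^ 2 * Real.exp ((2 + η) * (t + 1)) * I) := by
    refine (lintegral_mono hQle).trans ?_
    rw [lintegral_indicator hmS, lintegral_const_mul' _ _ ENNReal.ofReal_ne_top,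
      ENNReal.ofReal_mul (p := K ^ 2 / η ^ 2 * Real.exp ((2 + η) * (t + 1))) (by positivity)]
    exact mul_le_mul_right hgInt _
  have hnn : ∀ z, 0 ≤ Q z * Real.exp (-(2 * u₀ z + 2 * u z + Real.exp (η * u z))) := fun z =>
    mul_nonneg (hQ0 z) (Real.exp_pos _).le
  have hm : AEStronglyMeasurable
      (fun z => Q z * Real.exp (-(2 * u₀ z + 2 * u z + Real.exp (η * u z)))) volume :=
    hQm.mul hψ.continuous.neg.rexp.aestronglyMeasurable
  have hQi : Integrable fun z => Q z * Real.exp (-(2 * u₀ z + 2 * u z + Real.exp (η * u z))) := by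
    refine ⟨hm, ?_⟩
    rw [hasFiniteIntegral_iff_ofReal (Eventually.of_forall hnn)]
    exact hlint.trans_lt ENNReal.ofReal_lt_top
  have hvs : tsupport (cutoffFun r t u g) ⊆ {z | ∑ j, ‖z j‖ ^ 2 < r ^ 2} := by
    refine (tsupport_cutoffFun_subset hsub).trans fun z hz => ?_
    rw [mem_closedBall_zero_iff] at hz
    refine lt_of_le_of_lt ?_ hns
    calc ∑ j, ‖z j‖ ^ 2 ≤ ∑ _j : Fin n, s ^ 2 := by
          gcongr with j
          exact (norm_le_pi_norm z j).trans hz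
      _ = n * s ^ 2 := by simp
  refine (hormander_dual_ball (by positivity) hψ (fun z hz w =>
    (by positivity : (0 : ℝ) ≤ η ^ 2 * Real.exp (η * u z)
      * ‖∑ j, dwir j (fun z => (u z : ℂ)) z * w j‖ ^ 2).trans (hψl z (hball z hz) w))
    (contDiff_cutoffFun hu hg hs hsub) ((isCompact_closedBall _ _).of_isClosed_subset
      (isClosed_tsupport _) (tsupport_cutoffFun_subset hsub)) hvs hQ0
    (fun z hz => Set.indicator_of_notMem (s := {z : Cn n | ∑ j, ‖z j‖ ^ 2 < r ^ 2}) (not_lt.2 hz) _) hQm hQi ?_ hα hαc hαB).trans ?_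
  · intro z hz c
    have e1 : ∑ j, conj (dbar j (cutoffFun r t u g) z) * c j
        = -((deriv Real.smoothTransition (-t - u z) : ℝ) : ℂ) * conj (g z)
          * ∑ j, dwir j (fun z => (u z : ℂ)) z * c j := by
      rw [Finset.mul_sum]
      refine Finset.sum_congr rfl fun j _ => ?_
      rw [dbar_cutoffFun hu hg hgd (hball z hz), ← conj_dwir_ofReal]
      simp
      ring
    have e2 := hψl z (hball z hz) c
    rw [e1, hQ, Set.indicator_of_mem
      (show z ∈ {z : Cn n | ∑ j, ‖z j‖ ^ 2 < r ^ 2} from hz)]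
    calc _ = (deriv Real.smoothTransition (-t - u z)) ^ 2 * ‖g z‖ ^ 2 * Real.exp (-η * u z) / η ^ 2
          * (η ^ 2 * Real.exp (η * u z) * ‖∑ j, dwir j (fun z => (u z : ℂ)) z * c j‖ ^ 2) := by
          have e3 : Real.exp (-η * u z) = (Real.exp (η * u z))⁻¹ := by
            rw [← Real.exp_neg]; congr 1; ring
          have := Real.exp_pos (η * u z)
          rw [e3]
          simp only [norm_mul, norm_neg, Complex.norm_real, RCLike.norm_conj, mul_pow,
            Real.norm_eq_abs, sq_abs]
          field_simp
      _ ≤ _ := by gcongr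
  · refine mul_le_mul_of_nonneg_right ?_ (mul_nonneg (Real.exp_pos _).le
      (integral_nonneg fun z => by positivity))
    rw [integral_eq_lintegral_of_nonneg_ae (Eventually.of_forall hnn) hm]
    exact ENNReal.toReal_le_of_le_ofReal (by positivity) hlint

end CutoffEstimate

section SingularWeight

lemma expE_eq (x : EReal) : expE x = EReal.exp x := by
  induction x <;> simp [expE]

lemma wexp_eq (c : ℝ) (φ : Cn n → EReal) (z : Cn n) : wexp c φ z = EReal.exp (φ z) ^ c := by
  rw [wexp, expE_eq, mul_comm, EReal.exp_mul]

lemma exp_coe_rpow (x c : ℝ) : EReal.exp (x : EReal) ^ c = ENNReal.ofReal (Real.exp (c * x)) := by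
  rw [← EReal.exp_mul, ← EReal.coe_mul, EReal.exp_coe, mul_comm]

variable {φ φ₀ : Cn n → EReal} {f : Cn n → ℂ} {r s t η : ℝ}

lemma tendsto_exp_toReal_wexp {u : ℕ → ℝ} {z : Cn n} (hz : φ z < ⊤)
    (h : Tendsto (fun k => (u k : EReal)) atTop (𝓝 (φ z))) :
    Tendsto (fun k => Real.exp (2 * u k)) atTop (𝓝 (wexp 2 φ z).toReal) := by
  have h1 : Tendsto (fun k => EReal.exp (u k : EReal) ^ (2 : ℝ)) atTop
      (𝓝 (EReal.exp (φ z) ^ (2 : ℝ))) :=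
    (ENNReal.continuous_rpow_const.tendsto _).comp ((ENNReal.continuous_exp.tendsto _).comp h)
  have h2 : EReal.exp (φ z) ^ (2 : ℝ) ≠ ⊤ :=
    ENNReal.rpow_ne_top_of_nonneg (by norm_num) (EReal.exp_lt_top_iff.2 hz).ne
  rw [wexp_eq]
  refine ((ENNReal.tendsto_toReal h2).comp h1).congr fun k => ?_
  simp only [Function.comp, exp_coe_rpow]
  exact ENNReal.toReal_ofReal (Real.exp_pos _).le

lemma tendsto_smoothTransition_trunc {u : ℕ → ℝ} {z : Cn n} (hz : φ z < ⊤) {m : ℕ}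
    (hm : t + 1 ≤ m) (h : Tendsto (fun k => (u k : EReal)) atTop (𝓝 (φ z))) :
    Tendsto (fun k => Real.smoothTransition (-t - u k)) atTop
      (𝓝 (Real.smoothTransition (-t - trunc φ m z))) := by
  have h1 : Tendsto (fun k => max (u k : EReal) ((-(m : ℝ) : ℝ) : EReal)) atTop
      (𝓝 (max (φ z) ((-(m : ℝ) : ℝ) : EReal))) := h.max tendsto_const_nhds
  have h2 := (EReal.tendsto_toReal (max_lt hz (EReal.coe_lt_top _)).ne
    ((EReal.bot_lt_coe _).trans_le (le_max_right _ _)).ne').comp h1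
  have h3 := (Real.smoothTransition.continuous.tendsto _).comp (h2.const_sub (-t))
  refine h3.congr fun k => ?_
  simp only [Function.comp]
  rcases le_total (-(m : ℝ)) (u k) with h4 | h4
  · rw [max_eq_left (by exact_mod_cast h4), EReal.toReal_coe]
  · rw [max_eq_right (by exact_mod_cast h4), EReal.toReal_coe,
      Real.smoothTransition.one_of_one_le (by linarith),
      Real.smoothTransition.one_of_one_le (by linarith)]

/-- The product weight `e^{2φ + 2φ₀}`, as a real function. -/
def prodWeight (φ φ₀ : Cn n → EReal) (z : Cn n) : ℝ :=
  (wexp 2 φ₀ z).toReal * (wexp 2 φ z).toReal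

theorem exists_cutoff_dual_estimate (hφ : PSHOn φ (Metric.ball 0 1))
    (hφ₀ : PSHOn φ₀ (Metric.ball 0 1)) (hf : DifferentiableOn ℂ f (Metric.ball 0 1))
    (hr : 0 < r) (hr1 : r < 1) (hη : 0 < η) :
    ∃ A : ℝ, 0 ≤ A ∧ ∀ t s : ℝ, s < r → n * s ^ 2 < r ^ 2 →
      (∀ z ∈ Metric.ball (0 : Cn n) r, φ z < ((-t : ℝ) : EReal) → ‖z‖ ≤ s) →
      (∫⁻ z in {z | φ z < ((-t : ℝ) : EReal)} ∩ Metric.ball 0 r,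
        (‖f z‖₊ : ℝ≥0∞) ^ 2 * wexp (-2) φ₀ z) ≠ ⊤ →
      ∃ v : Cn n → ℂ, AEStronglyMeasurable v volume ∧ (∀ z, ‖v z‖ ≤ ‖f z‖) ∧
        (∀ z, v z ≠ 0 → z ∈ Metric.ball (0 : Cn n) r ∧ φ z < ((-t : ℝ) : EReal)) ∧
        (∀ z ∈ Metric.ball (0 : Cn n) r, φ z ≤ ((-t - 1 : ℝ) : EReal) → v z = f z) ∧
        ∀ α : Fin n → Cn n → ℂ, (∀ j, ContDiff ℝ ∞ (α j)) → (∀ j, HasCompactSupport (α j)) →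
          (∀ j, tsupport (α j) ⊆ {z | ∑ j, ‖z j‖ ^ 2 < r ^ 2}) →
          ‖∫ z, v z * ∑ j, dbar j (α j) z‖ ^ 2
            ≤ A * Real.exp ((2 + η) * t) *
              (∫⁻ z in {z | φ z < ((-t : ℝ) : EReal)} ∩ Metric.ball 0 r,
                (‖f z‖₊ : ℝ≥0∞) ^ 2 * wexp (-2) φ₀ z).toReal *
              ∫ z, ‖∑ j, dbar j (α j) z‖ ^ 2 * prodWeight φ φ₀ z := by
  obtain ⟨u, M, hu, huz⟩ := hφ.exists_smooth_approx hr1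
  obtain ⟨u₀, M₀, hu₀, hu₀z⟩ := hφ₀.exists_smooth_approx hr1
  obtain ⟨g, hg, hgf⟩ := exists_contDiff_eq_of_differentiableOn hr1 hf
  obtain ⟨K, hK0, hK⟩ := exists_abs_deriv_smoothTransition_le
  have hb1 : ∀ z ∈ Metric.ball (0 : Cn n) r, z ∈ Metric.ball (0 : Cn n) 1 := fun z hz =>
    Metric.ball_subset_ball hr1.le hz
  refine ⟨K ^ 2 / η ^ 2 * Real.exp (2 + η) * (Real.exp 1 * Real.exp (Real.exp (η * M))),
    by positivity, fun t s hs hns hsub hfin => ?_⟩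
  set I := ∫⁻ z in {z | φ z < ((-t : ℝ) : EReal)} ∩ Metric.ball 0 r,
        (‖f z‖₊ : ℝ≥0∞) ^ 2 * wexp (-2) φ₀ z with hI
  obtain ⟨m, hm⟩ := exists_nat_ge (t + 1)
  have hvg : cutoffFun r t (trunc φ m) f = cutoffFun r t (trunc φ m) g := by
    ext z
    by_cases hz : z ∈ Metric.ball (0 : Cn n) r
    · rw [cutoffFun, cutoffFun, Set.indicator_of_mem hz, Set.indicator_of_mem hz, hgf z hz]
    · rw [cutoffFun, cutoffFun, Set.indicator_of_notMem hz, Set.indicator_of_notMem hz]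
  have hlim : ∀ z, Tendsto (fun k => cutoffFun r t (u k) g z) atTop
      (𝓝 (cutoffFun r t (trunc φ m) f z)) := by
    intro z
    rw [hvg]
    by_cases hz : z ∈ Metric.ball (0 : Cn n) r
    · simp only [cutoffFun, Set.indicator_of_mem hz]
      exact ((Complex.continuous_ofReal.tendsto _).comp (tendsto_smoothTransition_trunc
        (hφ.lt_top z (hb1 z hz)) hm (huz z hz).2.2.2)).mul_const _
    · simp only [cutoffFun, Set.indicator_of_notMem hz]
      exact tendsto_const_nhds
  have hulow : ∀ k, ∀ z ∈ Metric.ball (0 : Cn n) r, u k z < -t → φ z < ((-t : ℝ) : EReal) :=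
    fun k z hz h => ((huz z hz).2.1 k).trans_lt (by exact_mod_cast h)
  have hsubk : ∀ k, ∀ z ∈ Metric.ball (0 : Cn n) r, u k z < -t → ‖z‖ ≤ s :=
    fun k z hz h => hsub z hz (hulow k z hz h)
  have hck : ∀ k, Continuous (cutoffFun r t (u k) g) := fun k =>
    (contDiff_cutoffFun (hu k) hg hs (hsubk k)).continuous
  refine ⟨cutoffFun r t (trunc φ m) f, ?_, norm_cutoffFun_le _ _ _ _, ?_, ?_, ?_⟩
  · exact aestronglyMeasurable_of_tendsto_ae atTop (fun k => (hck k).aestronglyMeasurable)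
      (Eventually.of_forall hlim)
  · intro z hz
    obtain ⟨h1, h2⟩ := cutoffFun_ne_zero hz
    exact ⟨h1, ((trunc_lt_iff (hφ.lt_top z (hb1 z h1))).1 h2).1⟩
  · intro z hz h
    have h1 : trunc φ m z ≤ -t - 1 :=
      (trunc_le_iff (hφ.lt_top z (hb1 z hz))).2 ⟨h, by linarith⟩
    rw [cutoffFun, Set.indicator_of_mem hz,
      Real.smoothTransition.one_of_one_le (by linarith : 1 ≤ -t - trunc φ m z)]
    simp
  · intro α hα hαc hαB
    have hD : Continuous fun z => ∑ j, dbar j (α j) z :=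
      continuous_finsetSum _ fun j _ => (contDiff_dbar j (hα j)).continuous
    have hDc := hasCompactSupport_sum_dbar hαc
    have hball : ∀ z : Cn n, ∑ j, ‖z j‖ ^ 2 < r ^ 2 → z ∈ Metric.ball (0 : Cn n) r := by
      intro z hz
      rw [mem_ball_zero_iff]
      exact lt_of_pow_lt_pow_left₀ 2 hr.le ((norm_sq_le_sum z).trans_lt hz)
    have hD0 : ∀ z, z ∉ Metric.ball (0 : Cn n) r → ∑ j, dbar j (α j) z = 0 := by
      intro z hz
      refine Finset.sum_eq_zero fun j _ => dbar_eq_zero_of_notMem_tsupport (fun h => hz ?_) j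
      exact hball z (hαB j h)
    have hintk : ∀ k, ∫⁻ z in {z | u k z < -t} ∩ Metric.ball (0 : Cn n) r,
        ENNReal.ofReal (‖g z‖ ^ 2 * Real.exp (-2 * u₀ k z)) ≤ ENNReal.ofReal I.toReal := by
      intro k
      rw [ENNReal.ofReal_toReal hfin, hI]
      refine le_trans (setLIntegral_mono' ?_ fun z hz => ?_)
        (lintegral_mono_set (fun z hz => ⟨hulow k z hz.2 hz.1, hz.2⟩))
      · exact ((isOpen_lt (hu k).continuous continuous_const).inter
          Metric.isOpen_ball).measurableSet
      · rw [ENNReal.ofReal_mul (by positivity), hgf z hz.2, wexp_eq, ← exp_coe_rpow]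
        refine mul_le_mul' (le_of_eq ?_) ?_
        · rw [ENNReal.ofReal_pow (norm_nonneg _), ofReal_norm, enorm_eq_nnnorm]
        · rw [ENNReal.rpow_neg, ENNReal.rpow_neg, ENNReal.inv_le_inv]
          exact ENNReal.rpow_le_rpow (EReal.exp_monotone ((hu₀z z hz.2).2.1 k)) (by norm_num)
    have hk : ∀ k, ‖∫ z, cutoffFun r t (u k) g z * ∑ j, dbar j (α j) z‖ ^ 2
        ≤ K ^ 2 / η ^ 2 * Real.exp (2 + η) * (Real.exp 1 * Real.exp (Real.exp (η * M)))
          * Real.exp ((2 + η) * t) * I.toReal * ∫ z, ‖∑ j, dbar j (α j) z‖ ^ 2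
            * (Real.exp (2 * u₀ k z) * Real.exp (2 * u k z)) := by
      intro k
      refine (norm_integral_cutoffFun_sq_le hr hη (hu k) (hu₀ k) (fun z hz => (huz z hz).1 k)
        (fun z hz => (hu₀z z hz).1 k) hg ((hf.mono hb1).congr hgf) hs hns (hsubk k) hK0 hK
        ENNReal.toReal_nonneg (hintk k) hα hαc hαB).trans ?_
      have c0 := (hu k).continuous
      have c1 := (hu₀ k).continuous
      have h1 : ∫ z, ‖∑ j, dbar j (α j) z‖ ^ 2
            * Real.exp (2 * u₀ k z + 2 * u k z + Real.exp (η * u k z))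
          ≤ Real.exp (Real.exp (η * M)) * ∫ z, ‖∑ j, dbar j (α j) z‖ ^ 2
            * (Real.exp (2 * u₀ k z) * Real.exp (2 * u k z)) := by
        have hn : HasCompactSupport fun z => ‖∑ j, dbar j (α j) z‖ ^ 2 :=
          hDc.comp_left (g := fun x : ℂ => ‖x‖ ^ 2) (by simp)
        rw [← integral_const_mul]
        refine integral_mono (Continuous.integrable_of_hasCompactSupport (by fun_prop)
          hn.mul_right) (Continuous.integrable_of_hasCompactSupport (by fun_prop)
          (HasCompactSupport.mul_left hn.mul_right)) fun z => ?_
        by_cases hz : z ∈ Metric.ball (0 : Cn n) r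
        · simp only [Real.exp_add]
          have : Real.exp (Real.exp (η * u k z)) ≤ Real.exp (Real.exp (η * M)) := by
            have := (huz z hz).2.2.1 k
            gcongr
          calc _ = ‖∑ j, dbar j (α j) z‖ ^ 2 * (Real.exp (2 * u₀ k z) * Real.exp (2 * u k z))
                * Real.exp (Real.exp (η * u k z)) := by ring
            _ ≤ ‖∑ j, dbar j (α j) z‖ ^ 2 * (Real.exp (2 * u₀ k z) * Real.exp (2 * u k z))
                * Real.exp (Real.exp (η * M)) := by gcongr
            _ = _ := by ring
        · simp [hD0 z hz]
      have h2 : Real.exp ((2 + η) * (t + 1)) = Real.exp (2 + η) * Real.exp ((2 + η) * t) := by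
        rw [← Real.exp_add]; congr 1; ring
      calc _ ≤ K ^ 2 / η ^ 2 * Real.exp ((2 + η) * (t + 1)) * I.toReal * (Real.exp 1 *
            (Real.exp (Real.exp (η * M)) * ∫ z, ‖∑ j, dbar j (α j) z‖ ^ 2
            * (Real.exp (2 * u₀ k z) * Real.exp (2 * u k z)))) := by gcongr
        _ = _ := by rw [h2]; ring
    have hL : Tendsto (fun k => ∫ z, cutoffFun r t (u k) g z * ∑ j, dbar j (α j) z) atTop
        (𝓝 (∫ z, cutoffFun r t (trunc φ m) f z * ∑ j, dbar j (α j) z)) := by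
      have hgc := hg.continuous
      refine tendsto_integral_of_dominated_convergence
        (fun z => ‖g z‖ * ‖∑ j, dbar j (α j) z‖)
        (fun k => ((hck k).mul hD).aestronglyMeasurable) ?_ ?_ ?_
      · exact Continuous.integrable_of_hasCompactSupport (by fun_prop) hDc.norm.mul_left
      · refine fun k => Eventually.of_forall fun z => ?_
        rw [norm_mul]
        gcongr
        exact norm_cutoffFun_le _ _ _ _ _
      · exact Eventually.of_forall fun z => (hlim z).mul_const _
    have hR : Tendsto (fun k => ∫ z, ‖∑ j, dbar j (α j) z‖ ^ 2
          * (Real.exp (2 * u₀ k z) * Real.exp (2 * u k z))) atTop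
        (𝓝 (∫ z, ‖∑ j, dbar j (α j) z‖ ^ 2 * prodWeight φ φ₀ z)) := by
      have hn : HasCompactSupport fun z => ‖∑ j, dbar j (α j) z‖ ^ 2 :=
        hDc.comp_left (g := fun x : ℂ => ‖x‖ ^ 2) (by simp)
      refine tendsto_integral_of_dominated_convergence
        (fun z => ‖∑ j, dbar j (α j) z‖ ^ 2 * (Real.exp (2 * M₀) * Real.exp (2 * M)))
        (fun k => Continuous.aestronglyMeasurable ?_) ?_ ?_ ?_
      · have := (hu k).continuous
        have := (hu₀ k).continuous
        fun_prop
      · exact Continuous.integrable_of_hasCompactSupport (by fun_prop) hn.mul_right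
      · refine fun k => Eventually.of_forall fun z => ?_
        by_cases hz : z ∈ Metric.ball (0 : Cn n) r
        · have h1 := (huz z hz).2.2.1 k
          have h2 := (hu₀z z hz).2.2.1 k
          rw [Real.norm_of_nonneg (by positivity)]
          gcongr
        · simp [hD0 z hz]
      · refine Eventually.of_forall fun z => ?_
        by_cases hz : z ∈ Metric.ball (0 : Cn n) r
        · exact ((tendsto_exp_toReal_wexp (hφ₀.lt_top z (hb1 z hz)) (hu₀z z hz).2.2.2).mul
            (tendsto_exp_toReal_wexp (hφ.lt_top z (hb1 z hz)) (huz z hz).2.2.2)).const_mul _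
        · simp [hD0 z hz]
    exact le_of_tendsto_of_tendsto (hL.norm.pow 2) (hR.const_mul _) (Eventually.of_forall hk)

end SingularWeight

section Solution

lemma exists_riesz_of_norm_sq_le {V H : Type*} [AddCommGroup V] [Module ℂ V]
    [NormedAddCommGroup H] [InnerProductSpace ℂ H] [CompleteSpace H] (T : V →ₗ[ℂ] H)
    (l : V →ₗ[ℂ] ℂ) {B : ℝ} (hB : 0 ≤ B) (h : ∀ a, ‖l a‖ ^ 2 ≤ B * ‖T a‖ ^ 2) :
    ∃ x : H, ‖x‖ ^ 2 ≤ B ∧ ∀ a, l a = inner ℂ x (T a) := by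
  have hker : T.ker ≤ l.ker := by
    intro a ha
    rw [LinearMap.mem_ker] at ha ⊢
    have := h a
    rw [ha, norm_zero] at this
    have h0 : ‖l a‖ ^ 2 = 0 := le_antisymm (by simpa using this) (by positivity)
    simpa using h0
  set l' : T.range →ₗ[ℂ] ℂ := (T.ker.liftQ l hker) ∘ₗ T.quotKerEquivRange.symm.toLinearMap
    with hl'
  have hl'a : ∀ a, l' ⟨T a, LinearMap.mem_range_self T a⟩ = l a := by
    intro a
    have : T.quotKerEquivRange.symm ⟨T a, LinearMap.mem_range_self T a⟩
        = T.ker.mkQ a := by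
      rw [LinearEquiv.symm_apply_eq]
      rfl
    simp only [hl', LinearMap.comp_apply, LinearEquiv.coe_coe, this]
    simp
  have hbd : ∀ y, ‖l' y‖ ≤ Real.sqrt B * ‖y‖ := by
    rintro ⟨_, a, rfl⟩
    rw [hl'a]
    refine le_of_sq_le_sq ?_ (by positivity)
    rw [mul_pow, Real.sq_sqrt hB]
    exact h a
  obtain ⟨g, hg, hgn⟩ := exists_extension_norm_eq T.range (l'.mkContinuous _ hbd)
  refine ⟨(InnerProductSpace.toDual ℂ H).symm g, ?_, fun a => ?_⟩
  · rw [LinearIsometryEquiv.norm_map, hgn]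
    calc _ ≤ (Real.sqrt B) ^ 2 := by
          gcongr
          exact LinearMap.mkContinuous_norm_le _ (Real.sqrt_nonneg _) _
      _ = B := Real.sq_sqrt hB
  · rw [InnerProductSpace.toDual_symm_apply, ← hl'a a]
    exact (hg ⟨T a, LinearMap.mem_range_self T a⟩).symm

/-- The smooth forms with compact support in `Ω`. -/
def testForms (Ω : Set (Cn n)) : Submodule ℂ (Fin n → Cn n → ℂ) where
  carrier := {α | ∀ j, ContDiff ℝ ∞ (α j) ∧ HasCompactSupport (α j) ∧ tsupport (α j) ⊆ Ω}
  zero_mem' := fun j => ⟨contDiff_const, HasCompactSupport.zero, by simp [tsupport]⟩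
  add_mem' := fun {a b} ha hb j => ⟨(ha j).1.add (hb j).1, (ha j).2.1.add (hb j).2.1,
    (tsupport_add (a j) (b j)).trans (Set.union_subset (ha j).2.2 (hb j).2.2)⟩
  smul_mem' := fun c a ha j => ⟨(ha j).1.const_smul c, (ha j).2.1.smul_left (f := fun _ => c),
    (tsupport_smul_subset_right (fun _ => c) (a j)).trans (ha j).2.2⟩

lemma dbar_const_mul {u : Cn n → ℂ} {z : Cn n} (j : Fin n) (hu : DifferentiableAt ℝ u z) (c : ℂ) :
    dbar j (fun w => c * u w) z = c * dbar j u z := by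
  rw [dbar_mul j (differentiableAt_const c) hu]
  simp [dbar]

/-- Solvability from a dual estimate with weight `q²`. -/
lemma exists_memLp_of_dual_estimate {v : Cn n → ℂ} {q : Cn n → ℝ} {Ω : Set (Cn n)} {B M : ℝ}
    (hv : Integrable v) (hq : AEStronglyMeasurable q volume) (hqM : ∀ z, ‖q z‖ ≤ M) (hB : 0 ≤ B)
    (h : ∀ α ∈ testForms Ω, ‖∫ z, v z * ∑ j, dbar j (α j) z‖ ^ 2
      ≤ B * ∫ z, ‖∑ j, dbar j (α j) z‖ ^ 2 * q z ^ 2) :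
    ∃ x : Cn n → ℂ, MemLp x 2 volume ∧ ∫ z, ‖x z‖ ^ 2 ≤ B ∧
      ∀ α ∈ testForms Ω, ∫ z, v z * ∑ j, dbar j (α j) z
        = ∫ z, (x z * q z) * ∑ j, dbar j (α j) z := by
  have hD : ∀ α ∈ testForms Ω, Continuous fun z => ∑ j, dbar j (α j) z := fun α hα =>
    continuous_finsetSum _ fun j _ => (contDiff_dbar j (hα j).1).continuous
  have hDc : ∀ α ∈ testForms Ω, HasCompactSupport fun z => ∑ j, dbar j (α j) z := fun α hα =>
    hasCompactSupport_sum_dbar fun j => (hα j).2.1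
  have hDa : ∀ a ∈ testForms Ω, ∀ b ∈ testForms Ω, ∀ z, ∑ j, dbar j ((a + b) j) z
      = ∑ j, dbar j (a j) z + ∑ j, dbar j (b j) z := by
    intro a ha b hb z
    rw [← Finset.sum_add_distrib]
    exact Finset.sum_congr rfl fun j _ => dbar_add j ((ha j).1.differentiable (by simp) z)
      ((hb j).1.differentiable (by simp) z)
  have hDs : ∀ (c : ℂ), ∀ a ∈ testForms Ω, ∀ z, ∑ j, dbar j ((c • a) j) z
      = c * ∑ j, dbar j (a j) z := by
    intro c a ha z
    rw [Finset.mul_sum]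
    exact Finset.sum_congr rfl fun j _ => dbar_const_mul j ((ha j).1.differentiable (by simp) z) c
  have hL : ∀ α ∈ testForms Ω, MemLp (fun z => (q z : ℂ) * ∑ j, dbar j (α j) z) 2 volume := by
    intro α hα
    refine MemLp.of_le_mul (c := M)
      ((hD α hα).memLp_of_hasCompactSupport (p := 2) (hDc α hα)) ?_ ?_
    · exact (Complex.continuous_ofReal.comp_aestronglyMeasurable hq).mul
        (hD α hα).aestronglyMeasurable
    · refine Eventually.of_forall fun z => ?_
      rw [norm_mul, Complex.norm_real]
      gcongr
      exact hqM z
  have hvi : ∀ α ∈ testForms Ω, Integrable fun z => v z * ∑ j, dbar j (α j) z := fun α hα => by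
    obtain ⟨C, hC⟩ := (hDc α hα).exists_bound_of_continuous (hD α hα)
    exact hv.mul_bdd (hD α hα).aestronglyMeasurable (Eventually.of_forall hC)
  set T : testForms Ω →ₗ[ℂ] Lp ℂ 2 (volume : Measure (Cn n)) :=
    { toFun := fun α => (hL α.1 α.2).toLp _
      map_add' := fun a b => by
        rw [← MemLp.toLp_add]
        refine MemLp.toLp_congr _ _ (Eventually.of_forall fun z => ?_)
        change (q z : ℂ) * ∑ j, dbar j ((a.1 + b.1) j) z
          = (q z : ℂ) * ∑ j, dbar j (a.1 j) z + (q z : ℂ) * ∑ j, dbar j (b.1 j) z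
        rw [hDa _ a.2 _ b.2, mul_add]
      map_smul' := fun c a => by
        rw [RingHom.id_apply, ← MemLp.toLp_const_smul]
        refine MemLp.toLp_congr _ _ (Eventually.of_forall fun z => ?_)
        change (q z : ℂ) * ∑ j, dbar j ((c • a.1) j) z
          = c * ((q z : ℂ) * ∑ j, dbar j (a.1 j) z)
        rw [hDs _ _ a.2]
        ring } with hT
  set l : testForms Ω →ₗ[ℂ] ℂ :=
    { toFun := fun α => ∫ z, v z * ∑ j, dbar j (α.1 j) z
      map_add' := fun a b => by
        rw [← integral_add (hvi _ a.2) (hvi _ b.2)]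
        congr 1; ext z
        rw [Submodule.coe_add, hDa _ a.2 _ b.2, mul_add]
      map_smul' := fun c a => by
        rw [RingHom.id_apply, smul_eq_mul, ← integral_const_mul]
        congr 1; ext z
        rw [Submodule.coe_smul, hDs _ _ a.2]
        ring } with hl
  have hTn : ∀ a : testForms Ω, ‖T a‖ ^ 2 = ∫ z, ‖∑ j, dbar j (a.1 j) z‖ ^ 2 * q z ^ 2 := by
    intro a
    have h1 : inner ℂ (T a) (T a) = ((‖T a‖ ^ 2 : ℝ) : ℂ) := by
      rw [inner_self_eq_norm_sq_to_K]; norm_cast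
    rw [L2.inner_def] at h1
    have h2 : ∫ z, inner ℂ (T a z) (T a z)
        = ((∫ z, ‖∑ j, dbar j (a.1 j) z‖ ^ 2 * q z ^ 2 : ℝ) : ℂ) := by
      rw [← integral_complex_ofReal]
      refine integral_congr_ae ?_
      filter_upwards [(hL a.1 a.2).coeFn_toLp] with z hz
      have hz' : T a z = (q z : ℂ) * ∑ j, dbar j (a.1 j) z := hz
      rw [hz', inner_self_eq_norm_sq_to_K, ← sq_abs (q z), ← Real.norm_eq_abs,
        ← Complex.norm_real (q z), ← mul_pow, norm_mul, mul_comm]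
      norm_cast
    rw [h2] at h1
    exact_mod_cast h1.symm
  obtain ⟨x, hx, hxl⟩ := exists_riesz_of_norm_sq_le T l hB fun a => by
    rw [hTn]; exact h a.1 a.2
  have hxm : MemLp (x : Cn n → ℂ) 2 volume := Lp.memLp x
  refine ⟨fun z => conj (x z), ?_, ?_, fun α hα => ?_⟩
  · exact hxm.star
  · refine le_trans (le_of_eq ?_) hx
    have h1 : inner ℂ x x = ((‖x‖ ^ 2 : ℝ) : ℂ) := by
      rw [inner_self_eq_norm_sq_to_K]; norm_cast
    rw [L2.inner_def] at h1
    have h2 : ∫ z, inner ℂ (x z) (x z) = ((∫ z, ‖conj (x z)‖ ^ 2 : ℝ) : ℂ) := by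
      rw [← integral_complex_ofReal]
      congr 1; ext z
      rw [inner_self_eq_norm_sq_to_K, RCLike.norm_conj]
      norm_cast
    rw [h2] at h1
    exact_mod_cast h1
  · have h1 := hxl ⟨α, hα⟩
    rw [L2.inner_def] at h1
    refine h1.trans (integral_congr_ae ?_)
    filter_upwards [(hL α hα).coeFn_toLp] with z hz
    have hz' : T ⟨α, hα⟩ z = (q z : ℂ) * ∑ j, dbar j (α j) z := hz
    rw [hz', RCLike.inner_apply]
    ring

end Solution

section Approximation

variable {φ φ₀ : Cn n → EReal} {f : Cn n → ℂ} {r s t η : ℝ}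

lemma PSHOn.isOpen_sublevel (hφ : PSHOn φ (Metric.ball 0 1)) (hr : r ≤ 1) (a : EReal) :
    IsOpen ({z | φ z < a} ∩ Metric.ball (0 : Cn n) r) := by
  rw [isOpen_iff_mem_nhds]
  rintro z ⟨h1, h2⟩
  have hz := Metric.ball_subset_ball hr h2
  have h3 := hφ.usc z hz a h1
  rw [Metric.isOpen_ball.nhdsWithin_eq hz] at h3
  filter_upwards [h3, Metric.isOpen_ball.mem_nhds h2] with y hy hy2 using ⟨hy, hy2⟩

lemma PSHOn.aemeasurable (hφ : PSHOn φ (Metric.ball 0 1)) :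
    AEMeasurable φ (volume.restrict (Metric.ball 0 1)) := by
  refine aemeasurable_restrict_of_measurable_subtype measurableSet_ball ?_
  exact (upperSemicontinuousOn_iff_restrict.2 hφ.usc).measurable

lemma coe_nnnorm_add_sq_le (a b : ℂ) :
    (‖a + b‖₊ : ℝ≥0∞) ^ 2 ≤ 2 * (‖a‖₊ : ℝ≥0∞) ^ 2 + 2 * (‖b‖₊ : ℝ≥0∞) ^ 2 := by
  have h1 : ‖a + b‖₊ ^ 2 ≤ 2 * ‖a‖₊ ^ 2 + 2 * ‖b‖₊ ^ 2 := by
    rw [← mul_add]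
    exact (pow_le_pow_left₀ (by positivity) (nnnorm_add_le a b) 2).trans add_sq_le
  exact_mod_cast h1

/-- The holomorphic approximation produced by the `L²` method: `f` is congruent, modulo functions
square-integrable with respect to `e^{-2φ-2φ₀}`, to a function of small `L²` norm. -/
theorem exists_holomorphic_congr (hφ : PSHOn φ (Metric.ball 0 1))
    (hφ₀ : PSHOn φ₀ (Metric.ball 0 1)) (hf : DifferentiableOn ℂ f (Metric.ball 0 1))
    (hr : 0 < r) (hr1 : r < 1) (hη : 0 < η)
    (hfin : ∫⁻ z in Metric.ball 0 r, (‖f z‖₊ : ℝ≥0∞) ^ 2 * wexp (-2) φ₀ z ≠ ⊤) :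
    ∃ C : ℝ, 0 ≤ C ∧ ∀ t s : ℝ, 0 ≤ t → s < r → n * s ^ 2 < r ^ 2 →
      (∀ z ∈ Metric.ball (0 : Cn n) r, φ z < ((-t : ℝ) : EReal) → ‖z‖ ≤ s) →
      ∃ F : Cn n → ℂ, DifferentiableOn ℂ F (Metric.ball 0 (r / (2 * (n + 1)))) ∧
        ∫⁻ z in Metric.ball 0 (r / (2 * (n + 1))), (‖F z‖₊ : ℝ≥0∞) ^ 2
          ≤ ENNReal.ofReal (C * Real.exp ((2 + η) * t)) *
            ∫⁻ z in {z | φ z < ((-t : ℝ) : EReal)} ∩ Metric.ball 0 r,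
              (‖f z‖₊ : ℝ≥0∞) ^ 2 * wexp (-2) φ₀ z ∧
        ∫⁻ z in Metric.ball 0 (r / (2 * (n + 1))),
          (‖f z - F z‖₊ : ℝ≥0∞) ^ 2 * (wexp (-2) φ z * wexp (-2) φ₀ z) < ⊤ := by
  obtain ⟨A, hA0, hA⟩ := exists_cutoff_dual_estimate hφ hφ₀ hf hr hr1 hη
  have hK1 : Metric.closedBall (0 : Cn n) r ⊆ Metric.ball 0 1 := Metric.closedBall_subset_ball hr1
  obtain ⟨M, -, hM⟩ := hφ.exists_le_on_isCompact (isCompact_closedBall _ _) hK1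
  obtain ⟨M₀, -, hM₀⟩ := hφ₀.exists_le_on_isCompact (isCompact_closedBall _ _) hK1
  obtain ⟨Mf, hMf⟩ := (isCompact_closedBall (0 : Cn n) r).exists_bound_of_continuousOn
    (hf.continuousOn.mono hK1)
  have hbc : ∀ z ∈ Metric.ball (0 : Cn n) r, z ∈ Metric.closedBall (0 : Cn n) r := fun z hz =>
    Metric.ball_subset_closedBall hz
  have hb1 : ∀ z ∈ Metric.ball (0 : Cn n) r, z ∈ Metric.ball (0 : Cn n) 1 := fun z hz =>
    hK1 (hbc z hz)
  refine ⟨2 * Real.exp (2 * M₀) + 2 * (Real.exp (2 * (M₀ + M)) * A), by positivity,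
    fun t s ht hs hns hsub => ?_⟩
  set S : Set (Cn n) := {z | φ z < ((-t : ℝ) : EReal)} ∩ Metric.ball 0 r with hS
  set I := ∫⁻ z in S, (‖f z‖₊ : ℝ≥0∞) ^ 2 * wexp (-2) φ₀ z with hI
  have hSm : MeasurableSet S := (hφ.isOpen_sublevel hr1.le _).measurableSet
  have hIf : I ≠ ⊤ := ((lintegral_mono_set Set.inter_subset_right).trans_lt hfin.lt_top).ne
  obtain ⟨v, hvm, hvf, hvS, hv1, hest⟩ := hA t s hs hns hsub hIf
  rw [← hS, ← hI] at hest
  set q : Cn n → ℝ := (Metric.ball (0 : Cn n) r).indicator fun z =>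
    (EReal.exp (φ₀ z)).toReal * (EReal.exp (φ z)).toReal with hq
  have hexpM : ∀ {x : EReal} {M : ℝ}, x ≤ (M : EReal) → EReal.exp x ≤ ENNReal.ofReal (Real.exp M) :=
    fun h => EReal.exp_monotone h
  have hqM : ∀ z, ‖q z‖ ≤ Real.exp (M₀ + M) := by
    intro z
    by_cases hz : z ∈ Metric.ball (0 : Cn n) r
    · rw [hq, Set.indicator_of_mem hz, Real.norm_of_nonneg (by positivity), Real.exp_add]
      gcongr
      · exact ENNReal.toReal_le_of_le_ofReal (Real.exp_pos _).le (hexpM (hM₀ z (hbc z hz)))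
      · exact ENNReal.toReal_le_of_le_ofReal (Real.exp_pos _).le (hexpM (hM z (hbc z hz)))
    · rw [hq, Set.indicator_of_notMem hz, norm_zero]
      positivity
  have hmr : ∀ {φ : Cn n → EReal}, PSHOn φ (Metric.ball 0 1) →
      AEMeasurable (fun z => (EReal.exp (φ z)).toReal) (volume.restrict (Metric.ball 0 r)) :=
    fun h => (EReal.measurable_exp.comp_aemeasurable
      (h.aemeasurable.mono_measure (Measure.restrict_mono hb1 le_rfl))).ennreal_toReal
  have hqm : AEStronglyMeasurable q volume :=
    ((aemeasurable_indicator_iff measurableSet_ball).2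
      ((hmr hφ₀).mul (hmr hφ))).aestronglyMeasurable
  have hfinE : ∀ z ∈ Metric.ball (0 : Cn n) r, EReal.exp (φ z) ≠ ⊤ ∧ EReal.exp (φ₀ z) ≠ ⊤ :=
    fun z hz => ⟨(EReal.exp_lt_top_iff.2 (hφ.lt_top z (hb1 z hz))).ne,
      (EReal.exp_lt_top_iff.2 (hφ₀.lt_top z (hb1 z hz))).ne⟩
  have hqe : ∀ z ∈ Metric.ball (0 : Cn n) r,
      (‖(q z : ℂ)‖₊ : ℝ≥0∞) = EReal.exp (φ₀ z) * EReal.exp (φ z) := by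
    intro z hz
    rw [hq, Set.indicator_of_mem hz, ← ENNReal.toReal_mul, ← enorm_eq_nnnorm,
      ← ofReal_norm, Complex.norm_real, Real.norm_of_nonneg ENNReal.toReal_nonneg,
      ENNReal.ofReal_toReal (ENNReal.mul_ne_top (hfinE z hz).2 (hfinE z hz).1)]
  have hball : ∀ z : Cn n, ∑ j, ‖z j‖ ^ 2 < r ^ 2 → z ∈ Metric.ball (0 : Cn n) r := by
    intro z hz
    rw [mem_ball_zero_iff]
    exact lt_of_pow_lt_pow_left₀ 2 hr.le ((norm_sq_le_sum z).trans_lt hz)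
  have hvi : Integrable v := by
    refine Integrable.mono' (g := (Metric.ball (0 : Cn n) r).indicator fun _ => Mf)
      ((integrable_indicator_iff measurableSet_ball).2
        (integrableOn_const (measure_ball_lt_top.ne))) hvm (Eventually.of_forall fun z => ?_)
    by_cases hz : v z = 0
    · rw [hz, norm_zero]
      refine Set.indicator_nonneg (fun z hz => (norm_nonneg _).trans (hMf z (hbc z hz))) z
    · rw [Set.indicator_of_mem (hvS z hz).1]
      exact (hvf z).trans (hMf z (hbc z (hvS z hz).1))
  set B := A * Real.exp ((2 + η) * t) * I.toReal with hB
  have hB0 : 0 ≤ B := by positivity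
  obtain ⟨x, hx, hxB, hxl⟩ := exists_memLp_of_dual_estimate
    (Ω := {z : Cn n | ∑ j, ‖z j‖ ^ 2 < r ^ 2}) hvi hqm hqM hB0 (by
      intro α hα
      refine (hest α (fun j => (hα j).1) (fun j => (hα j).2.1) (fun j => (hα j).2.2)).trans_eq ?_
      congr 2; ext z
      by_cases hz : z ∈ Metric.ball (0 : Cn n) r
      · rw [hq, Set.indicator_of_mem hz, prodWeight, wexp_eq, wexp_eq, mul_pow]
        simp [← ENNReal.toReal_pow]
      · have : ∑ j, dbar j (α j) z = 0 := Finset.sum_eq_zero fun j _ =>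
          dbar_eq_zero_of_notMem_tsupport (fun h => hz (hball z ((hα j).2.2 h))) j
        simp [this])
  have hqi : MemLp (fun z => (q z : ℂ)) 2 volume := by
    have h1 : MemLp ((Metric.ball (0 : Cn n) r).indicator fun _ => Real.exp (M₀ + M)) 2 volume :=
      memLp_indicator_const 2 measurableSet_ball _ (Or.inr measure_ball_lt_top.ne)
    refine h1.mono (Complex.continuous_ofReal.comp_aestronglyMeasurable hqm)
      (Eventually.of_forall fun z => ?_)
    rw [Complex.norm_real]
    by_cases hz : z ∈ Metric.ball (0 : Cn n) r
    · rw [Set.indicator_of_mem hz, Real.norm_of_nonneg (Real.exp_pos _).le]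
      exact hqM z
    · rw [hq, Set.indicator_of_notMem hz, Set.indicator_of_notMem hz]
  have hui : Integrable fun z => x z * (q z : ℂ) := hx.integrable_mul hqi
  have hdi : Integrable fun z => v z - x z * (q z : ℂ) := hvi.sub hui
  have hn1 : (0 : ℝ) < n + 1 := by positivity
  have hsr : r / (2 * (n + 1)) < r / (n + 1) :=
    div_lt_div_of_pos_left hr hn1 (by linarith)
  have hsub' : Metric.ball (0 : Cn n) (r / (n + 1)) ⊆ {z | ∑ j, ‖z j‖ ^ 2 < r ^ 2} := by
    intro z hz
    rw [mem_ball_zero_iff] at hz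
    calc ∑ j, ‖z j‖ ^ 2 ≤ ∑ _j : Fin n, (r / (n + 1)) ^ 2 := by
          gcongr with j
          exact (norm_le_pi_norm z j).trans hz.le
      _ = n * (r / (n + 1)) ^ 2 := by simp
      _ = r ^ 2 * (n / (n + 1) ^ 2) := by rw [div_pow]; ring
      _ < r ^ 2 * 1 := by
          gcongr
          rw [div_lt_one (by positivity)]
          nlinarith [(Nat.cast_nonneg n : (0 : ℝ) ≤ n)]
      _ = r ^ 2 := mul_one _
  obtain ⟨F, -, hF, hFe⟩ := exists_differentiableOn_ae_eq_of_weak hdi hsr (by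
    intro j α hα hαc hαs
    have hmem : (fun i => if i = j then α else 0) ∈
        testForms {z : Cn n | ∑ j, ‖z j‖ ^ 2 < r ^ 2} := by
      intro i
      by_cases hij : i = j
      · simp only [hij, if_true]
        exact ⟨hα, hαc, hαs.trans hsub'⟩
      · simp only [hij, if_false]
        exact ⟨contDiff_const, HasCompactSupport.zero, by simp [tsupport]⟩
    have h1 := hxl _ hmem
    have h2 : ∀ z, ∑ i, dbar i (if i = j then α else 0) z = dbar j α z := by
      intro z
      rw [Finset.sum_eq_single j]
      · simp
      · intro i _ hij
        simp [hij, dbar]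
      · simp
    simp only [h2] at h1
    obtain ⟨c, hc⟩ := (hasCompactSupport_dbar j hαc).exists_bound_of_continuous
      (contDiff_dbar j hα).continuous
    have i1 : Integrable fun z => v z * dbar j α z := hvi.mul_bdd
      (contDiff_dbar j hα).continuous.aestronglyMeasurable (Eventually.of_forall hc)
    have i2 : Integrable fun z => (x z * (q z : ℂ)) * dbar j α z := hui.mul_bdd
      (contDiff_dbar j hα).continuous.aestronglyMeasurable (Eventually.of_forall hc)
    simp only [sub_mul]
    rw [integral_sub i1 i2, h1, sub_self])
  have hρr : r / (2 * (n + 1)) ≤ r := div_le_self hr.le (by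
    linarith [(Nat.cast_nonneg n : (0 : ℝ) ≤ n)])
  have hbr : ∀ z ∈ Metric.ball (0 : Cn n) (r / (2 * (n + 1))), z ∈ Metric.ball (0 : Cn n) r :=
    fun z hz => Metric.ball_subset_ball hρr hz
  have hxI : ∫⁻ z, (‖x z‖₊ : ℝ≥0∞) ^ 2 ≤ ENNReal.ofReal B := by
    have h1 : ∫⁻ z, (‖x z‖₊ : ℝ≥0∞) ^ 2 = ENNReal.ofReal (∫ z, ‖x z‖ ^ 2) := by
      rw [ofReal_integral_eq_lintegral_ofReal (hx.integrable_norm_pow (by norm_num))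
        (Eventually.of_forall fun z => by positivity)]
      congr 1; ext z
      rw [ENNReal.ofReal_pow (norm_nonneg _), ofReal_norm, enorm_eq_nnnorm]
    rw [h1]
    exact ENNReal.ofReal_le_ofReal hxB
  have hxm : AEMeasurable (fun z => (‖x z‖₊ : ℝ≥0∞) ^ 2) volume :=
    hx.1.enorm.pow_const 2
  have hvm' : AEMeasurable (fun z => (‖v z‖₊ : ℝ≥0∞) ^ 2) volume := hvm.enorm.pow_const 2
  refine ⟨F, hF, ?_, ?_⟩
  · have hv2 : ∫⁻ z, (‖v z‖₊ : ℝ≥0∞) ^ 2 ≤ ENNReal.ofReal (Real.exp (2 * M₀)) * I := by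
      rw [hI, ← lintegral_const_mul' _ _ ENNReal.ofReal_ne_top, ← lintegral_indicator hSm]
      refine lintegral_mono fun z => ?_
      by_cases hz : v z = 0
      · simp [hz]
      · have hzS : z ∈ S := ⟨(hvS z hz).2, (hvS z hz).1⟩
        rw [Set.indicator_of_mem hzS, mul_left_comm]
        have h1 : 1 ≤ ENNReal.ofReal (Real.exp (2 * M₀)) * wexp (-2) φ₀ z := by
          rw [wexp_eq, ← exp_coe_rpow, ENNReal.rpow_neg]
          rw [← div_eq_mul_inv, ENNReal.le_div_iff_mul_le
            (Or.inr (by rw [exp_coe_rpow]; simp [Real.exp_pos]))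
            (Or.inl (ENNReal.rpow_ne_top_of_nonneg (by norm_num) (hfinE z hzS.2).2)), one_mul]
          · exact ENNReal.rpow_le_rpow (EReal.exp_monotone (hM₀ z (hbc z hzS.2))) (by norm_num)
        calc (‖v z‖₊ : ℝ≥0∞) ^ 2 ≤ (‖f z‖₊ : ℝ≥0∞) ^ 2 := by
              gcongr
              exact hvf z
          _ = (‖f z‖₊ : ℝ≥0∞) ^ 2 * 1 := (mul_one _).symm
          _ ≤ _ := by gcongr
    have hu2 : ∫⁻ z, (‖x z * (q z : ℂ)‖₊ : ℝ≥0∞) ^ 2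
        ≤ ENNReal.ofReal (Real.exp (2 * (M₀ + M))) * ENNReal.ofReal B := by
      calc _ ≤ ∫⁻ z, ENNReal.ofReal (Real.exp (2 * (M₀ + M))) * (‖x z‖₊ : ℝ≥0∞) ^ 2 := by
            refine lintegral_mono fun z => ?_
            simp only [nnnorm_mul, ENNReal.coe_mul, mul_pow]
            rw [mul_comm]
            gcongr
            rw [← enorm_eq_nnnorm, ← ofReal_norm, ← ENNReal.ofReal_pow (norm_nonneg _),
              Complex.norm_real]
            refine ENNReal.ofReal_le_ofReal ?_
            rw [two_mul, Real.exp_add, ← pow_two]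
            exact pow_le_pow_left₀ (norm_nonneg _) (hqM z) 2
        _ = ENNReal.ofReal (Real.exp (2 * (M₀ + M))) * ∫⁻ z, (‖x z‖₊ : ℝ≥0∞) ^ 2 :=
            lintegral_const_mul' _ _ ENNReal.ofReal_ne_top
        _ ≤ _ := by gcongr
    calc ∫⁻ z in Metric.ball 0 (r / (2 * (n + 1))), (‖F z‖₊ : ℝ≥0∞) ^ 2
        ≤ ∫⁻ z in Metric.ball 0 (r / (2 * (n + 1))),
            (2 * (‖v z‖₊ : ℝ≥0∞) ^ 2 + 2 * (‖x z * (q z : ℂ)‖₊ : ℝ≥0∞) ^ 2) := by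
          refine lintegral_mono_ae ?_
          rw [ae_restrict_iff' measurableSet_ball]
          filter_upwards [hFe] with z hz hzb
          rw [← hz hzb, sub_eq_add_neg]
          refine (coe_nnnorm_add_sq_le _ _).trans_eq ?_
          rw [nnnorm_neg]
      _ ≤ ∫⁻ z, (2 * (‖v z‖₊ : ℝ≥0∞) ^ 2 + 2 * (‖x z * (q z : ℂ)‖₊ : ℝ≥0∞) ^ 2) :=
          setLIntegral_le_lintegral _ _
      _ = 2 * (∫⁻ z, (‖v z‖₊ : ℝ≥0∞) ^ 2) + 2 * ∫⁻ z, (‖x z * (q z : ℂ)‖₊ : ℝ≥0∞) ^ 2 := by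
          rw [lintegral_add_left' (hvm'.const_mul _), lintegral_const_mul' _ _ (by simp),
            lintegral_const_mul' _ _ (by simp)]
      _ ≤ 2 * (ENNReal.ofReal (Real.exp (2 * M₀)) * I)
          + 2 * (ENNReal.ofReal (Real.exp (2 * (M₀ + M))) * ENNReal.ofReal B) := by gcongr
      _ = ENNReal.ofReal ((2 * Real.exp (2 * M₀)
          + 2 * (Real.exp (2 * (M₀ + M)) * (A * Real.exp ((2 + η) * t)))) * I.toReal) := by
          rw [← ENNReal.ofReal_toReal hIf, hB]
          simp only [ENNReal.toReal_ofReal ENNReal.toReal_nonneg]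
          rw [show (2 : ℝ≥0∞) = ENNReal.ofReal 2 by simp, ← ENNReal.ofReal_mul (by positivity),
            ← ENNReal.ofReal_mul (by positivity), ← ENNReal.ofReal_mul (by positivity),
            ← ENNReal.ofReal_mul (by positivity), ← ENNReal.ofReal_add (by positivity)
              (by positivity)]
          congr 1
          ring
      _ ≤ ENNReal.ofReal ((2 * Real.exp (2 * M₀) + 2 * (Real.exp (2 * (M₀ + M)) * A))
            * Real.exp ((2 + η) * t) * I.toReal) := by
          refine ENNReal.ofReal_le_ofReal (mul_le_mul_of_nonneg_right ?_ ENNReal.toReal_nonneg)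
          have h1 : 1 ≤ Real.exp ((2 + η) * t) := Real.one_le_exp (by positivity)
          have h2 := Real.exp_pos (2 * M₀)
          nlinarith
      _ = _ := by
          rw [ENNReal.ofReal_mul (by positivity), ENNReal.ofReal_toReal hIf]
  · have hW1 : ∀ z ∈ Metric.ball (0 : Cn n) r, (‖f z - v z‖₊ : ℝ≥0∞) ^ 2
        * (wexp (-2) φ z * wexp (-2) φ₀ z)
        ≤ 4 * ENNReal.ofReal (Real.exp (2 * (t + 1))) *
          ((‖f z‖₊ : ℝ≥0∞) ^ 2 * wexp (-2) φ₀ z) := by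
      intro z hz
      rcases le_or_gt (φ z) ((-t - 1 : ℝ) : EReal) with h1 | h1
      · rw [hv1 z hz h1]
        simp
      · have h2 : wexp (-2) φ z ≤ ENNReal.ofReal (Real.exp (2 * (t + 1))) := by
          have h3 : (2 * (t + 1)) = -2 * (-t - 1) := by ring
          rw [wexp_eq, h3, ← exp_coe_rpow, ENNReal.rpow_neg, ENNReal.rpow_neg,
            ENNReal.inv_le_inv]
          exact ENNReal.rpow_le_rpow (EReal.exp_monotone h1.le) (by norm_num)
        have h4 : (‖f z - v z‖₊ : ℝ≥0∞) ^ 2 ≤ 4 * (‖f z‖₊ : ℝ≥0∞) ^ 2 := by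
          have h5 : ‖f z - v z‖₊ ≤ 2 * ‖f z‖₊ := by
            refine (nnnorm_sub_le _ _).trans ?_
            rw [two_mul]
            exact add_le_add_right (hvf z) _
          calc (‖f z - v z‖₊ : ℝ≥0∞) ^ 2 ≤ ((2 * ‖f z‖₊ : ℝ≥0) : ℝ≥0∞) ^ 2 := by gcongr
            _ = _ := by rw [ENNReal.coe_mul, mul_pow]; norm_num
        calc _ ≤ 4 * (‖f z‖₊ : ℝ≥0∞) ^ 2 * (ENNReal.ofReal (Real.exp (2 * (t + 1)))
              * wexp (-2) φ₀ z) := by gcongr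
          _ = _ := by ring
    have hW2 : ∀ z ∈ Metric.ball (0 : Cn n) r, (‖x z * (q z : ℂ)‖₊ : ℝ≥0∞) ^ 2
        * (wexp (-2) φ z * wexp (-2) φ₀ z) ≤ (‖x z‖₊ : ℝ≥0∞) ^ 2 := by
      intro z hz
      rw [nnnorm_mul, ENNReal.coe_mul, hqe z hz, wexp_eq, wexp_eq, ENNReal.rpow_neg,
        ENNReal.rpow_neg, ENNReal.rpow_ofNat, ENNReal.rpow_ofNat]
      calc _ = (‖x z‖₊ : ℝ≥0∞) ^ 2 * ((EReal.exp (φ₀ z) ^ 2 * (EReal.exp (φ₀ z) ^ 2)⁻¹)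
            * (EReal.exp (φ z) ^ 2 * (EReal.exp (φ z) ^ 2)⁻¹)) := by ring
        _ ≤ (‖x z‖₊ : ℝ≥0∞) ^ 2 * (1 * 1) := by
            gcongr
            · exact ENNReal.mul_inv_le_one _
            · exact ENNReal.mul_inv_le_one _
        _ = _ := by ring
    calc ∫⁻ z in Metric.ball 0 (r / (2 * (n + 1))),
          (‖f z - F z‖₊ : ℝ≥0∞) ^ 2 * (wexp (-2) φ z * wexp (-2) φ₀ z)
        ≤ ∫⁻ z in Metric.ball 0 (r / (2 * (n + 1))),
          (2 * (‖x z‖₊ : ℝ≥0∞) ^ 2 + 2 * (4 * ENNReal.ofReal (Real.exp (2 * (t + 1))) *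
            ((‖f z‖₊ : ℝ≥0∞) ^ 2 * wexp (-2) φ₀ z))) := by
          refine lintegral_mono_ae ?_
          rw [ae_restrict_iff' measurableSet_ball]
          filter_upwards [hFe] with z hz hzb
          rw [← hz hzb, show f z - (v z - x z * (q z : ℂ)) = x z * (q z : ℂ) + (f z - v z) by ring]
          calc _ ≤ (2 * (‖x z * (q z : ℂ)‖₊ : ℝ≥0∞) ^ 2 + 2 * (‖f z - v z‖₊ : ℝ≥0∞) ^ 2) *
                (wexp (-2) φ z * wexp (-2) φ₀ z) := by
                gcongr
                exact coe_nnnorm_add_sq_le _ _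
            _ = 2 * ((‖x z * (q z : ℂ)‖₊ : ℝ≥0∞) ^ 2 * (wexp (-2) φ z * wexp (-2) φ₀ z))
                + 2 * ((‖f z - v z‖₊ : ℝ≥0∞) ^ 2 * (wexp (-2) φ z * wexp (-2) φ₀ z)) := by ring
            _ ≤ _ := add_le_add (mul_le_mul_right (hW2 z (hbr z hzb)) 2)
                (mul_le_mul_right (hW1 z (hbr z hzb)) 2)
      _ = 2 * (∫⁻ z in Metric.ball 0 (r / (2 * (n + 1))), (‖x z‖₊ : ℝ≥0∞) ^ 2)
          + 2 * (4 * ENNReal.ofReal (Real.exp (2 * (t + 1))) *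
            ∫⁻ z in Metric.ball 0 (r / (2 * (n + 1))),
              (‖f z‖₊ : ℝ≥0∞) ^ 2 * wexp (-2) φ₀ z) := by
          rw [lintegral_add_left' (hxm.restrict.const_mul _), lintegral_const_mul' _ _ (by simp),
            lintegral_const_mul' _ _ (by simp), lintegral_const_mul' _ _
              (ENNReal.mul_ne_top (by simp) ENNReal.ofReal_ne_top)]
      _ < ⊤ := by
          refine ENNReal.add_lt_top.2 ⟨ENNReal.mul_lt_top (by simp)
            (((setLIntegral_le_lintegral _ _).trans hxI).trans_lt ENNReal.ofReal_lt_top),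
            ENNReal.mul_lt_top (by simp) (ENNReal.mul_lt_top (ENNReal.mul_lt_top (by simp)
              ENNReal.ofReal_lt_top) ?_)⟩
          exact (lintegral_mono_set hbr).trans_lt hfin.lt_top

end Approximation

section SummableFamilies

variable {M E : Type*} [NormedAddCommGroup E] [NormedSpace ℂ E] [CompleteSpace E]

/-- The space of absolutely summable complex families indexed by `M`. -/
abbrev SumFam (M : Type*) : Type _ := lp (fun _ : M => ℂ) 1

lemma SumFam.hasSum_norm (b : SumFam M) : HasSum (fun α => ‖b α‖) ‖b‖ := by
  simpa using lp.hasSum_norm (p := 1) (by simp) b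

/-- An absolutely summable family, as an element of `SumFam M`. -/
def SumFam.mk (f : M → ℂ) (hf : Summable fun α => ‖f α‖) : SumFam M :=
  ⟨f, memℓp_gen (by simpa using hf)⟩

@[simp] lemma SumFam.mk_apply (f : M → ℂ) (hf : Summable fun α => ‖f α‖) (α : M) :
    SumFam.mk f hf α = f α := rfl

lemma SumFam.norm_smul_le {v : M → E} {C : ℝ} (hv : ∀ α, ‖v α‖ ≤ C) (b : SumFam M) (α : M) :
    ‖b α • v α‖ ≤ ‖b α‖ * C := by
  rw [norm_smul]
  exact mul_le_mul_of_nonneg_left (hv α) (norm_nonneg _)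

lemma SumFam.summable_smul {v : M → E} {C : ℝ} (hv : ∀ α, ‖v α‖ ≤ C) (b : SumFam M) :
    Summable fun α => b α • v α :=
  Summable.of_norm_bounded (b.hasSum_norm.summable.mul_right C) (SumFam.norm_smul_le hv b)

lemma SumFam.norm_tsum_smul_le {v : M → E} {C : ℝ} (hv : ∀ α, ‖v α‖ ≤ C) (b : SumFam M) :
    ‖∑' α, b α • v α‖ ≤ C * ‖b‖ := by
  rw [mul_comm]
  exact tsum_of_norm_bounded (b.hasSum_norm.mul_right C) (SumFam.norm_smul_le hv b)

/-- The bounded linear map sending the unit vectors to a given bounded family. -/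
def SumFam.lift (v : M → E) (C : ℝ) (hv : ∀ α, ‖v α‖ ≤ C) : SumFam M →L[ℂ] E :=
  LinearMap.mkContinuous
    { toFun := fun b => ∑' α, b α • v α
      map_add' := fun b c => by
        rw [← (SumFam.summable_smul hv b).tsum_add (SumFam.summable_smul hv c)]
        exact tsum_congr fun α => by rw [← add_smul]; rfl
      map_smul' := fun k b => by
        rw [RingHom.id_apply, ← (SumFam.summable_smul hv b).tsum_const_smul]
        exact tsum_congr fun α => by rw [← mul_smul]; rfl }
    C (SumFam.norm_tsum_smul_le hv)

lemma SumFam.lift_apply {v : M → E} {C : ℝ} (hv : ∀ α, ‖v α‖ ≤ C) (b : SumFam M) :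
    SumFam.lift v C hv b = ∑' α, b α • v α := rfl

lemma SumFam.norm_apply_le (b : SumFam M) (α : M) : ‖b α‖ ≤ ‖b‖ :=
  le_hasSum b.hasSum_norm α fun _ _ => norm_nonneg _

lemma SumFam.continuous_apply (α : M) : Continuous fun b : SumFam M => b α :=
  (LinearMap.mkContinuous (𝕜 := ℂ) (σ := RingHom.id ℂ)
    { toFun := fun b : SumFam M => b α
      map_add' := fun _ _ => rfl
      map_smul' := fun _ _ => rfl } 1
    (fun b => (b.norm_apply_le α).trans_eq (one_mul _).symm)).continuous

variable [DecidableEq M]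

/-- The unit vectors of `SumFam M`. -/
def SumFam.unit (α : M) : SumFam M := lp.single 1 α (1 : ℂ)

lemma SumFam.unit_apply (α β : M) : SumFam.unit α β = if β = α then 1 else 0 := by
  rw [SumFam.unit, lp.single_apply, Pi.single_apply]

lemma SumFam.norm_unit (α : M) : ‖SumFam.unit α‖ = 1 := by
  rw [SumFam.unit, lp.norm_single (by norm_num), norm_one]

lemma SumFam.hasSum_unit (b : SumFam M) : HasSum (fun α => b α • SumFam.unit α) b := by
  have h := lp.hasSum_single (p := 1) (by simp) b
  refine h.congr_fun fun α => ?_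
  rw [SumFam.unit, ← lp.single_smul, smul_eq_mul, mul_one]

lemma SumFam.lift_unit {v : M → E} {C : ℝ} (hv : ∀ α, ‖v α‖ ≤ C) (α : M) :
    SumFam.lift v C hv (SumFam.unit α) = v α := by
  rw [SumFam.lift_apply, tsum_eq_single α]
  · simp [SumFam.unit_apply]
  · intro β hβ
    simp [SumFam.unit_apply, hβ]

/-- A bounded family close to the unit vectors is the image of the unit vectors under an
automorphism. -/
lemma SumFam.exists_equiv_of_near_unit {v : M → SumFam M}
    (hv : ∀ α, ‖v α - SumFam.unit α‖ ≤ 1 / 2) :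
    ∃ (C : ℝ) (hC : ∀ α, ‖v α‖ ≤ C) (T : SumFam M →L[ℂ] SumFam M),
      (∀ b, SumFam.lift v C hC (T b) = b) ∧ ∀ b, T (SumFam.lift v C hC b) = b := by
  have hC : ∀ α, ‖v α‖ ≤ 1 / 2 + 1 := fun α => by
    have h := norm_add_le (v α - SumFam.unit α) (SumFam.unit α)
    rw [sub_add_cancel, SumFam.norm_unit] at h
    linarith [hv α]
  have hS : ‖(1 : SumFam M →L[ℂ] SumFam M) - SumFam.lift v _ hC‖ < 1 := by
    refine lt_of_le_of_lt (b := 1 / 2) ?_ (by norm_num)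
    refine ContinuousLinearMap.opNorm_le_bound _ (by norm_num) fun b => ?_
    have h1 : ((1 : SumFam M →L[ℂ] SumFam M) - SumFam.lift v _ hC) b
        = - ∑' α, b α • (v α - SumFam.unit α) := by
      have h2 : ∑' α, b α • (v α - SumFam.unit α) = SumFam.lift v _ hC b - b := by
        rw [SumFam.lift_apply]
        refine HasSum.tsum_eq ?_
        simp only [smul_sub]
        exact (SumFam.summable_smul hC b).hasSum.sub b.hasSum_unit
      rw [h2, neg_sub]
      rfl
    rw [h1, norm_neg]
    exact SumFam.norm_tsum_smul_le hv b
  refine ⟨_, hC, ((Units.oneSub _ hS)⁻¹ : (SumFam M →L[ℂ] SumFam M)ˣ), fun b => ?_, fun b => ?_⟩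
  · have h := (Units.oneSub _ hS).mul_inv
    have h2 := congrArg (fun T : SumFam M →L[ℂ] SumFam M => T b) h
    simpa using h2
  · have h := (Units.oneSub _ hS).inv_mul
    have h2 := congrArg (fun T : SumFam M →L[ℂ] SumFam M => T b) h
    simpa using h2

end SummableFamilies

section Monomials

/-- The prime number attached to a coordinate. -/
def finPrime (i : Fin n) : ℕ := Nat.nth Nat.Prime i

lemma prime_finPrime (i : Fin n) : (finPrime i).Prime := Nat.prime_nth_prime i

lemma finPrime_injective : Function.Injective (finPrime : Fin n → ℕ) := fun _ _ h =>
  Fin.ext (Nat.nth_injective Nat.infinite_setOfPred_prime h)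

/-- An injective numbering of the exponents that turns sums into products. -/
def expNum (α : Fin n → ℕ) : ℕ := ∏ i, finPrime i ^ α i

lemma expNum_pos (α : Fin n → ℕ) : 0 < expNum α :=
  Finset.prod_pos fun i _ => pow_pos (prime_finPrime i).pos _

lemma expNum_add (α β : Fin n → ℕ) : expNum (α + β) = expNum α * expNum β := by
  simp [expNum, pow_add, Finset.prod_mul_distrib]

lemma expNum_injective : Function.Injective (expNum : (Fin n → ℕ) → ℕ) := by
  have h : ∀ (α : Fin n → ℕ) j, (expNum α).factorization (finPrime j) = α j := by
    intro α j
    rw [expNum, Nat.factorization_prod fun i _ => (pow_pos (prime_finPrime i).pos _).ne',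
      Finset.sum_apply']
    rw [Finset.sum_eq_single j]
    · rw [Nat.Prime.factorization_pow (prime_finPrime _), Finsupp.single_eq_same]
    · intro i _ hij
      rw [Nat.Prime.factorization_pow (prime_finPrime _), Finsupp.single_eq_of_ne]
      intro h
      exact hij (finPrime_injective h).symm
    · simp
  intro α β hαβ
  funext j
  rw [← h α j, hαβ, h β j]

/-- The monomial with exponent `α`. -/
def evalMon (α : Fin n → ℕ) (z : Cn n) : ℂ := ∏ i, z i ^ α i

lemma evalMon_add (α β : Fin n → ℕ) (z : Cn n) :
    evalMon (α + β) z = evalMon α z * evalMon β z := by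
  simp [evalMon, pow_add, Finset.prod_mul_distrib]

/-- The monomial with exponent `α`, normalized on the polydisc `scaledPolydisc l`. -/
def scaledMon (l : ℕ) (α : Fin n → ℕ) (z : Cn n) : ℂ := (expNum α : ℂ) ^ l * evalMon α z

lemma scaledMon_add (l : ℕ) (α β : Fin n → ℕ) (z : Cn n) :
    scaledMon l (α + β) z = scaledMon l α z * scaledMon l β z := by
  simp only [scaledMon, evalMon_add, expNum_add]
  push_cast
  ring

/-- The closed polydisc with radii the inverses of the `l`-th powers of the primes. -/
def scaledPolydisc (n l : ℕ) : Set (Cn n) :=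
  {z | ∀ i, (finPrime i : ℝ) ^ l * ‖z i‖ ≤ 1}

lemma scaledPolydisc_mem_nhds (n l : ℕ) : scaledPolydisc n l ∈ 𝓝 (0 : Cn n) := by
  have h : ∀ i : Fin n, ∀ᶠ z in 𝓝 (0 : Cn n), (finPrime i : ℝ) ^ l * ‖z i‖ < 1 := by
    intro i
    have hc : Continuous fun z : Cn n => (finPrime i : ℝ) ^ l * ‖z i‖ := by fun_prop
    exact hc.continuousAt.eventually_lt continuousAt_const (by simp)
  filter_upwards [eventually_all.2 h] with z hz i using (hz i).le

lemma norm_scaledMon_eq (l : ℕ) (α : Fin n → ℕ) (z : Cn n) :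
    ‖scaledMon l α z‖ = ∏ i, ((finPrime i : ℝ) ^ l * ‖z i‖) ^ α i := by
  simp only [scaledMon, evalMon, expNum, norm_mul, norm_pow, norm_prod, mul_pow,
    Finset.prod_mul_distrib, Nat.cast_prod, Nat.cast_pow, ← Finset.prod_pow, Complex.norm_natCast]
  simp only [← pow_mul, mul_comm]

lemma norm_scaledMon_le_one {l : ℕ} {z : Cn n} (hz : z ∈ scaledPolydisc n l)
    (α : Fin n → ℕ) : ‖scaledMon l α z‖ ≤ 1 := by
  rw [norm_scaledMon_eq]
  exact Finset.prod_le_one (fun i _ => by positivity)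
    fun i _ => pow_le_one₀ (by positivity) (hz i)

/-- The power series with normalized coefficients `b`. -/
def evalFam (l : ℕ) (b : SumFam (Fin n → ℕ)) (z : Cn n) : ℂ := ∑' α, b α * scaledMon l α z

lemma evalFam_lift {l : ℕ} {z : Cn n} (hz : z ∈ scaledPolydisc n l)
    {v : (Fin n → ℕ) → SumFam (Fin n → ℕ)} {C : ℝ} (hv : ∀ α, ‖v α‖ ≤ C)
    (b : SumFam (Fin n → ℕ)) :
    evalFam l (SumFam.lift v C hv b) z = ∑' α, b α * evalFam l (v α) z := by
  have h := ContinuousLinearMap.map_tsum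
    (SumFam.lift (fun α => scaledMon l α z) 1 (norm_scaledMon_le_one hz))
    (SumFam.summable_smul hv b)
  simp only [map_smul] at h
  exact h

lemma evalFam_unit (l : ℕ) (α : Fin n → ℕ) (z : Cn n) :
    evalFam l (SumFam.unit α) z = scaledMon l α z := by
  rw [evalFam, tsum_eq_single α]
  · simp [SumFam.unit_apply]
  · intro β hβ
    simp [SumFam.unit_apply, hβ]

/-- Multiplication by a normalized monomial on families of coefficients. -/
def SumFam.shift (γ : Fin n → ℕ) : SumFam (Fin n → ℕ) →L[ℂ] SumFam (Fin n → ℕ) :=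
  SumFam.lift (fun β => SumFam.unit (β + γ)) 1 fun _ => (SumFam.norm_unit _).le

lemma SumFam.shift_unit (γ α : Fin n → ℕ) :
    SumFam.shift γ (SumFam.unit α) = SumFam.unit (α + γ) :=
  SumFam.lift_unit _ _

lemma SumFam.norm_shift_le (γ : Fin n → ℕ) (b : SumFam (Fin n → ℕ)) :
    ‖SumFam.shift γ b‖ ≤ ‖b‖ :=
  (SumFam.norm_tsum_smul_le (fun _ => (SumFam.norm_unit _).le) b).trans_eq (one_mul _)

lemma evalFam_shift {l : ℕ} {z : Cn n} (hz : z ∈ scaledPolydisc n l) (γ : Fin n → ℕ)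
    (b : SumFam (Fin n → ℕ)) :
    evalFam l (SumFam.shift γ b) z = evalFam l b z * scaledMon l γ z := by
  rw [SumFam.shift, evalFam_lift hz, evalFam, ← tsum_mul_right]
  exact tsum_congr fun α => by rw [evalFam_unit, scaledMon_add, mul_assoc]

/-- Properties of function germs at the origin that are stable under domination by finite sums. -/
structure IsGermIdeal (P : (Cn n → ℂ) → Prop) : Prop where
  dom : ∀ (ι : Type) (s : Finset ι) (G : ι → Cn n → ℂ) (g : Cn n → ℂ) (C : ℝ),
    (∀ i ∈ s, P (G i)) → (∀ᶠ z in 𝓝 0, ‖g z‖ ≤ C * ∑ i ∈ s, ‖G i z‖) → P g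

lemma IsGermIdeal.of_le {P : (Cn n → ℂ) → Prop} (hP : IsGermIdeal P) {g h : Cn n → ℂ}
    (hg : P g) (C : ℝ) (hh : ∀ᶠ z in 𝓝 0, ‖h z‖ ≤ C * ‖g z‖) : P h :=
  hP.dom Unit {()} (fun _ => g) h C (fun _ _ => hg) (by simpa using hh)

lemma IsGermIdeal.of_le_add {P : (Cn n → ℂ) → Prop} (hP : IsGermIdeal P) {g₁ g₂ h : Cn n → ℂ}
    (hg₁ : P g₁) (hg₂ : P g₂) (hh : ∀ᶠ z in 𝓝 0, ‖h z‖ ≤ ‖g₁ z‖ + ‖g₂ z‖) : P h :=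
  hP.dom Bool Finset.univ (fun i => if i then g₁ else g₂) h 1
    (fun i _ => by cases i <;> simpa) (by simpa using hh)

/-- The exponents that occur as leading exponents of convergent power series with property `P`. -/
def leadSet (P : (Cn n → ℂ) → Prop) : Set (Fin n → ℕ) :=
  {α | ∃ c : (Fin n → ℕ) → ℂ, c α = 1 ∧ (∀ β, expNum β < expNum α → c β = 0) ∧
    (∃ l : ℕ, Summable fun β => ‖c β‖ / (expNum β : ℝ) ^ l) ∧
    P fun z => ∑' β, c β * evalMon β z}

lemma IsGermIdeal.exists_mem_leadSet {P : (Cn n → ℂ) → Prop} (hP : IsGermIdeal P) {l : ℕ}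
    {b : SumFam (Fin n → ℕ)} (hb : P (evalFam l b)) {α₀ : Fin n → ℕ} (hα₀ : b α₀ ≠ 0) :
    ∃ α ∈ leadSet P, b α ≠ 0 := by
  obtain ⟨α, hα, hmin⟩ := (measure (expNum : (Fin n → ℕ) → ℕ)).wf.has_min {α | b α ≠ 0}
    ⟨α₀, hα₀⟩
  have hα' : b α ≠ 0 := hα
  have hN : ∀ β : Fin n → ℕ, (expNum β : ℂ) ^ l ≠ 0 := fun β =>
    pow_ne_zero _ (Nat.cast_ne_zero.2 (expNum_pos β).ne')
  have hNr : ∀ β : Fin n → ℕ, (expNum β : ℝ) ^ l ≠ 0 := fun β =>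
    pow_ne_zero _ (Nat.cast_ne_zero.2 (expNum_pos β).ne')
  refine ⟨α, ⟨fun β => (b α * (expNum α : ℂ) ^ l)⁻¹ * (b β * (expNum β : ℂ) ^ l), ?_, ?_,
    ⟨l, ?_⟩, ?_⟩, hα⟩
  · exact inv_mul_cancel₀ (mul_ne_zero hα' (hN α))
  · intro β hβ
    have : b β = 0 := by
      by_contra h
      exact hmin β h hβ
    simp [this]
  · refine (b.hasSum_norm.summable.mul_left ‖(b α * (expNum α : ℂ) ^ l)⁻¹‖).congr fun β => ?_
    rw [norm_mul, norm_mul _ ((expNum β : ℂ) ^ l), norm_pow, Complex.norm_natCast, mul_div_assoc,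
      mul_div_cancel_right₀ _ (hNr β)]
  · refine hP.of_le hb ‖(b α * (expNum α : ℂ) ^ l)⁻¹‖ (Eventually.of_forall fun z => ?_)
    rw [← norm_mul, evalFam, ← tsum_mul_left]
    refine le_of_eq (congrArg norm (tsum_congr fun β => ?_))
    rw [scaledMon]
    ring

/-- A convergent power series with leading coefficient one is dominated by its leading term on
sufficiently small polydiscs. -/
lemma eventually_exists_near_unit {c : (Fin n → ℕ) → ℂ} {α : Fin n → ℕ} (hα : c α = 1)
    (hlead : ∀ β, expNum β < expNum α → c β = 0) {l₀ : ℕ}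
    (hs : Summable fun β => ‖c β‖ / (expNum β : ℝ) ^ l₀) :
    ∀ᶠ l in atTop, ∃ g : SumFam (Fin n → ℕ),
      (∀ β, g β = c β * ((expNum α : ℂ) / expNum β) ^ l) ∧ ‖g - SumFam.unit α‖ ≤ 1 / 2 := by
  set N : (Fin n → ℕ) → ℝ := fun β => expNum β with hN
  have hNpos : ∀ β, 0 < N β := fun β => Nat.cast_pos.2 (expNum_pos β)
  set q : ℝ := N α / (N α + 1) with hq
  have hq0 : 0 ≤ q := div_nonneg (hNpos α).le (by linarith [hNpos α])
  have hq1 : q < 1 := (div_lt_one (by linarith [hNpos α])).2 (by linarith)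
  set u : (Fin n → ℕ) → ℝ := fun β => ‖c β‖ * (N α / N β) ^ l₀ with hu
  have hus : Summable u := by
    refine (hs.mul_right (N α ^ l₀)).congr fun β => ?_
    simp only [hu, div_pow]
    ring
  have hterm : ∀ k β, β ≠ α → ‖c β‖ * (N α / N β) ^ (l₀ + k) ≤ u β * q ^ k := by
    intro k β hβ
    rcases lt_or_ge (expNum β) (expNum α) with h | h
    · simp [hu, hlead β h]
    · have h1 : expNum α + 1 ≤ expNum β :=
        lt_of_le_of_ne h fun h' => hβ (expNum_injective h').symm
      have h2 : N α + 1 ≤ N β := by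
        simp only [hN]
        exact_mod_cast h1
      have h3 : N α / N β ≤ q :=
        div_le_div_of_nonneg_left (hNpos α).le (by linarith [hNpos α]) h2
      have h4 : 0 ≤ N α / N β := div_nonneg (hNpos α).le (hNpos β).le
      rw [pow_add, ← mul_assoc]
      exact mul_le_mul_of_nonneg_left (pow_le_pow_left₀ h4 h3 k) (by positivity)
  have hlim : Tendsto (fun k => (∑' β, u β) * q ^ k) atTop (𝓝 0) := by
    simpa using (tendsto_pow_atTop_nhds_zero_of_lt_one hq0 hq1).const_mul (∑' β, u β)
  obtain ⟨k₀, hk₀⟩ := eventually_atTop.1 (hlim.eventually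
    (Iic_mem_nhds (show (0 : ℝ) < 1 / 2 by norm_num)))
  refine eventually_atTop.2 ⟨l₀ + k₀, fun l hl => ?_⟩
  obtain ⟨k, rfl⟩ := Nat.exists_eq_add_of_le (show l₀ ≤ l by omega)
  have hk := hk₀ k (by omega)
  have hnorm : ∀ β, ‖c β * ((expNum α : ℂ) / expNum β) ^ (l₀ + k)‖
      = ‖c β‖ * (N α / N β) ^ (l₀ + k) := by
    intro β
    simp [hN]
  have hsum : Summable fun β => ‖c β * ((expNum α : ℂ) / expNum β) ^ (l₀ + k)‖ := by
    refine Summable.of_nonneg_of_le (fun _ => norm_nonneg _) (fun β => ?_) hus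
    rw [hnorm]
    rcases eq_or_ne β α with rfl | h
    · simp [hu, div_self (hNpos β).ne']
    · refine (hterm k β h).trans ?_
      exact mul_le_of_le_one_right (by positivity) (pow_le_one₀ hq0 hq1.le)
  refine ⟨SumFam.mk _ hsum, fun β => rfl, le_trans ?_ hk⟩
  refine hasSum_le (fun β => ?_) (SumFam.hasSum_norm _) (hus.hasSum.mul_right (q ^ k))
  change ‖c β * ((expNum α : ℂ) / expNum β) ^ (l₀ + k) - SumFam.unit α β‖ ≤ _
  rw [SumFam.unit_apply]
  rcases eq_or_ne β α with rfl | h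
  · have : (expNum β : ℂ) ≠ 0 := Nat.cast_ne_zero.2 (expNum_pos β).ne'
    rw [if_pos rfl, hα, div_self this, one_pow, mul_one, sub_self, norm_zero]
    positivity
  · rw [if_neg h, sub_zero, hnorm]
    exact hterm k β h

end Monomials

section Closedness

lemma exists_finset_le_of_mem (L : Set (Fin n → ℕ)) :
    ∃ A : Finset (Fin n → ℕ), (∀ α ∈ A, α ∈ L) ∧ ∀ α ∈ L, ∃ β ∈ A, β ≤ α := by
  have hpwo : L.IsPWO := Set.IsPWO.mono
    (Set.IsPWO.pi (s := fun _ : Fin n => (Set.univ : Set ℕ)) fun _ => Set.IsPWO.of_linearOrder _)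
    (fun _ _ _ _ => Set.mem_univ _)
  have hfin : {α | Minimal (· ∈ L) α}.Finite :=
    IsAntichain.finite_of_partiallyWellOrderedOn (setOfPred_minimal_antichain _)
      (hpwo.mono fun _ h => h.1)
  refine ⟨hfin.toFinset, fun α hα => ((Set.Finite.mem_toFinset _).1 hα).1, fun α hα => ?_⟩
  obtain ⟨β, hβ, hβm⟩ := hpwo.exists_le_minimal hα
  exact ⟨β, (Set.Finite.mem_toFinset _).2 hβm, hβ⟩

/-- On small polydiscs, the absolutely convergent power series in a germ ideal form a closed
subspace. -/
theorem IsGermIdeal.eventually_isClosed {P : (Cn n → ℂ) → Prop} (hP : IsGermIdeal P) :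
    ∀ᶠ l in atTop, IsClosed {b : SumFam (Fin n → ℕ) | P (evalFam l b)} := by
  classical
  obtain ⟨A, hAL, hA⟩ := exists_finset_le_of_mem (leadSet P)
  have hnear : ∀ α ∈ A, ∀ᶠ l in atTop, ∃ g : SumFam (Fin n → ℕ),
      P (evalFam l g) ∧ ‖g - SumFam.unit α‖ ≤ 1 / 2 := by
    intro α hα
    obtain ⟨c, hc1, hc0, ⟨l₀, hs⟩, hPc⟩ := hAL α hα
    filter_upwards [eventually_exists_near_unit hc1 hc0 hs] with l ⟨g, hg, hgn⟩
    refine ⟨g, hP.of_le hPc ‖(expNum α : ℂ) ^ l‖ (Eventually.of_forall fun z => ?_), hgn⟩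
    rw [← norm_mul, evalFam, ← tsum_mul_left]
    refine le_of_eq (congrArg norm (tsum_congr fun β => ?_))
    have hβ : (expNum β : ℂ) ^ l ≠ 0 := pow_ne_zero _ (Nat.cast_ne_zero.2 (expNum_pos β).ne')
    rw [hg, scaledMon, div_pow]
    field_simp
  filter_upwards [(Finset.eventually_all A).2 hnear] with l hl
  choose! g hgP hgn using hl
  choose! j hjA hj using hA
  set v : (Fin n → ℕ) → SumFam (Fin n → ℕ) := fun α =>
    if α ∈ leadSet P then SumFam.shift (α - j α) (g (j α)) else SumFam.unit α with hv
  have hvn : ∀ α, ‖v α - SumFam.unit α‖ ≤ 1 / 2 := by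
    intro α
    by_cases h : α ∈ leadSet P
    · have h1 : SumFam.unit α = SumFam.shift (α - j α) (SumFam.unit (j α)) := by
        rw [SumFam.shift_unit, add_tsub_cancel_of_le (hj α h)]
      simp only [hv, if_pos h]
      rw [h1, ← map_sub]
      exact (SumFam.norm_shift_le _ _).trans (hgn _ (hjA α h))
    · simp [hv, if_neg h]
  obtain ⟨C, hC, T, hT₁, -⟩ := SumFam.exists_equiv_of_near_unit hvn
  suffices h : {b : SumFam (Fin n → ℕ) | P (evalFam l b)}
      = ⋂ α ∈ (leadSet P)ᶜ, {b | T b α = 0} by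
    rw [h]
    exact isClosed_biInter fun α _ =>
      isClosed_eq ((SumFam.continuous_apply α).comp T.continuous) continuous_const
  ext a
  set b := T a with hb
  have hbs : Summable fun α => ‖if α ∈ leadSet P then (0 : ℂ) else b α‖ :=
    Summable.of_nonneg_of_le (fun _ => norm_nonneg _)
      (fun α => by split_ifs <;> simp) b.hasSum_norm.summable
  set b' : SumFam (Fin n → ℕ) := SumFam.mk _ hbs with hb'
  set h₁ : Cn n → ℂ := fun z => ∑' α, if α ∈ leadSet P then b α * evalFam l (v α) z else 0
    with hh₁
  have hterm : ∀ z ∈ scaledPolydisc n l, ∀ α,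
      ‖if α ∈ leadSet P then b α * evalFam l (v α) z else 0‖
        ≤ ‖b α‖ * ∑ β ∈ A, ‖evalFam l (g β) z‖ := by
    intro z hz α
    split_ifs with h
    · rw [norm_mul]
      refine mul_le_mul_of_nonneg_left ?_ (norm_nonneg _)
      simp only [hv, if_pos h]
      rw [evalFam_shift hz, norm_mul]
      calc _ ≤ ‖evalFam l (g (j α)) z‖ * 1 :=
            mul_le_mul_of_nonneg_left (norm_scaledMon_le_one hz _) (norm_nonneg _)
        _ = ‖evalFam l (g (j α)) z‖ := mul_one _
        _ ≤ _ := Finset.single_le_sum (f := fun β => ‖evalFam l (g β) z‖)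
            (fun _ _ => norm_nonneg _) (hjA α h)
    · rw [norm_zero]
      positivity
  have hPh₁ : P h₁ := by
    refine hP.dom _ A (fun β => evalFam l (g β)) h₁ ‖b‖ hgP ?_
    filter_upwards [scaledPolydisc_mem_nhds n l] with z hz
    exact tsum_of_norm_bounded (b.hasSum_norm.mul_right _) (hterm z hz)
  have hsplit : ∀ z ∈ scaledPolydisc n l, evalFam l a z = h₁ z + evalFam l b' z := by
    intro z hz
    rw [← hT₁ a, evalFam_lift hz]
    refine Eq.trans (tsum_congr fun α => ?_) (Summable.tsum_add
      (Summable.of_norm_bounded (b.hasSum_norm.summable.mul_right _) (hterm z hz))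
      (SumFam.summable_smul (norm_scaledMon_le_one hz) b'))
    rw [hb', SumFam.mk_apply]
    by_cases h : α ∈ leadSet P
    · simp [if_pos h, hb]
    · simp only [if_neg h, hv, evalFam_unit]
      simp [hb]
  simp only [Set.mem_setOf_eq, Set.mem_iInter, Set.mem_compl_iff]
  constructor
  · intro ha
    have hPb' : P (evalFam l b') := by
      refine hP.of_le_add ha hPh₁ ?_
      filter_upwards [scaledPolydisc_mem_nhds n l] with z hz
      rw [show evalFam l b' z = evalFam l a z - h₁ z by rw [hsplit z hz]; ring]
      exact norm_sub_le _ _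
    intro α hα
    by_contra hne
    have hne' : b' α ≠ 0 := by
      rw [hb', SumFam.mk_apply, if_neg hα]
      exact hne
    obtain ⟨β, hβ, hβ'⟩ := hP.exists_mem_leadSet hPb' hne'
    exact hβ' (by rw [hb', SumFam.mk_apply, if_pos hβ])
  · intro h0
    refine hP.of_le hPh₁ 1 ?_
    filter_upwards [scaledPolydisc_mem_nhds n l] with z hz
    rw [hsplit z hz, one_mul]
    have : evalFam l b' z = 0 := by
      rw [evalFam]
      refine (tsum_congr fun α => ?_).trans tsum_zero
      rw [hb', SumFam.mk_apply]
      by_cases h : α ∈ leadSet P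
      · rw [if_pos h, zero_mul]
      · rw [if_neg h, h0 α h, zero_mul]
    rw [this, add_zero]

end Closedness

section PowerSeries

lemma cons_mem_ball {R : ℝ} (hR : 0 < R) {ζ : ℂ} {w : Cn n} :
    (Fin.cons ζ w : Cn (n + 1)) ∈ Metric.ball (0 : Cn (n + 1)) R
      ↔ ‖ζ‖ < R ∧ w ∈ Metric.ball (0 : Cn n) R := by
  rw [mem_ball_zero_iff, mem_ball_zero_iff, pi_norm_lt_iff hR, pi_norm_lt_iff hR,
    Fin.forall_fin_succ]
  simp

/-- The embedding of the last coordinates. -/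
def consCLM (n : ℕ) : Cn n →L[ℂ] Cn (n + 1) :=
  (0 : Cn n →L[ℂ] ℂ).finCons (ContinuousLinearMap.id ℂ (Cn n))

lemma hasFDerivAt_cons (ζ : ℂ) (w : Cn n) :
    HasFDerivAt (fun w : Cn n => (Fin.cons ζ w : Cn (n + 1))) (consCLM n) w :=
  HasFDerivAt.finCons (hasFDerivAt_const ζ w) (hasFDerivAt_id w)

/-- Circle integrals in the first coordinate preserve holomorphy in the other coordinates. -/
lemma differentiableOn_circleIntegral_cons {R s K : ℝ} (hs : 0 < s) (hsR : s < R)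
    {f : Cn (n + 1) → ℂ} (hf : DifferentiableOn ℂ f (Metric.ball 0 R))
    (hb : ∀ z ∈ Metric.ball (0 : Cn (n + 1)) R, ‖f z‖ ≤ K) {h : ℂ → ℂ}
    (hh : ContinuousOn h (Metric.sphere 0 s)) :
    DifferentiableOn ℂ (fun w : Cn n => ∮ ζ in C(0, s), h ζ • f (Fin.cons ζ w))
      (Metric.ball 0 R) := by
  intro w₀ hw₀
  have hR : 0 < R := hs.trans hsR
  have hK : 0 ≤ K := (norm_nonneg _).trans (hb 0 (Metric.mem_ball_self hR))
  obtain ⟨δ, hδ, hδw⟩ : ∃ δ > 0, ∀ w ∈ Metric.ball w₀ δ, ‖w‖ + δ ≤ R ∧ s + δ ≤ R := by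
    rw [mem_ball_zero_iff] at hw₀
    refine ⟨min ((R - ‖w₀‖) / 2) (R - s), lt_min (by linarith) (by linarith), fun w hw => ?_⟩
    rw [mem_ball_iff_norm] at hw
    have h1 := norm_le_norm_add_norm_sub' w w₀
    have h2 := min_le_left ((R - ‖w₀‖) / 2) (R - s)
    have h3 := min_le_right ((R - ‖w₀‖) / 2) (R - s)
    constructor <;> linarith
  have hsph : ∀ θ, circleMap 0 s θ ∈ Metric.sphere (0 : ℂ) s := fun θ =>
    circleMap_mem_sphere 0 hs.le θ
  have hnc : ∀ θ, ‖circleMap 0 s θ‖ = s := fun θ => by simpa using hsph θ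
  have hmem : ∀ θ, ∀ w ∈ Metric.ball w₀ δ,
      (Fin.cons (circleMap 0 s θ) w : Cn (n + 1)) ∈ Metric.ball (0 : Cn (n + 1)) R := by
    intro θ w hw
    rw [cons_mem_ball hR, hnc, mem_ball_zero_iff]
    exact ⟨hsR, by linarith [(hδw w hw).1]⟩
  have hsub : ∀ θ, ∀ w ∈ Metric.ball w₀ δ,
      Metric.ball (Fin.cons (circleMap 0 s θ) w : Cn (n + 1)) δ ⊆ Metric.ball 0 R := by
    intro θ w hw
    refine Metric.ball_subset_ball' ?_
    rw [dist_zero_right]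
    have : ‖(Fin.cons (circleMap 0 s θ) w : Cn (n + 1))‖ ≤ R - δ := by
      rw [pi_norm_le_iff_of_nonneg (by linarith [(hδw w hw).1, norm_nonneg w]),
        Fin.forall_fin_succ]
      simp only [Fin.cons_zero, Fin.cons_succ]
      refine ⟨by rw [hnc]; linarith [(hδw w hw).2], fun i => ?_⟩
      linarith [norm_le_pi_norm w i, (hδw w hw).1]
    linarith
  have hcont : ∀ w ∈ Metric.ball w₀ δ, Continuous fun θ : ℝ =>
      deriv (circleMap 0 s) θ • h (circleMap 0 s θ) • f (Fin.cons (circleMap 0 s θ) w) := by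
    intro w hw
    have h1 : Continuous fun θ : ℝ => h (circleMap 0 s θ) :=
      hh.comp_continuous (continuous_circleMap 0 s) hsph
    have h2 : Continuous fun θ : ℝ => f (Fin.cons (circleMap 0 s θ) w) := by
      refine hf.continuousOn.comp_continuous ?_ fun θ => hmem θ w hw
      refine continuous_pi fun i => ?_
      refine Fin.cases ?_ (fun i => ?_) i
      · simpa using continuous_circleMap 0 s
      · simpa using continuous_const
    have h3 : Continuous fun θ : ℝ => deriv (circleMap 0 s) θ := by
      simp only [deriv_circleMap]
      fun_prop
    exact h3.smul (h1.smul h2)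
  obtain ⟨Ch, hCh⟩ := (isCompact_sphere (0 : ℂ) s).exists_bound_of_continuousOn hh
  have hCh0 : 0 ≤ Ch := (norm_nonneg _).trans (hCh _ (hsph 0))
  refine (HasFDerivAt.differentiableAt (f' := ∫ θ in (0 : ℝ)..2 * Real.pi,
    (deriv (circleMap 0 s) θ * h (circleMap 0 s θ)) •
      (fderiv ℂ f (Fin.cons (circleMap 0 s θ) w₀)).comp (consCLM n))
    ?_).differentiableWithinAt
  refine intervalIntegral.hasFDerivAt_integral_of_dominated_of_fderiv_le
    (F' := fun w θ => (deriv (circleMap 0 s) θ * h (circleMap 0 s θ)) •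
      (fderiv ℂ f (Fin.cons (circleMap 0 s θ) w)).comp (consCLM n))
    (bound := fun _ => s * Ch * ((2 * K + 1) / δ * ‖consCLM n‖))
    (Metric.ball_mem_nhds w₀ hδ) ?_ ?_ ?_ ?_ intervalIntegrable_const ?_
  · filter_upwards [Metric.ball_mem_nhds w₀ hδ] with w hw
    exact (hcont w hw).aestronglyMeasurable
  · exact (hcont w₀ (Metric.mem_ball_self hδ)).intervalIntegrable _ _
  · have h1 : Continuous fun θ : ℝ => deriv (circleMap 0 s) θ * h (circleMap 0 s θ) := by
      refine Continuous.mul ?_ (hh.comp_continuous (continuous_circleMap 0 s) hsph)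
      rw [show deriv (circleMap 0 s) = fun θ => circleMap 0 s θ * Complex.I from
        funext fun θ => deriv_circleMap 0 s θ]
      fun_prop
    have h2 : Continuous fun θ : ℝ => (Fin.cons (circleMap 0 s θ) w₀ : Cn (n + 1)) := by
      refine continuous_pi fun i => ?_
      refine Fin.cases ?_ (fun i => ?_) i
      · simpa using continuous_circleMap 0 s
      · simpa using continuous_const
    have h3 : StronglyMeasurable fun θ : ℝ => fderiv ℂ f (Fin.cons (circleMap 0 s θ) w₀) :=
      ((measurable_fderiv ℂ f).comp h2.measurable).stronglyMeasurable
    have h4 : StronglyMeasurable fun θ : ℝ =>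
        (fderiv ℂ f (Fin.cons (circleMap 0 s θ) w₀)).comp (consCLM n) :=
      ((ContinuousLinearMap.compL ℂ (Cn n) (Cn (n + 1)) ℂ).flip
        (consCLM n)).continuous.comp_stronglyMeasurable h3
    exact (h1.stronglyMeasurable.smul h4).aestronglyMeasurable
  · refine Eventually.of_forall fun θ _ w hw => ?_
    have h1 : ‖fderiv ℂ f (Fin.cons (circleMap 0 s θ) w)‖ ≤ (2 * K + 1) / δ := by
      refine Complex.norm_fderiv_le_div_of_mapsTo_ball (hf.mono (hsub θ w hw)) ?_ hδ
      intro y hy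
      rw [mem_closedBall_iff_norm]
      have := norm_sub_le (f y) (f (Fin.cons (circleMap 0 s θ) w))
      linarith [hb y (hsub θ w hw hy), hb _ (hmem θ w hw)]
    rw [norm_smul, norm_mul, deriv_circleMap, norm_mul, hnc, Complex.norm_I, mul_one]
    gcongr
    · exact hCh _ (hsph θ)
    · exact (ContinuousLinearMap.opNorm_comp_le _ _).trans (by gcongr)
  · refine Eventually.of_forall fun θ _ w hw => ?_
    have h1 : HasFDerivAt f (fderiv ℂ f (Fin.cons (circleMap 0 s θ) w))
        (Fin.cons (circleMap 0 s θ) w) :=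
      (hf.differentiableAt (Metric.isOpen_ball.mem_nhds (hmem θ w hw))).hasFDerivAt
    have h2 := ((h1.comp w (hasFDerivAt_cons _ w)).const_smul (h (circleMap 0 s θ))).const_smul
      (deriv (circleMap 0 s) θ)
    rw [mul_smul]
    exact h2

end PowerSeries

section PowerSeriesExpansion

lemma summable_prod_pow : ∀ {n : ℕ} {x : Fin n → ℝ}, (∀ i, 0 ≤ x i) → (∀ i, x i < 1) →
    Summable fun α : Fin n → ℕ => ∏ i, x i ^ α i
  | 0, _, _, _ => (hasSum_fintype _).summable
  | n + 1, x, h0, h1 => by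
    rw [← (Fin.consEquiv fun _ : Fin (n + 1) => ℕ).summable_iff]
    have h := Summable.mul_of_nonneg (summable_geometric_of_lt_one (h0 0) (h1 0))
      (summable_prod_pow (x := fun i => x i.succ) (fun i => h0 _) (fun i => h1 _))
      (fun k => pow_nonneg (h0 0) k)
      (fun β => Finset.prod_nonneg fun i _ => pow_nonneg (h0 _) _)
    refine h.congr fun p => ?_
    simp [Fin.prod_univ_succ, Fin.consEquiv]

/-- Bounded holomorphic functions on a polydisc are given by power series, with Cauchy's
estimates for the coefficients. -/
theorem exists_coeff_of_differentiableOn : ∀ {n : ℕ} {R s K : ℝ}, 0 < s → s < R →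
    ∀ {f : Cn n → ℂ}, DifferentiableOn ℂ f (Metric.ball 0 R) →
    (∀ z ∈ Metric.ball (0 : Cn n) R, ‖f z‖ ≤ K) →
    ∃ c : (Fin n → ℕ) → ℂ, (∀ α, ‖c α‖ ≤ K * ∏ i, (s⁻¹) ^ α i) ∧
      ∀ z ∈ Metric.ball (0 : Cn n) s, HasSum (fun α => c α * evalMon α z) (f z)
  | 0, R, s, K, hs, hsR, f, _, hb => by
    refine ⟨fun _ => f 0, fun α => ?_, fun z _ => ?_⟩
    · simpa using hb 0 (Metric.mem_ball_self (hs.trans hsR))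
    · have h := hasSum_unique (fun α : Fin 0 → ℕ => f 0 * evalMon α z)
      rw [Subsingleton.elim z 0] at h ⊢
      simpa [evalMon] using h
  | n + 1, R, s, K, hs, hsR, f, hf, hb => by
    have hR : 0 < R := hs.trans hsR
    set a : ℕ → Cn n → ℂ := fun k w =>
      (2 * Real.pi * Complex.I : ℂ)⁻¹ • ∮ ζ in C(0, s), ((1 / (ζ - 0)) ^ k * (ζ - 0)⁻¹) •
        f (Fin.cons ζ w) with ha
    have hne : ∀ ζ ∈ Metric.sphere (0 : ℂ) s, ζ - 0 ≠ 0 := by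
      intro ζ hζ
      rw [sub_zero]
      exact Metric.ne_of_mem_sphere hζ hs.ne'
    have had : ∀ k, DifferentiableOn ℂ (a k) (Metric.ball 0 R) := by
      intro k
      refine DifferentiableOn.const_smul
        (differentiableOn_circleIntegral_cons hs hsR hf hb ?_) (2 * Real.pi * Complex.I : ℂ)⁻¹
      exact ((continuousOn_const.div (continuousOn_id.sub continuousOn_const) hne).pow k).mul
        ((continuousOn_id.sub continuousOn_const).inv₀ hne)
    have hab : ∀ k, ∀ w ∈ Metric.ball (0 : Cn n) R, ‖a k w‖ ≤ K * (s⁻¹) ^ k := by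
      intro k w hw
      refine (circleIntegral.norm_two_pi_i_inv_smul_integral_le_of_norm_le_const hs.le
        (C := (s⁻¹) ^ k * s⁻¹ * K) fun ζ hζ => ?_).trans_eq ?_
      · have h1 : ‖ζ‖ = s := by simpa using hζ
        have h2 := hb (Fin.cons ζ w) ((cons_mem_ball hR).2 ⟨by rw [h1]; exact hsR, hw⟩)
        rw [norm_smul, norm_mul, norm_pow, norm_div, norm_inv, sub_zero, h1, norm_one, one_div]
        exact mul_le_mul_of_nonneg_left h2 (by positivity)
      · field_simp
    have hasum : ∀ w ∈ Metric.ball (0 : Cn n) R, ∀ ζ : ℂ, ‖ζ‖ < s →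
        HasSum (fun k => a k w * ζ ^ k) (f (Fin.cons ζ w)) := by
      intro w hw ζ hζ
      have hd : DifferentiableOn ℂ (fun ζ : ℂ => f (Fin.cons ζ w)) (Metric.closedBall 0 s) := by
        intro ζ hζ
        rw [mem_closedBall_zero_iff] at hζ
        have h1 := hf.differentiableAt (Metric.isOpen_ball.mem_nhds
          ((cons_mem_ball hR).2 ⟨hζ.trans_lt hsR, hw⟩))
        have h2 : DifferentiableAt ℂ (fun ζ : ℂ => (Fin.cons ζ w : Cn (n + 1))) ζ :=
          (HasFDerivAt.finCons (hasFDerivAt_id ζ) (hasFDerivAt_const w ζ)).differentiableAt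
        exact (h1.comp ζ h2).differentiableWithinAt
      lift s to ℝ≥0 using hs.le
      have hp := DifferentiableOn.hasFPowerSeriesOnBall hd (by exact_mod_cast hs)
      have hζ' : ζ ∈ Metric.eball (0 : ℂ) (s : ℝ≥0∞) := by
        rw [Metric.mem_eball, edist_zero_right, enorm_eq_nnnorm]
        exact_mod_cast hζ
      have h3 := hp.hasSum hζ'
      rw [zero_add] at h3
      refine h3.congr_fun fun k => ?_
      rw [FormalMultilinearSeries.apply_eq_pow_smul_coeff, smul_eq_mul, mul_comm]
      congr 1
      have h4 := cauchyPowerSeries_apply (fun ζ : ℂ => f (Fin.cons ζ w)) 0 s k 1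
      rw [FormalMultilinearSeries.apply_eq_pow_smul_coeff, one_pow, one_smul] at h4
      simp only [ha, mul_smul]
      exact h4.symm
    choose d hdb hds using fun k =>
      exists_coeff_of_differentiableOn hs hsR (had k) (hab k)
    refine ⟨fun α => d (α 0) (Fin.tail α), fun α => ?_, fun z hz => ?_⟩
    · rw [Fin.prod_univ_succ, ← mul_assoc]
      exact hdb _ _
    · have hz1 : ∀ i, ‖z i‖ < s := (pi_norm_lt_iff hs).1 (mem_ball_zero_iff.1 hz)
      have hK : 0 ≤ K := (norm_nonneg _).trans (hb 0 (Metric.mem_ball_self hR))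
      have hzt : Fin.tail z ∈ Metric.ball (0 : Cn n) s := by
        rw [mem_ball_zero_iff, pi_norm_lt_iff hs]
        exact fun i => hz1 _
      have hsum : Summable fun α : Fin (n + 1) → ℕ => d (α 0) (Fin.tail α) * evalMon α z := by
        refine Summable.of_norm_bounded ((summable_prod_pow (x := fun i => s⁻¹ * ‖z i‖)
          (fun i => by positivity) (fun i => ?_)).mul_left K) fun α => ?_
        · rw [inv_mul_lt_one₀ hs]
          exact hz1 i
        · rw [norm_mul, evalMon, norm_prod]
          simp only [mul_pow, Finset.prod_mul_distrib, norm_pow]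
          rw [← mul_assoc]
          refine mul_le_mul_of_nonneg_right ?_ (Finset.prod_nonneg fun i _ => by positivity)
          rw [Fin.prod_univ_succ, ← mul_assoc]
          exact hdb _ _
      have hprod := (Fin.consEquiv fun _ : Fin (n + 1) => ℕ).hasSum_iff.2 hsum.hasSum
      have hfib := hprod.prod_fiberwise (g := fun k => a k (Fin.tail z) * z 0 ^ k) fun k => by
        refine ((hds k (Fin.tail z) hzt).mul_right (z 0 ^ k)).congr_fun fun β => ?_
        simp only [Function.comp_apply, Fin.consEquiv, Equiv.coe_fn_mk, Fin.cons_zero,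
          Fin.tail_cons, evalMon, Fin.prod_univ_succ, Fin.cons_succ, Fin.tail]
        ring
      have huniq := hfib.unique (hasum (Fin.tail z)
        (Metric.ball_subset_ball hsR.le hzt) (z 0) (hz1 0))
      rw [Fin.cons_self_tail] at huniq
      rw [← huniq]
      exact hsum.hasSum

end PowerSeriesExpansion

section Closure

lemma exists_evalFam_eq {R s K : ℝ} (hs : 0 < s) (hsR : s < R) {l : ℕ} (hl : 2 * s⁻¹ ≤ 2 ^ l)
    {f : Cn n → ℂ} (hf : DifferentiableOn ℂ f (Metric.ball 0 R))
    (hb : ∀ z ∈ Metric.ball (0 : Cn n) R, ‖f z‖ ≤ K) :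
    ∃ b : SumFam (Fin n → ℕ), ‖b‖ ≤ K * ∑' α : Fin n → ℕ, ∏ i, (1 / 2 : ℝ) ^ α i ∧
      ∀ z ∈ Metric.ball (0 : Cn n) s, evalFam l b z = f z := by
  obtain ⟨c, hc, hsum⟩ := exists_coeff_of_differentiableOn hs hsR hf hb
  have hK : 0 ≤ K := (norm_nonneg _).trans (hb 0 (Metric.mem_ball_self (hs.trans hsR)))
  have hS : Summable fun α : Fin n → ℕ => ∏ i, (1 / 2 : ℝ) ^ α i :=
    summable_prod_pow (x := fun _ => 1 / 2) (fun _ => by norm_num) (fun _ => by norm_num)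
  have hN : ∀ β : Fin n → ℕ, (expNum β : ℂ) ^ l ≠ 0 := fun β =>
    pow_ne_zero _ (Nat.cast_ne_zero.2 (expNum_pos β).ne')
  have hle : ∀ α, ‖c α / (expNum α : ℂ) ^ l‖ ≤ K * ∏ i, (1 / 2 : ℝ) ^ α i := by
    intro α
    have hNr : (0 : ℝ) < (expNum α : ℝ) ^ l := pow_pos (Nat.cast_pos.2 (expNum_pos α)) _
    rw [norm_div, norm_pow, Complex.norm_natCast, div_le_iff₀ hNr]
    refine (hc α).trans ?_
    rw [mul_assoc]
    refine mul_le_mul_of_nonneg_left ?_ hK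
    rw [expNum, Nat.cast_prod, ← Finset.prod_pow, ← Finset.prod_mul_distrib]
    refine Finset.prod_le_prod (fun i _ => by positivity) fun i _ => ?_
    rw [Nat.cast_pow, ← pow_mul, mul_comm (α i) l, pow_mul, ← mul_pow]
    refine pow_le_pow_left₀ (by positivity) ?_ _
    have h2 : (2 : ℝ) ^ l ≤ (finPrime i : ℝ) ^ l :=
      pow_le_pow_left₀ (by norm_num) (by exact_mod_cast (prime_finPrime i).two_le) _
    linarith
  have hbs : Summable fun α => ‖c α / (expNum α : ℂ) ^ l‖ :=
    Summable.of_nonneg_of_le (fun _ => norm_nonneg _) hle (hS.mul_left K)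
  refine ⟨SumFam.mk _ hbs, ?_, fun z hz => ?_⟩
  · rw [← tsum_mul_left]
    have h := (SumFam.hasSum_norm (SumFam.mk _ hbs)).tsum_eq
    simp only [SumFam.mk_apply] at h
    rw [← h]
    exact hbs.tsum_le_tsum hle (hS.mul_left K)
  · rw [← (hsum z hz).tsum_eq, evalFam]
    refine tsum_congr fun α => ?_
    rw [SumFam.mk_apply, scaledMon, ← mul_assoc, div_mul_cancel₀ _ (hN α)]

lemma evalFam_sub {l : ℕ} {z : Cn n} (hz : z ∈ scaledPolydisc n l)
    (a b : SumFam (Fin n → ℕ)) : evalFam l (a - b) z = evalFam l a z - evalFam l b z :=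
  map_sub (SumFam.lift (fun α => scaledMon l α z) 1 (norm_scaledMon_le_one hz)) a b

/-- Germ ideals are closed under uniform convergence on a fixed neighborhood. -/
theorem IsGermIdeal.of_tendsto {P : (Cn n → ℂ) → Prop} (hP : IsGermIdeal P) {R K : ℝ}
    (hR : 0 < R) {f : Cn n → ℂ} {F : ℕ → Cn n → ℂ} {κ : ℕ → ℝ}
    (hf : DifferentiableOn ℂ f (Metric.ball 0 R))
    (hfK : ∀ z ∈ Metric.ball (0 : Cn n) R, ‖f z‖ ≤ K)
    (hF : ∀ k, DifferentiableOn ℂ (F k) (Metric.ball 0 R))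
    (hFκ : ∀ k, ∀ z ∈ Metric.ball (0 : Cn n) R, ‖F k z‖ ≤ κ k)
    (hκ : Tendsto κ atTop (𝓝 0)) (hmem : ∀ k, P fun z => f z - F k z) : P f := by
  have hs : 0 < R / 2 := by linarith
  have hsR : R / 2 < R := by linarith
  have hev : ∀ᶠ l : ℕ in atTop, 2 * (R / 2)⁻¹ ≤ (2 : ℝ) ^ l :=
    (tendsto_pow_atTop_atTop_of_one_lt (by norm_num)).eventually_ge_atTop _
  obtain ⟨l, hcl, hl⟩ := (hP.eventually_isClosed.and hev).exists
  obtain ⟨b, -, hb⟩ := exists_evalFam_eq hs hsR hl hf hfK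
  choose a ha ha' using fun k => exists_evalFam_eq hs hsR hl (hF k) (hFκ k)
  have hball : Metric.ball (0 : Cn n) (R / 2) ∈ 𝓝 0 := Metric.ball_mem_nhds _ hs
  have ha0 : Tendsto a atTop (𝓝 0) := by
    refine squeeze_zero_norm ha ?_
    simpa using hκ.mul_const (∑' α : Fin n → ℕ, ∏ i, (1 / 2 : ℝ) ^ α i)
  have hlim : Tendsto (fun k => b - a k) atTop (𝓝 b) := by
    simpa using tendsto_const_nhds.sub ha0
  have hbP : P (evalFam l b) := by
    refine hcl.mem_of_tendsto hlim (Eventually.of_forall fun k => ?_)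
    refine hP.of_le (hmem k) 1 ?_
    filter_upwards [hball, scaledPolydisc_mem_nhds n l] with z hz hz'
    rw [evalFam_sub hz', hb z hz, ha' k z hz, one_mul]
  refine hP.of_le hbP 1 ?_
  filter_upwards [hball] with z hz
  rw [hb z hz, one_mul]

end Closure

section SupBound

/-- The sup norm of a holomorphic function on a ball is controlled by its square integral on a
larger ball. -/
lemma exists_sup_le_lintegral {R : ℝ} (hR : 0 < R) : ∃ C : ℝ≥0∞, C ≠ ⊤ ∧
    ∀ F : Cn n → ℂ, DifferentiableOn ℂ F (Metric.ball 0 R) →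
      ∀ z ∈ Metric.ball (0 : Cn n) (R / 2),
        (‖F z‖₊ : ℝ≥0∞) ^ 2 ≤ C * ∫⁻ y in Metric.ball 0 R, (‖F y‖₊ : ℝ≥0∞) ^ 2 := by
  obtain ⟨ρ, hρ⟩ := exists_isMollifier (n := n) (ε := R / 4) (by linarith)
  obtain ⟨M, hM⟩ := hρ.hasCompactSupport.exists_bound_of_continuous hρ.smooth.continuous
  refine ⟨(ENNReal.ofReal M) ^ 2 * volume (Metric.ball (0 : Cn n) R),
    ENNReal.mul_ne_top (by simp) measure_ball_lt_top.ne, fun F hF z hz => ?_⟩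
  have hzR : ‖z‖ < R / 2 := by simpa using hz
  have hsub : Metric.closedBall z (R / 4) ⊆ Metric.ball 0 R := by
    intro y hy
    rw [mem_closedBall_iff_norm] at hy
    rw [mem_ball_zero_iff]
    have := norm_add_le (y - z) z
    rw [sub_add_cancel] at this
    linarith
  have h1 : (‖F z‖₊ : ℝ≥0∞) ≤
      ENNReal.ofReal M * ∫⁻ y in Metric.ball (0 : Cn n) R, (‖F y‖₊ : ℝ≥0∞) := by
    have hz' := hρ.moll_eq_of_differentiableOn (hF.mono hsub)
    rw [← hz', moll, ← lintegral_const_mul' _ _ ENNReal.ofReal_ne_top,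
      ← lintegral_indicator Metric.isOpen_ball.measurableSet]
    refine (enorm_integral_le_lintegral_enorm _).trans (lintegral_mono fun y => ?_)
    by_cases hy : y ∈ Metric.ball (0 : Cn n) R
    · rw [Set.indicator_of_mem hy, enorm_smul]
      refine mul_le_mul_left ?_ _
      rw [← ofReal_norm]
      exact ENNReal.ofReal_le_ofReal (hM _)
    · rw [Set.indicator_of_notMem hy]
      have : ρ (z - y) = 0 := by
        by_contra h
        refine hy (hsub ?_)
        rw [mem_closedBall_iff_norm, norm_sub_rev]
        exact (hρ.supp _ h).le
      simp [this]
  have hmeas : AEMeasurable (fun y => (‖F y‖₊ : ℝ≥0∞))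
      (volume.restrict (Metric.ball (0 : Cn n) R)) :=
    (hF.continuousOn.aestronglyMeasurable Metric.isOpen_ball.measurableSet).enorm
  have h2 : (∫⁻ y in Metric.ball (0 : Cn n) R, (‖F y‖₊ : ℝ≥0∞)) ^ 2 ≤
      (∫⁻ y in Metric.ball (0 : Cn n) R, (‖F y‖₊ : ℝ≥0∞) ^ 2) *
        volume (Metric.ball (0 : Cn n) R) := by
    have h := ENNReal.lintegral_mul_le_Lp_mul_Lq
      (volume.restrict (Metric.ball (0 : Cn n) R)) Real.HolderConjugate.two_two hmeas
      (aemeasurable_const (b := (1 : ℝ≥0∞)))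
    simp only [Pi.mul_apply, mul_one, ENNReal.one_rpow, ENNReal.rpow_two, lintegral_const,
      Measure.restrict_apply_univ] at h
    calc _ ≤ _ := pow_le_pow_left₀ zero_le h 2
      _ = _ := by
        rw [mul_pow, ← ENNReal.rpow_mul_natCast, ← ENNReal.rpow_mul_natCast]
        norm_num
  calc (‖F z‖₊ : ℝ≥0∞) ^ 2 ≤ _ := pow_le_pow_left₀ zero_le h1 2
    _ = ENNReal.ofReal M ^ 2 * (∫⁻ y in Metric.ball (0 : Cn n) R, (‖F y‖₊ : ℝ≥0∞)) ^ 2 :=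
      mul_pow _ _ _
    _ ≤ ENNReal.ofReal M ^ 2 * ((∫⁻ y in Metric.ball (0 : Cn n) R, (‖F y‖₊ : ℝ≥0∞) ^ 2) *
        volume (Metric.ball (0 : Cn n) R)) := by gcongr
    _ = _ := by ring

end SupBound

section IntegrabilityIdeal

/-- Functions whose square has an integrable measurable majorant near the origin with respect to
the weight `W`. -/
def SqIntNear (W : Cn n → ℝ≥0∞) (g : Cn n → ℂ) : Prop :=
  ∃ h : Cn n → ℝ≥0∞, Measurable h ∧ ∃ U ∈ 𝓝 (0 : Cn n),
    (∀ᵐ z ∂volume.restrict U, (‖g z‖₊ : ℝ≥0∞) ^ 2 * W z ≤ h z) ∧ ∫⁻ z in U, h z < ⊤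

lemma sqIntNear_of_aemeasurable {W : Cn n → ℝ≥0∞} {g : Cn n → ℂ} {U : Set (Cn n)}
    (hU : U ∈ 𝓝 0)
    (hm : AEMeasurable (fun z => (‖g z‖₊ : ℝ≥0∞) ^ 2 * W z) (volume.restrict U))
    (hfin : ∫⁻ z in U, (‖g z‖₊ : ℝ≥0∞) ^ 2 * W z < ⊤) : SqIntNear W g :=
  ⟨hm.mk _, hm.measurable_mk, U, hU, hm.ae_eq_mk.le, by
    rwa [← lintegral_congr_ae hm.ae_eq_mk]⟩

lemma lintegral_sum_sq_lt_top {W : Cn n → ℝ≥0∞} {ι : Type} (s : Finset ι) {G : ι → Cn n → ℂ}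
    (hG : ∀ i ∈ s, SqIntNear W (G i)) :
    ∃ h : Cn n → ℝ≥0∞, Measurable h ∧ ∃ U ∈ 𝓝 (0 : Cn n),
      (∀ᵐ z ∂volume.restrict U, ∑ i ∈ s, (‖G i z‖₊ : ℝ≥0∞) ^ 2 * W z ≤ h z) ∧
      ∫⁻ z in U, h z < ⊤ := by
  classical
  induction s using Finset.induction_on with
  | empty => exact ⟨0, measurable_zero, Set.univ, univ_mem, by simp, by simp⟩
  | insert a s ha ih =>
    obtain ⟨h, hm, U, hU, hle, hfin⟩ := ih fun i hi => hG i (Finset.mem_insert_of_mem hi)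
    obtain ⟨h', hm', U', hU', hle', hfin'⟩ := hG a (Finset.mem_insert_self _ _)
    refine ⟨fun z => h' z + h z, hm'.add hm, U ∩ U', inter_mem hU hU', ?_, ?_⟩
    · filter_upwards [ae_mono (Measure.restrict_mono_set volume Set.inter_subset_left) hle,
        ae_mono (Measure.restrict_mono_set volume Set.inter_subset_right) hle'] with z h1 h2
      rw [Finset.sum_insert ha]
      exact add_le_add h2 h1
    · rw [lintegral_add_left hm']
      exact ENNReal.add_lt_top.2 ⟨(lintegral_mono_set Set.inter_subset_right).trans_lt hfin',
        (lintegral_mono_set Set.inter_subset_left).trans_lt hfin⟩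

lemma isGermIdeal_sqIntNear (W : Cn n → ℝ≥0∞) : IsGermIdeal (SqIntNear W) where
  dom ι s G g C hG hle := by
    obtain ⟨h, hm, U, hU, hUle, hfin⟩ := lintegral_sum_sq_lt_top s hG
    obtain ⟨r, hr, hball⟩ := Metric.mem_nhds_iff.1 hle
    set c : ℝ≥0∞ := ENNReal.ofReal (C ^ 2 * s.card) with hc
    refine ⟨fun z => c * h z, hm.const_mul c, U ∩ Metric.ball 0 r,
      inter_mem hU (Metric.ball_mem_nhds _ hr), ?_, ?_⟩
    · have h1 : ∀ᵐ z ∂volume.restrict (U ∩ Metric.ball 0 r), z ∈ Metric.ball (0 : Cn n) r :=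
        ae_mono (Measure.restrict_mono_set volume Set.inter_subset_right)
          (ae_restrict_mem Metric.isOpen_ball.measurableSet)
      filter_upwards [h1,
        ae_mono (Measure.restrict_mono_set volume Set.inter_subset_left) hUle] with z hz hz'
      have h2 : ‖g z‖ ^ 2 ≤ C ^ 2 * s.card * ∑ i ∈ s, ‖G i z‖ ^ 2 := by
        calc ‖g z‖ ^ 2 ≤ (C * ∑ i ∈ s, ‖G i z‖) ^ 2 :=
              pow_le_pow_left₀ (norm_nonneg _) (hball hz) 2
          _ = C ^ 2 * (∑ i ∈ s, ‖G i z‖) ^ 2 := by ring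
          _ ≤ C ^ 2 * (s.card * ∑ i ∈ s, ‖G i z‖ ^ 2) := by
              gcongr
              exact sq_sum_le_card_mul_sum_sq
          _ = _ := by ring
      have h3 : ∀ w : ℂ, (‖w‖₊ : ℝ≥0∞) ^ 2 = ENNReal.ofReal (‖w‖ ^ 2) := fun w => by
        rw [ENNReal.ofReal_pow (norm_nonneg _), ofReal_norm]
        rfl
      have h4 : (‖g z‖₊ : ℝ≥0∞) ^ 2 ≤ c * ∑ i ∈ s, (‖G i z‖₊ : ℝ≥0∞) ^ 2 := by
        simp only [h3]
        rw [← ENNReal.ofReal_sum_of_nonneg (fun i _ => by positivity), hc,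
          ← ENNReal.ofReal_mul (by positivity)]
        exact ENNReal.ofReal_le_ofReal h2
      calc (‖g z‖₊ : ℝ≥0∞) ^ 2 * W z ≤ (c * ∑ i ∈ s, (‖G i z‖₊ : ℝ≥0∞) ^ 2) * W z := by gcongr
        _ = c * ∑ i ∈ s, (‖G i z‖₊ : ℝ≥0∞) ^ 2 * W z := by rw [mul_assoc, Finset.sum_mul]
        _ ≤ c * h z := by gcongr
    · rw [lintegral_const_mul _ hm]
      exact ENNReal.mul_lt_top ENNReal.ofReal_lt_top
        ((lintegral_mono_set Set.inter_subset_left).trans_lt hfin)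

end IntegrabilityIdeal

section Asymptotics

variable {φ φ₀ : Cn n → EReal} {r : ℝ}

lemma norm_le_of_lt_of_elog_le {N C t : ℝ} (hN : 0 < N) {x : EReal} {z : Cn n}
    (hz : (N : EReal) * elog ‖z‖ ≤ x + C) (hx : x < ((-t : ℝ) : EReal)) :
    ‖z‖ ≤ Real.exp ((C - t) / N) := by
  rcases (norm_nonneg z).eq_or_lt with h0 | h0
  · rw [← h0]
    positivity
  · rw [elog, if_neg h0.not_ge, ← EReal.coe_mul] at hz
    have h1 : x + C ≤ ((-t + C : ℝ) : EReal) := by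
      rw [EReal.coe_add]
      exact add_le_add_left hx.le _
    have h2 : N * Real.log ‖z‖ ≤ -t + C := EReal.coe_le_coe_iff.1 (hz.trans h1)
    rw [← Real.log_le_iff_le_exp h0, le_div_iff₀ hN]
    linarith

lemma wexp_neg_two_add {z : Cn n} (h : φ z < ⊤) (h₀ : φ₀ z < ⊤) :
    wexp (-2) (fun w => φ w + φ₀ w) z = wexp (-2) φ z * wexp (-2) φ₀ z := by
  rw [wexp_eq, wexp_eq, wexp_eq, EReal.exp_add, ENNReal.mul_rpow_of_ne_top]
  · exact (EReal.exp_lt_top_iff.2 h).ne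
  · exact (EReal.exp_lt_top_iff.2 h₀).ne

lemma wexp_le_of_lt {z : Cn n} {a t : ℝ} (ha : 0 ≤ a) (h : φ z < ((-t : ℝ) : EReal))
    (h₀ : φ₀ z < ⊤) :
    wexp (-2) φ₀ z ≤ ENNReal.ofReal (Real.exp (-(2 * a * t))) *
      wexp (-2) (fun w => (a : EReal) * φ w + φ₀ w) z := by
  have h1 : (a : EReal) * φ z + φ₀ z ≤ ((-(a * t) : ℝ) : EReal) + φ₀ z := by
    refine add_le_add_left ?_ _
    calc (a : EReal) * φ z ≤ (a : EReal) * ((-t : ℝ) : EReal) :=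
          mul_le_mul_of_nonneg_left h.le (EReal.coe_nonneg.2 ha)
      _ = _ := by rw [← EReal.coe_mul, mul_neg]
  have h2 : ENNReal.ofReal (Real.exp (2 * a * t)) * wexp (-2) φ₀ z ≤
      wexp (-2) (fun w => (a : EReal) * φ w + φ₀ w) z := by
    rw [wexp_eq, wexp_eq]
    have h3 : ENNReal.ofReal (Real.exp (2 * a * t)) * EReal.exp (φ₀ z) ^ (-2 : ℝ) =
        EReal.exp (((-(a * t) : ℝ) : EReal) + φ₀ z) ^ (-2 : ℝ) := by
      rw [EReal.exp_add, ENNReal.mul_rpow_of_ne_top, exp_coe_rpow]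
      · congr 3
        ring
      · exact (EReal.exp_lt_top_iff.2 (EReal.coe_lt_top _)).ne
      · exact (EReal.exp_lt_top_iff.2 h₀).ne
    rw [h3, ENNReal.rpow_neg, ENNReal.rpow_neg]
    exact ENNReal.inv_le_inv.2 (ENNReal.rpow_le_rpow (EReal.exp_monotone h1) (by norm_num))
  calc wexp (-2) φ₀ z = ENNReal.ofReal (Real.exp (-(2 * a * t))) *
        (ENNReal.ofReal (Real.exp (2 * a * t)) * wexp (-2) φ₀ z) := by
        rw [← mul_assoc, ← ENNReal.ofReal_mul (Real.exp_nonneg _), ← Real.exp_add]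
        simp
    _ ≤ _ := by gcongr

lemma PSHOn.aemeasurable_wexp (hφ : PSHOn φ (Metric.ball 0 1)) (c : ℝ) :
    AEMeasurable (wexp c φ) (volume.restrict (Metric.ball 0 1)) := by
  have h : wexp c φ = fun z => EReal.exp (φ z) ^ c := funext fun z => wexp_eq c φ z
  rw [h]
  exact (EReal.measurable_exp.comp_aemeasurable hφ.aemeasurable).pow_const c

variable {m : ℕ} {f₀ : Fin m → Cn n → ℂ}

lemma sq_nnnorm_le_normSq2 (f₀ : Fin m → Cn n → ℂ) (j : Fin m) (z : Cn n) :
    (‖f₀ j z‖₊ : ℝ≥0∞) ^ 2 ≤ normSq2 f₀ z :=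
  Finset.single_le_sum (f := fun j => (‖f₀ j z‖₊ : ℝ≥0∞) ^ 2) (fun _ _ => zero_le)
    (Finset.mem_univ j)

/-- If the sublevel sets shrink to the origin, integrability with the weight `a φ` bounds the
integrals over the sublevel sets. -/
lemma exists_lintegral_sublevel_le (hφ : PSHOn φ (Metric.ball 0 1))
    (hφ₀ : PSHOn φ₀ (Metric.ball 0 1)) (hr1 : r < 1)
    {s : ℝ → ℝ} (hs : Tendsto s atTop (𝓝 0))
    (hsub : ∀ t, ∀ z ∈ Metric.ball (0 : Cn n) r, φ z < ((-t : ℝ) : EReal) → ‖z‖ ≤ s t)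
    {a : ℝ} (ha : 0 ≤ a)
    (hgInt : IntNear fun z => normSq2 f₀ z * wexp (-2) (fun w => (a : EReal) * φ w + φ₀ w) z) :
    ∃ K : ℝ, 0 < K ∧ ∀ᶠ t in atTop,
      ∫⁻ z in {z | φ z < ((-t : ℝ) : EReal)} ∩ Metric.ball 0 r, dens0 f₀ φ₀ z ≤
        ENNReal.ofReal (Real.exp (-(2 * a * t)) * K) := by
  obtain ⟨V, hV, hfin⟩ := hgInt
  obtain ⟨ρ, hρ, hball⟩ := Metric.mem_nhds_iff.1 hV
  set I := ∫⁻ z in V, normSq2 f₀ z * wexp (-2) (fun w => (a : EReal) * φ w + φ₀ w) z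
  refine ⟨I.toReal + 1, by positivity, ?_⟩
  filter_upwards [hs.eventually_lt_const hρ] with t ht
  set A : Set (Cn n) := {z | φ z < ((-t : ℝ) : EReal)} ∩ Metric.ball 0 r with hA
  have hAV : A ⊆ V := fun z hz => hball (by
    rw [mem_ball_zero_iff]
    exact (hsub t z hz.2 hz.1).trans_lt ht)
  calc ∫⁻ z in A, dens0 f₀ φ₀ z
      ≤ ∫⁻ z in A, ENNReal.ofReal (Real.exp (-(2 * a * t))) *
        (normSq2 f₀ z * wexp (-2) (fun w => (a : EReal) * φ w + φ₀ w) z) := by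
        refine setLIntegral_mono_ae' ?_ ?_
        · exact (hφ.isOpen_sublevel hr1.le _).measurableSet
        · refine Eventually.of_forall fun z hz => ?_
          rw [mul_left_comm]
          exact mul_le_mul_right (wexp_le_of_lt ha hz.1
            (hφ₀.lt_top z (Metric.ball_subset_ball hr1.le hz.2))) _
    _ = ENNReal.ofReal (Real.exp (-(2 * a * t))) *
        ∫⁻ z in A, normSq2 f₀ z * wexp (-2) (fun w => (a : EReal) * φ w + φ₀ w) z :=
        lintegral_const_mul' _ _ ENNReal.ofReal_ne_top
    _ ≤ ENNReal.ofReal (Real.exp (-(2 * a * t))) * I := by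
        gcongr
        exact lintegral_mono_set hAV
    _ ≤ _ := by
        rw [ENNReal.ofReal_mul (Real.exp_nonneg _)]
        gcongr
        rw [← ENNReal.ofReal_toReal hfin.ne]
        refine ENNReal.ofReal_le_ofReal ?_
        rw [ENNReal.ofReal_toReal hfin.ne]
        linarith

end Asymptotics

section LowerBound

variable {φ φ₀ : Cn n → EReal} {r : ℝ} {m : ℕ} {f₀ : Fin m → Cn n → ℂ}

/-- If the integrals over the sublevel sets of `φ` decay too fast along a sequence, then `f` is
square integrable with respect to `φ + φ₀`. -/
lemma sqIntNear_of_frequently_lt {f : Cn n → ℂ} (hφ : PSHOn φ (Metric.ball 0 1))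
    (hφ₀ : PSHOn φ₀ (Metric.ball 0 1)) (hf : DifferentiableOn ℂ f (Metric.ball 0 1))
    (hr : 0 < r) (hr1 : r < 1)
    (hfin : ∫⁻ z in Metric.ball 0 r, (‖f z‖₊ : ℝ≥0∞) ^ 2 * wexp (-2) φ₀ z ≠ ⊤)
    {s : ℝ → ℝ} (hs : Tendsto s atTop (𝓝 0))
    (hsub : ∀ t, ∀ z ∈ Metric.ball (0 : Cn n) r, φ z < ((-t : ℝ) : EReal) → ‖z‖ ≤ s t)
    {δ : ℝ} (hδ : 0 < δ)
    (hfreq : ∃ᶠ t in atTop, ∫⁻ z in {z | φ z < ((-t : ℝ) : EReal)} ∩ Metric.ball 0 r,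
      (‖f z‖₊ : ℝ≥0∞) ^ 2 * wexp (-2) φ₀ z ≤ ENNReal.ofReal (Real.exp (-(2 + 2 * δ) * t))) :
    SqIntNear (fun z => wexp (-2) φ z * wexp (-2) φ₀ z) f := by
  obtain ⟨C, hC0, hC⟩ := exists_holomorphic_congr hφ hφ₀ hf hr hr1 hδ hfin
  set R : ℝ := r / (2 * (n + 1)) with hR
  have hR0 : 0 < R := by positivity
  have hR1 : R < 1 := by
    refine (div_le_self hr.le ?_).trans_lt hr1
    have : (0 : ℝ) ≤ n := n.cast_nonneg
    linarith
  have hballR : Metric.ball (0 : Cn n) R ⊆ Metric.ball 0 1 := Metric.ball_subset_ball hR1.le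
  obtain ⟨B, hB, hsup⟩ := exists_sup_le_lintegral (n := n) hR0
  have hs1 : ∀ᶠ t in atTop, s t < r := hs.eventually_lt_const hr
  have hs2 : ∀ᶠ t in atTop, n * s t ^ 2 < r ^ 2 := by
    have h : Tendsto (fun t => n * s t ^ 2) atTop (𝓝 (n * 0 ^ 2)) := (hs.pow 2).const_mul _
    exact h.eventually_lt_const (by simpa using pow_pos hr 2)
  have hex : ∀ k : ℕ, ∃ t : ℝ, (k : ℝ) ≤ t ∧ s t < r ∧ n * s t ^ 2 < r ^ 2 ∧
      ∫⁻ z in {z | φ z < ((-t : ℝ) : EReal)} ∩ Metric.ball 0 r,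
        (‖f z‖₊ : ℝ≥0∞) ^ 2 * wexp (-2) φ₀ z ≤ ENNReal.ofReal (Real.exp (-(2 + 2 * δ) * t)) := by
    intro k
    obtain ⟨t, h1, h2, h3, h4⟩ :=
      (hfreq.and_eventually (hs1.and (hs2.and (eventually_ge_atTop (k : ℝ))))).exists
    exact ⟨t, h4, h2, h3, h1⟩
  choose t ht hst hst' hlt using hex
  have ht0 : ∀ k, 0 ≤ t k := fun k => k.cast_nonneg.trans (ht k)
  choose F hF hFint hFcongr using fun k => hC (t k) (s (t k)) (ht0 k) (hst k) (hst' k) (hsub (t k))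
  have hFle : ∀ k, ∫⁻ z in Metric.ball 0 R, (‖F k z‖₊ : ℝ≥0∞) ^ 2 ≤
      ENNReal.ofReal (C * Real.exp (-δ * t k)) := by
    intro k
    refine (hFint k).trans ((mul_le_mul_right (hlt k) _).trans_eq ?_)
    rw [← ENNReal.ofReal_mul (by positivity), mul_assoc, ← Real.exp_add]
    congr 3
    ring
  have hsq : ∀ k, ∀ z ∈ Metric.ball (0 : Cn n) (R / 2),
      ‖F k z‖ ≤ Real.sqrt (B.toReal * (C * Real.exp (-δ * t k))) := by
    intro k z hz
    refine Real.le_sqrt_of_sq_le ?_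
    have h1 := (hsup (F k) (hF k) z hz).trans (mul_le_mul_right (hFle k) B)
    rw [← ENNReal.ofReal_toReal hB, ← ENNReal.ofReal_mul ENNReal.toReal_nonneg] at h1
    have h2 : (‖F k z‖₊ : ℝ≥0∞) ^ 2 = ENNReal.ofReal (‖F k z‖ ^ 2) := by
      rw [ENNReal.ofReal_pow (norm_nonneg _), ofReal_norm]
      rfl
    rw [h2] at h1
    exact (ENNReal.ofReal_le_ofReal_iff (by positivity)).1 h1
  have htop : Tendsto t atTop atTop := tendsto_atTop_mono ht tendsto_natCast_atTop_atTop
  have hκ : Tendsto (fun k => Real.sqrt (B.toReal * (C * Real.exp (-δ * t k)))) atTop (𝓝 0) := by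
    have h1 : Tendsto (fun k => -δ * t k) atTop atBot :=
      htop.const_mul_atTop_of_neg (neg_lt_zero.2 hδ)
    have h2 := ((Real.tendsto_exp_atBot.comp h1).const_mul C).const_mul B.toReal
    rw [mul_zero, mul_zero] at h2
    have h3 := (Real.continuous_sqrt.tendsto 0).comp h2
    rwa [Real.sqrt_zero] at h3
  have hR2 : Metric.ball (0 : Cn n) (R / 2) ⊆ Metric.ball 0 R :=
    Metric.ball_subset_ball (by linarith)
  obtain ⟨Mf, hMf⟩ := (isCompact_closedBall (0 : Cn n) R).exists_bound_of_continuousOn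
    (hf.continuousOn.mono (Metric.closedBall_subset_ball hR1))
  refine (isGermIdeal_sqIntNear _).of_tendsto (half_pos hR0) (hf.mono (hR2.trans hballR))
    (fun z hz => hMf z (Metric.ball_subset_closedBall (hR2 hz)))
    (fun k => (hF k).mono hR2) hsq hκ fun k => ?_
  refine sqIntNear_of_aemeasurable (Metric.ball_mem_nhds _ hR0) ?_ (hFcongr k)
  have h1 : AEMeasurable (fun z => (‖f z - F k z‖₊ : ℝ≥0∞))
      (volume.restrict (Metric.ball (0 : Cn n) R)) :=
    (((hf.continuousOn.mono hballR).sub (hF k).continuousOn).aestronglyMeasurable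
      Metric.isOpen_ball.measurableSet).enorm
  exact (h1.pow_const 2).mul (((hφ.aemeasurable_wexp _).mul (hφ₀.aemeasurable_wexp _)).mono_measure
    (Measure.restrict_mono_set volume hballR))

lemma eventually_le_lintegral_sublevel (hφ : PSHOn φ (Metric.ball 0 1))
    (hφ₀ : PSHOn φ₀ (Metric.ball 0 1))
    (hf₀ : ∀ j, DifferentiableOn ℂ (f₀ j) (Metric.ball 0 1)) (hr : 0 < r) (hr1 : r < 1)
    (hfin : ∫⁻ z in Metric.ball 0 r, dens0 f₀ φ₀ z < ⊤)
    {s : ℝ → ℝ} (hs : Tendsto s atTop (𝓝 0))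
    (hsub : ∀ t, ∀ z ∈ Metric.ball (0 : Cn n) r, φ z < ((-t : ℝ) : EReal) → ‖z‖ ≤ s t)
    (hnonint : ¬ IntNear fun z => normSq2 f₀ z * wexp (-2) (fun w => φ w + φ₀ w) z)
    {δ : ℝ} (hδ : 0 < δ) :
    ∀ᶠ t in atTop, ENNReal.ofReal (Real.exp (-(2 + 2 * δ) * t)) ≤
      ∫⁻ z in {z | φ z < ((-t : ℝ) : EReal)} ∩ Metric.ball 0 r, dens0 f₀ φ₀ z := by
  by_contra hcon
  have hfreq : ∃ᶠ t in atTop,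
      ∫⁻ z in {z | φ z < ((-t : ℝ) : EReal)} ∩ Metric.ball 0 r, dens0 f₀ φ₀ z ≤
        ENNReal.ofReal (Real.exp (-(2 + 2 * δ) * t)) :=
    (not_eventually.1 hcon).mono fun t ht => (not_le.1 ht).le
  have hle : ∀ j z, (‖f₀ j z‖₊ : ℝ≥0∞) ^ 2 * wexp (-2) φ₀ z ≤ dens0 f₀ φ₀ z := fun j z =>
    mul_le_mul_left (sq_nnnorm_le_normSq2 f₀ j z) _
  have hP : ∀ j ∈ Finset.univ, SqIntNear (fun z => wexp (-2) φ z * wexp (-2) φ₀ z) (f₀ j) :=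
    fun j _ => sqIntNear_of_frequently_lt hφ hφ₀ (hf₀ j) hr hr1
      ((lintegral_mono (hle j)).trans_lt hfin).ne hs hsub hδ
      (hfreq.mono fun t ht => (lintegral_mono (hle j)).trans ht)
  obtain ⟨h, -, U, hU, hUle, hUfin⟩ := lintegral_sum_sq_lt_top Finset.univ hP
  refine hnonint ⟨U ∩ Metric.ball 0 1, inter_mem hU (Metric.ball_mem_nhds _ one_pos), ?_⟩
  refine lt_of_le_of_lt (lintegral_mono_ae ?_)
    ((lintegral_mono_set Set.inter_subset_left).trans_lt hUfin)
  have h1 : ∀ᵐ z ∂volume.restrict (U ∩ Metric.ball 0 1), z ∈ Metric.ball (0 : Cn n) 1 :=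
    ae_mono (Measure.restrict_mono_set volume Set.inter_subset_right)
      (ae_restrict_mem Metric.isOpen_ball.measurableSet)
  filter_upwards [h1,
    ae_mono (Measure.restrict_mono_set volume Set.inter_subset_left) hUle] with z hz hz'
  rwa [wexp_neg_two_add (hφ.lt_top z hz) (hφ₀.lt_top z hz), normSq2, Finset.sum_mul]

lemma polydisc_eq_ball (n : ℕ) : polydisc n = Metric.ball 0 1 := by
  ext z
  rw [mem_ball_zero_iff, pi_norm_lt_iff one_pos]
  rfl

end LowerBound

/-- A function squeezed between exponentials has the expected logarithmic decay. -/
lemma tendsto_neg_log_div {I : ℝ → ℝ≥0∞}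
    (hlow : ∀ δ : ℝ, 0 < δ → ∀ᶠ t in atTop, ENNReal.ofReal (Real.exp (-(2 + 2 * δ) * t)) ≤ I t)
    (hup : ∀ ε : ℝ, 0 < ε → ε < 1 → ∃ K : ℝ, 0 < K ∧
      ∀ᶠ t in atTop, I t ≤ ENNReal.ofReal (Real.exp (-(2 * (1 - ε) * t)) * K)) :
    Tendsto (fun t : ℝ => (- Real.log (I t).toReal) / (2 * t)) atTop (𝓝 1) := by
  have hlow' : ∀ δ : ℝ, 0 < δ → ∀ᶠ t in atTop, Real.exp (-(2 + 2 * δ) * t) ≤ (I t).toReal := by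
    intro δ hδ
    obtain ⟨K, -, hK⟩ := hup (1 / 2) (by norm_num) (by norm_num)
    filter_upwards [hlow δ hδ, hK] with t h1 h2
    exact (ENNReal.ofReal_le_iff_le_toReal (h2.trans_lt ENNReal.ofReal_lt_top).ne).1 h1
  refine tendsto_order.2 ⟨fun a ha => ?_, fun b hb => ?_⟩
  · obtain ⟨ε, hε0, hε1, hεa⟩ : ∃ ε : ℝ, 0 < ε ∧ ε < 1 ∧ 2 * ε ≤ 1 - a := by
      refine ⟨min (1 / 2) ((1 - a) / 2), lt_min (by norm_num) (by linarith), ?_, ?_⟩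
      · exact (min_le_left _ _).trans_lt (by norm_num)
      · linarith [min_le_right (1 / 2) ((1 - a) / 2)]
    obtain ⟨K, hK0, hK⟩ := hup ε hε0 hε1
    filter_upwards [hK, hlow' 1 one_pos, eventually_gt_atTop 0,
      eventually_gt_atTop (Real.log K / (2 * ε))] with t h1 h2 ht htK
    have hpos : 0 < (I t).toReal := (Real.exp_pos _).trans_le h2
    have h3 : (I t).toReal ≤ Real.exp (-(2 * (1 - ε) * t)) * K :=
      ENNReal.toReal_le_of_le_ofReal (by positivity) h1
    have h4 := Real.log_le_log hpos h3
    rw [Real.log_mul (Real.exp_pos _).ne' hK0.ne', Real.log_exp] at h4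
    rw [div_lt_iff₀ (by positivity)] at htK
    rw [lt_div_iff₀ (by positivity)]
    nlinarith [mul_le_mul_of_nonneg_right hεa ht.le]
  · have hδ : 0 < (b - 1) / 2 := by linarith
    filter_upwards [hlow' _ hδ, eventually_gt_atTop 0] with t h2 ht
    have h4 := Real.log_le_log (Real.exp_pos _) h2
    rw [Real.log_exp] at h4
    rw [div_lt_iff₀ (by positivity)]
    nlinarith [mul_pos ht hδ]

/-- exact asymptotic `-log ∫_{{φ<-t}∩U} |f₀|²e^{-2φ₀} ∼ 2t`. -/
theorem statement11 {n m : ℕ} (f₀ : Fin m → Cn n → ℂ) (φ φ₀ : Cn n → EReal)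
    (hf₀ : ∀ j, DifferentiableOn ℂ (f₀ j) (polydisc n))
    (hφ : PSHOn φ (polydisc n)) (hφ₀ : PSHOn φ₀ (polydisc n))
    (hint₀ : IntNear (dens0 f₀ φ₀))
    (hN : ∃ N : ℝ, 0 < N ∧ leO (fun z => (N : EReal) * elog ‖z‖) φ)
    (hnonint : ¬ IntNear fun z => normSq2 f₀ z * wexp (-2) (fun w => φ w + φ₀ w) z)
    (hε : ∀ ε : ℝ, 0 < ε → ε < 1 →
      IntNear fun z =>
        normSq2 f₀ z * wexp (-2) (fun w => ((1 - ε : ℝ) : EReal) * φ w + φ₀ w) z) :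
    ∃ U ∈ 𝓝 (0 : Cn n), closure U ⊆ polydisc n ∧
      Tendsto (fun t : ℝ =>
          (- Real.log
              ((∫⁻ z in {z : Cn n | φ z < ((-t : ℝ) : EReal)} ∩ U, dens0 f₀ φ₀ z).toReal))
            / (2 * t)) atTop (𝓝 1) := by
  rw [polydisc_eq_ball] at *
  obtain ⟨N, hN0, C, hC⟩ := hN
  obtain ⟨V, hV, hVfin⟩ := hint₀
  obtain ⟨ρ, hρ, hball⟩ := Metric.mem_nhds_iff.1 (inter_mem hV hC)
  obtain ⟨r, hr, hrρ, hr1⟩ : ∃ r : ℝ, 0 < r ∧ r ≤ ρ ∧ r < 1 :=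
    ⟨min ρ (1 / 2), lt_min hρ (by norm_num), min_le_left _ _,
      (min_le_right _ _).trans_lt (by norm_num)⟩
  have hrball : Metric.ball (0 : Cn n) r ⊆ Metric.ball 0 ρ := Metric.ball_subset_ball hrρ
  have hsub : ∀ t : ℝ, ∀ z ∈ Metric.ball (0 : Cn n) r, φ z < ((-t : ℝ) : EReal) →
      ‖z‖ ≤ Real.exp ((C - t) / N) := fun t z hz hlt =>
    norm_le_of_lt_of_elog_le hN0 (hball (hrball hz)).2 hlt
  have hs : Tendsto (fun t : ℝ => Real.exp ((C - t) / N)) atTop (𝓝 0) :=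
    Real.tendsto_exp_atBot.comp ((tendsto_atBot_add_const_left atTop C
      tendsto_neg_atTop_atBot).atBot_div_const hN0)
  have hfin : ∫⁻ z in Metric.ball 0 r, dens0 f₀ φ₀ z < ⊤ :=
    (lintegral_mono_set fun z hz => (hball (hrball hz)).1).trans_lt hVfin
  refine ⟨Metric.ball 0 r, Metric.ball_mem_nhds _ hr,
    Metric.closure_ball_subset_closedBall.trans (Metric.closedBall_subset_ball hr1),
    tendsto_neg_log_div (fun δ hδ => ?_) fun ε hε0 hε1 => ?_⟩
  · exact eventually_le_lintegral_sublevel hφ hφ₀ hf₀ hr hr1 hfin hs hsub hnonint hδ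
  · exact exists_lintegral_sublevel_le hφ hφ₀ hr1 hs hsub (by linarith) (hε ε hε0 hε1)
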